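/- arXiv:2107.03118 — 2 statements merged into one kernel-verified Lean document; each statement's English description precedes it below -/
import Mathlib

section
/- As t → ∞, ∫₀¹ (u_x² + w_x² + θ_x²)(x,t) dx → 0, and w(x,t) → 0 uniformly in x ∈ [0,1]. -/
open MeasureTheory Real Set Filter Topology

/-- A classical solution on `[0,1] × [0,∞)` of the rescaled stress-free
one-dimensional compressible Navier–Stokes system
`u_t + u = v_x`, `v_t = ((v_x - θ)/u)_x`,
`θ_t = -θ v_x/u + v_x²/u + (θ^β θ_x/u)_x` (β > 0),
with stress-free, thermally insulated boundary conditions and positive data. -/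
structure NSSol where
  β : ℝ
  hβ : 0 < β
  u : ℝ → ℝ → ℝ
  v : ℝ → ℝ → ℝ
  θ : ℝ → ℝ → ℝ
  ux : ℝ → ℝ → ℝ
  ut : ℝ → ℝ → ℝ
  vx : ℝ → ℝ → ℝ
  vt : ℝ → ℝ → ℝ
  vxx : ℝ → ℝ → ℝ
  θx : ℝ → ℝ → ℝ
  θt : ℝ → ℝ → ℝ
  θxx : ℝ → ℝ → ℝ
  hu_pos : ∀ x ∈ Icc (0:ℝ) 1, ∀ t ∈ Ici (0:ℝ), 0 < u x t
  hθ_pos : ∀ x ∈ Icc (0:ℝ) 1, ∀ t ∈ Ici (0:ℝ), 0 < θ x t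
  hux : ∀ x ∈ Icc (0:ℝ) 1, ∀ t ∈ Ici (0:ℝ),
    HasDerivWithinAt (fun y => u y t) (ux x t) (Icc 0 1) x
  hut : ∀ x ∈ Icc (0:ℝ) 1, ∀ t ∈ Ici (0:ℝ),
    HasDerivWithinAt (fun s => u x s) (ut x t) (Ici 0) t
  hvx : ∀ x ∈ Icc (0:ℝ) 1, ∀ t ∈ Ici (0:ℝ),
    HasDerivWithinAt (fun y => v y t) (vx x t) (Icc 0 1) x
  hvt : ∀ x ∈ Icc (0:ℝ) 1, ∀ t ∈ Ici (0:ℝ),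
    HasDerivWithinAt (fun s => v x s) (vt x t) (Ici 0) t
  hvxx : ∀ x ∈ Icc (0:ℝ) 1, ∀ t ∈ Ici (0:ℝ),
    HasDerivWithinAt (fun y => vx y t) (vxx x t) (Icc 0 1) x
  hθx : ∀ x ∈ Icc (0:ℝ) 1, ∀ t ∈ Ici (0:ℝ),
    HasDerivWithinAt (fun y => θ y t) (θx x t) (Icc 0 1) x
  hθt : ∀ x ∈ Icc (0:ℝ) 1, ∀ t ∈ Ici (0:ℝ),
    HasDerivWithinAt (fun s => θ x s) (θt x t) (Ici 0) t
  hθxx : ∀ x ∈ Icc (0:ℝ) 1, ∀ t ∈ Ici (0:ℝ),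
    HasDerivWithinAt (fun y => θx y t) (θxx x t) (Icc 0 1) x
  hu_cont : ContinuousOn (Function.uncurry u) (Icc 0 1 ×ˢ Ici 0)
  hv_cont : ContinuousOn (Function.uncurry v) (Icc 0 1 ×ˢ Ici 0)
  hθ_cont : ContinuousOn (Function.uncurry θ) (Icc 0 1 ×ˢ Ici 0)
  hux_cont : ContinuousOn (Function.uncurry ux) (Icc 0 1 ×ˢ Ici 0)
  hut_cont : ContinuousOn (Function.uncurry ut) (Icc 0 1 ×ˢ Ici 0)
  hvx_cont : ContinuousOn (Function.uncurry vx) (Icc 0 1 ×ˢ Ici 0)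
  hvt_cont : ContinuousOn (Function.uncurry vt) (Icc 0 1 ×ˢ Ici 0)
  hvxx_cont : ContinuousOn (Function.uncurry vxx) (Icc 0 1 ×ˢ Ici 0)
  hθx_cont : ContinuousOn (Function.uncurry θx) (Icc 0 1 ×ˢ Ici 0)
  hθt_cont : ContinuousOn (Function.uncurry θt) (Icc 0 1 ×ˢ Ici 0)
  hθxx_cont : ContinuousOn (Function.uncurry θxx) (Icc 0 1 ×ˢ Ici 0)
  mass : ∀ x ∈ Icc (0:ℝ) 1, ∀ t ∈ Ici (0:ℝ), ut x t + u x t = vx x t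
  momentum : ∀ x ∈ Icc (0:ℝ) 1, ∀ t ∈ Ici (0:ℝ),
    HasDerivWithinAt (fun y => (vx y t - θ y t) / u y t) (vt x t) (Icc 0 1) x
  energyEq : ∀ x ∈ Icc (0:ℝ) 1, ∀ t ∈ Ici (0:ℝ),
    HasDerivWithinAt (fun y => θ y t ^ β * θx y t / u y t)
      (θt x t + θ x t * vx x t / u x t - (vx x t) ^ 2 / u x t) (Icc 0 1) x
  bc0 : ∀ t ∈ Ici (0:ℝ), (vx 0 t - θ 0 t) / u 0 t = 0
  bc1 : ∀ t ∈ Ici (0:ℝ), (vx 1 t - θ 1 t) / u 1 t = 0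
  bcθ0 : ∀ t ∈ Ici (0:ℝ), θx 0 t = 0
  bcθ1 : ∀ t ∈ Ici (0:ℝ), θx 1 t = 0

namespace NSSol

/-- The initial energy `E₀ = ∫₀¹ (v₀²/2 + θ₀) dx`. -/
noncomputable def E₀ (S : NSSol) : ℝ := ∫ x in (0:ℝ)..1, ((S.v x 0) ^ 2 / 2 + S.θ x 0)

/-- The dissipation functional
`V(t) = ∫₀¹ (θ^β θ_x²/(uθ²) + (v_x − θ)²/(uθ)) dx`. -/
noncomputable def V (S : NSSol) (t : ℝ) : ℝ :=
  ∫ x in (0:ℝ)..1,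
    (S.θ x t ^ S.β * (S.θx x t) ^ 2 / (S.u x t * (S.θ x t) ^ 2)
      + (S.vx x t - S.θ x t) ^ 2 / (S.u x t * S.θ x t))

/-- The auxiliary velocity
`w(x,t) = v(x,t) − ∫₀¹ v₀ dξ − ∫₀ˣ u(ξ,t) dξ + ∫₀¹∫₀^ξ u(η,t) dη dξ`,
which satisfies `w_x = v_x − u` and `∫₀¹ w dx = 0`. -/
noncomputable def w (S : NSSol) (x t : ℝ) : ℝ :=
  S.v x t - (∫ ξ in (0:ℝ)..1, S.v ξ 0) - (∫ ξ in (0:ℝ)..x, S.u ξ t)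
    + ∫ ξ in (0:ℝ)..1, ∫ η in (0:ℝ)..ξ, S.u η t

/-- The asymptotic state `A = 2√(36 + 3(2E₀ − (∫₀¹ v₀ dx)²)) − 12`. -/
noncomputable def A (S : NSSol) : ℝ :=
  2 * Real.sqrt (36 + 3 * (2 * S.E₀ - (∫ x in (0:ℝ)..1, S.v x 0) ^ 2)) - 12

end NSSol

theorem integral_eq_zero_of_hasDerivAt {g g' : ℝ → ℝ} (hg : Continuous g) (hg' : Continuous g')
    (hd : ∀ x ∈ Ioo (0:ℝ) 1, HasDerivAt g (g' x) x) (h0 : g 0 = 0) (h1 : g 1 = 0) :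
    ∫ x in (0:ℝ)..1, g' x = 0 := by
  rw [intervalIntegral.integral_eq_sub_of_hasDerivAt_of_le zero_le_one hg.continuousOn hd
    (hg'.intervalIntegrable _ _), h0, h1, sub_zero]

theorem integral_le_add_two {f g₁ g₂ : ℝ → ℝ} {a b : ℝ} (hab : a ≤ b) (c₁ c₂ : ℝ)
    (hf : Continuous f) (h₁ : Continuous g₁) (h₂ : Continuous g₂)
    (h : ∀ x ∈ Icc a b, f x ≤ c₁ * g₁ x + c₂ * g₂ x) :
    ∫ x in a..b, f x ≤ c₁ * (∫ x in a..b, g₁ x) + c₂ * ∫ x in a..b, g₂ x := by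
  rw [← intervalIntegral.integral_const_mul, ← intervalIntegral.integral_const_mul,
    ← intervalIntegral.integral_add ((h₁.const_mul _).intervalIntegrable _ _)
      ((h₂.const_mul _).intervalIntegrable _ _)]
  exact intervalIntegral.integral_mono_on hab (hf.intervalIntegrable _ _)
    (((h₁.const_mul _).add (h₂.const_mul _)).intervalIntegrable _ _) h

theorem integral_le_mul {f g : ℝ → ℝ} {a b : ℝ} (hab : a ≤ b) (c : ℝ)
    (hf : Continuous f) (hg : Continuous g) (h : ∀ x ∈ Icc a b, f x ≤ c * g x) :
    ∫ x in a..b, f x ≤ c * ∫ x in a..b, g x := by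
  rw [← intervalIntegral.integral_const_mul]
  exact intervalIntegral.integral_mono_on hab (hf.intervalIntegrable _ _)
    ((hg.const_mul _).intervalIntegrable _ _) h

theorem integral_le_add_four {f g₁ g₂ g₃ g₄ : ℝ → ℝ} {a b : ℝ} (hab : a ≤ b) (c₁ c₂ c₃ c₄ : ℝ)
    (hf : Continuous f) (h₁ : Continuous g₁) (h₂ : Continuous g₂) (h₃ : Continuous g₃)
    (h₄ : Continuous g₄)
    (h : ∀ x ∈ Icc a b, f x ≤ c₁ * g₁ x + c₂ * g₂ x + c₃ * g₃ x + c₄ * g₄ x) :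
    ∫ x in a..b, f x ≤ c₁ * (∫ x in a..b, g₁ x) + c₂ * (∫ x in a..b, g₂ x)
      + c₃ * (∫ x in a..b, g₃ x) + c₄ * ∫ x in a..b, g₄ x := by
  have A := integral_le_add_two (f := f) (g₁ := fun x => c₁ * g₁ x + c₂ * g₂ x)
    (g₂ := fun x => c₃ * g₃ x + c₄ * g₄ x) hab 1 1 hf (by fun_prop) (by fun_prop)
    (fun x hx => by linarith [h x hx])
  have B := integral_le_add_two (f := fun x => c₁ * g₁ x + c₂ * g₂ x) hab c₁ c₂ (by fun_prop) h₁ h₂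
    (fun x _ => le_rfl)
  have C := integral_le_add_two (f := fun x => c₃ * g₃ x + c₄ * g₄ x) hab c₃ c₄ (by fun_prop) h₃ h₄
    (fun x _ => le_rfl)
  linarith

theorem sq_integral_mul_le {f g : ℝ → ℝ} {a b : ℝ} (hab : a ≤ b) (hf : Continuous f)
    (hg : Continuous g) :
    (∫ x in a..b, f x * g x) ^ 2 ≤ (∫ x in a..b, f x ^ 2) * ∫ x in a..b, g x ^ 2 := by
  have key : ∀ s : ℝ, 0 ≤ (∫ x in a..b, g x ^ 2) * (s * s) + (-2 * ∫ x in a..b, f x * g x) * s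
      + ∫ x in a..b, f x ^ 2 := by
    intro s
    have h0 : 0 ≤ ∫ x in a..b, (f x - s * g x) ^ 2 :=
      intervalIntegral.integral_nonneg hab fun x _ => sq_nonneg _
    have := integral_le_add_four (f := fun x => (f x - s * g x) ^ 2) (g₁ := fun x => g x ^ 2)
      (g₂ := fun x => f x * g x) (g₃ := fun x => f x ^ 2) (g₄ := fun _ => (0:ℝ)) hab
      (s * s) (-2 * s) 1 0 (by fun_prop) (by fun_prop) (by fun_prop) (by fun_prop) (by fun_prop)
      (fun x _ => by ring_nf; exact le_rfl)
    nlinarith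
  have := discrim_le_zero key
  unfold discrim at this
  nlinarith

theorem abs_sub_le_integral_abs {f f' : ℝ → ℝ} (hf : Continuous f) (hf' : Continuous f')
    (hd : ∀ x ∈ Ioo (0:ℝ) 1, HasDerivAt f (f' x) x) {x y : ℝ} (hx : x ∈ Icc (0:ℝ) 1)
    (hy : y ∈ Icc (0:ℝ) 1) : |f x - f y| ≤ ∫ z in (0:ℝ)..1, |f' z| := by
  wlog hxy : y ≤ x generalizing x y
  · rw [abs_sub_comm]; exact this hy hx (le_of_not_ge hxy)
  rw [← intervalIntegral.integral_eq_sub_of_hasDerivAt_of_le hxy hf.continuousOn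
    (fun z hz => hd z ⟨hy.1.trans_lt hz.1, hz.2.trans_le hx.2⟩) (hf'.intervalIntegrable _ _)]
  refine (intervalIntegral.abs_integral_le_integral_abs hxy).trans ?_
  exact intervalIntegral.integral_mono_interval hy.1 hxy hx.2
    (Eventually.of_forall fun z => abs_nonneg _) (hf'.abs.intervalIntegrable _ _)

theorem continuous_integral_of_continuous {f : ℝ → ℝ → ℝ} (hf : Continuous (Function.uncurry f))
    (a b : ℝ) : Continuous fun t => ∫ x in a..b, f x t := by
  have : Continuous (Function.uncurry fun t x => f x t) := hf.comp continuous_swap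
  exact intervalIntegral.continuous_parametric_intervalIntegral_of_continuous' this a b

theorem hasDerivAt_integral_param {f f' : ℝ → ℝ → ℝ} {a b t₀ : ℝ} (hab : a ≤ b)
    (hf : Continuous (Function.uncurry f)) (hf' : Continuous (Function.uncurry f')) (ht₀ : 0 < t₀)
    (hd : ∀ x ∈ Icc a b, ∀ t > 0, HasDerivAt (f x) (f' x t) t) :
    HasDerivAt (fun t => ∫ x in a..b, f x t) (∫ x in a..b, f' x t₀) t₀ := by
  obtain ⟨C, hC⟩ := (isCompact_Icc.prod isCompact_Icc).exists_bound_of_continuousOn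
    (s := Icc a b ×ˢ Icc (t₀ / 2) (2 * t₀)) hf'.continuousOn
  refine (intervalIntegral.hasDerivAt_integral_of_dominated_loc_of_deriv_le
    (F := fun t x => f x t) (F' := fun t x => f' x t) (bound := fun _ => C)
    (s := Ioo (t₀ / 2) (2 * t₀)) (Ioo_mem_nhds (by linarith) (by linarith))
    ?_ ?_ ?_ ?_ ?_ ?_).2
  · exact Eventually.of_forall fun t =>
      (show Continuous fun x => f x t by fun_prop).aestronglyMeasurable
  · exact (show Continuous fun x => f x t₀ by fun_prop).intervalIntegrable _ _
  · exact (show Continuous fun x => f' x t₀ by fun_prop).aestronglyMeasurable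
  · refine Eventually.of_forall fun x hx t ht => ?_
    rw [uIoc_of_le hab] at hx
    exact hC (x, t) ⟨⟨hx.1.le, hx.2⟩, ht.1.le, ht.2.le⟩
  · exact intervalIntegrable_const
  · refine Eventually.of_forall fun x hx t ht => ?_
    rw [uIoc_of_le hab] at hx
    exact hd x ⟨hx.1.le, hx.2⟩ t (by linarith [ht.1])

theorem hasDerivAt_integral_mul_of_eq_zero {b c c' : ℝ → ℝ → ℝ} {t₀ : ℝ}
    (hb : Continuous (Function.uncurry b)) (hc' : Continuous (Function.uncurry c')) (ht₀ : 0 < t₀)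
    (hd : ∀ x ∈ Icc (0:ℝ) 1, ∀ t > 0, HasDerivAt (c x) (c' x t) t) :
    HasDerivAt (fun t => ∫ x in (0:ℝ)..1, b x t * (c x t - c x t₀))
      (∫ x in (0:ℝ)..1, b x t₀ * c' x t₀) t₀ := by
  let d : ℝ → ℝ → ℝ := fun x t => ∫ l in (0:ℝ)..1, c' x (t₀ + l * (t - t₀))
  have hdc : Continuous (Function.uncurry d) := by
    refine intervalIntegral.continuous_parametric_intervalIntegral_of_continuous'
      (f := fun (p : ℝ × ℝ) l => c' p.1 (t₀ + l * (p.2 - t₀))) (by fun_prop) 0 1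
  let G : ℝ → ℝ := fun t => ∫ x in (0:ℝ)..1, b x t * d x t
  have hG : Continuous G := by
    refine continuous_integral_of_continuous (f := fun x t => b x t * d x t) (by fun_prop) 0 1
  have hG0 : G t₀ = ∫ x in (0:ℝ)..1, b x t₀ * c' x t₀ := by
    simp only [G, d, sub_self, mul_zero, add_zero, intervalIntegral.integral_const, sub_zero,
      one_smul]
  have heq : ∀ t > 0, (∫ x in (0:ℝ)..1, b x t * (c x t - c x t₀)) = (t - t₀) * G t := by
    intro t ht
    rw [← intervalIntegral.integral_const_mul]
    refine intervalIntegral.integral_congr fun x hx => ?_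
    rw [uIcc_of_le zero_le_one] at hx
    have hpos : ∀ l ∈ Icc (0:ℝ) 1, 0 < t₀ + l * (t - t₀) := by
      intro l hl
      rcases eq_or_lt_of_le hl.1 with h | h
      · rw [← h]; linarith
      · nlinarith [hl.2, mul_pos h ht, mul_nonneg (sub_nonneg.2 hl.2) ht₀.le]
    have : c x t - c x t₀ = ∫ l in (0:ℝ)..1, c' x (t₀ + l * (t - t₀)) * (t - t₀) := by
      rw [intervalIntegral.integral_eq_sub_of_hasDerivAt
        (f := fun l => c x (t₀ + l * (t - t₀))) (a := 0) (b := 1)]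
      · simp
      · intro l hl
        rw [uIcc_of_le zero_le_one] at hl
        have h1 : HasDerivAt (fun l : ℝ => t₀ + l * (t - t₀)) (t - t₀) l := by
          simpa using ((hasDerivAt_id l).mul_const (t - t₀)).const_add t₀
        exact (hd x hx _ (hpos l hl)).comp l h1
      · exact Continuous.intervalIntegrable (by fun_prop) _ _
    simp only [this, d, intervalIntegral.integral_mul_const]
    ring
  have h1 : HasDerivAt (fun t => (t - t₀) * G t) (G t₀) t₀ := by
    rw [hasDerivAt_iff_tendsto_slope]
    refine (hG.tendsto t₀ |>.mono_left nhdsWithin_le_nhds).congr' ?_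
    filter_upwards [self_mem_nhdsWithin] with t ht
    have : t - t₀ ≠ 0 := sub_ne_zero.2 ht
    simp [slope_def_field, this]
  rw [hG0] at h1
  refine h1.congr_of_eventuallyEq ?_
  filter_upwards [lt_mem_nhds ht₀] with t ht using heq t ht

/-- Weighted energy identity for a flux `a` vanishing at the end points, with `p_x = u a + q`. -/
theorem hasDerivAt_integral_mul_sq {u u' a a' p px p' q q' : ℝ → ℝ → ℝ} {t₀ : ℝ} (ht₀ : 0 < t₀)
    (hu : Continuous (Function.uncurry u)) (hu' : Continuous (Function.uncurry u'))
    (ha : Continuous (Function.uncurry a)) (ha' : Continuous (Function.uncurry a'))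
    (hp : Continuous (Function.uncurry p)) (hp' : Continuous (Function.uncurry p'))
    (hpx : Continuous (Function.uncurry px))
    (hq : Continuous (Function.uncurry q)) (hq' : Continuous (Function.uncurry q'))
    (hut : ∀ x ∈ Icc (0:ℝ) 1, ∀ t > 0, HasDerivAt (u x) (u' x t) t)
    (hpt : ∀ x ∈ Icc (0:ℝ) 1, ∀ t > 0, HasDerivAt (p x) (p' x t) t)
    (hqt : ∀ x ∈ Icc (0:ℝ) 1, ∀ t > 0, HasDerivAt (q x) (q' x t) t)
    (hax : ∀ t > 0, ∀ x ∈ Ioo (0:ℝ) 1, HasDerivAt (fun y => a y t) (a' x t) x)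
    (hpxd : ∀ t > 0, ∀ x ∈ Ioo (0:ℝ) 1, HasDerivAt (fun y => p y t) (px x t) x)
    (heq : ∀ x t, px x t = u x t * a x t + q x t)
    (ha0 : ∀ t, a 0 t = 0) (ha1 : ∀ t, a 1 t = 0) :
    HasDerivAt (fun t => ∫ x in (0:ℝ)..1, u x t * a x t ^ 2)
      (∫ x in (0:ℝ)..1, (-2 * a' x t₀ * p' x t₀ - 2 * a x t₀ * q' x t₀
        - a x t₀ ^ 2 * u' x t₀)) t₀ := by
  have h1 := hasDerivAt_integral_mul_of_eq_zero (b := fun x t => -(a' x t + a' x t₀))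
    (by fun_prop) hp' ht₀ hpt
  have h2 := hasDerivAt_integral_mul_of_eq_zero (b := fun x t => -(a x t + a x t₀))
    (by fun_prop) hq' ht₀ hqt
  have h3 := hasDerivAt_integral_mul_of_eq_zero (b := fun x t => -(a x t * a x t₀))
    (by fun_prop) hu' ht₀ hut
  have h4 := ((h1.add h2).add h3).add_const (∫ x in (0:ℝ)..1, u x t₀ * a x t₀ ^ 2)
  rw [← intervalIntegral.integral_add (Continuous.intervalIntegrable (by fun_prop) _ _)
      (Continuous.intervalIntegrable (by fun_prop) _ _),
    ← intervalIntegral.integral_add (Continuous.intervalIntegrable (by fun_prop) _ _)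
      (Continuous.intervalIntegrable (by fun_prop) _ _)] at h4
  have h5 : (∫ x in (0:ℝ)..1, (-2 * a' x t₀ * p' x t₀ - 2 * a x t₀ * q' x t₀
        - a x t₀ ^ 2 * u' x t₀)) = ∫ x in (0:ℝ)..1, (-(a' x t₀ + a' x t₀) * p' x t₀
        + -(a x t₀ + a x t₀) * q' x t₀ + -(a x t₀ * a x t₀) * u' x t₀) :=
    intervalIntegral.integral_congr fun x _ => by ring
  rw [h5]
  refine h4.congr_of_eventuallyEq ?_
  filter_upwards [lt_mem_nhds ht₀] with t ht
  have hz : ∫ x in (0:ℝ)..1, ((a' x t + a' x t₀) * (p x t - p x t₀)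
      + (a x t + a x t₀) * (px x t - px x t₀)) = 0 := by
    refine integral_eq_zero_of_hasDerivAt (g := fun x => (a x t + a x t₀) * (p x t - p x t₀))
      (by fun_prop) (by fun_prop) (fun x hx => ?_) ?_ ?_
    · exact ((hax t ht x hx).add (hax t₀ ht₀ x hx)).mul
        ((hpxd t ht x hx).sub (hpxd t₀ ht₀ x hx))
    · simp [ha0]
    · simp [ha1]
  simp only [Pi.add_apply]
  suffices h : (∫ x in (0:ℝ)..1, u x t * a x t ^ 2) - ∫ x in (0:ℝ)..1,
      ((a' x t + a' x t₀) * (p x t - p x t₀) + (a x t + a x t₀) * (px x t - px x t₀))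
      = (∫ x in (0:ℝ)..1, -(a' x t + a' x t₀) * (p x t - p x t₀))
        + (∫ x in (0:ℝ)..1, -(a x t + a x t₀) * (q x t - q x t₀))
        + (∫ x in (0:ℝ)..1, -(a x t * a x t₀) * (u x t - u x t₀))
        + ∫ x in (0:ℝ)..1, u x t₀ * a x t₀ ^ 2 by
    rw [hz, sub_zero] at h; exact h
  rw [← intervalIntegral.integral_sub (Continuous.intervalIntegrable (by fun_prop) _ _)
      (Continuous.intervalIntegrable (by fun_prop) _ _),
    ← intervalIntegral.integral_add (Continuous.intervalIntegrable (by fun_prop) _ _)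
      (Continuous.intervalIntegrable (by fun_prop) _ _),
    ← intervalIntegral.integral_add (Continuous.intervalIntegrable (by fun_prop) _ _)
      (Continuous.intervalIntegrable (by fun_prop) _ _),
    ← intervalIntegral.integral_add (Continuous.intervalIntegrable (by fun_prop) _ _)
      (Continuous.intervalIntegrable (by fun_prop) _ _)]
  refine intervalIntegral.integral_congr fun x _ => ?_
  simp only [heq]
  ring

theorem sub_le_integral_of_hasDerivAt {f f' g : ℝ → ℝ} {a b : ℝ} (hab : a ≤ b)
    (hf : Continuous f) (hg : Continuous g) (hd : ∀ t ∈ Ioo a b, HasDerivAt f (f' t) t)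
    (h : ∀ t ∈ Ioo a b, f' t ≤ g t) : f b - f a ≤ ∫ t in a..b, g t :=
  intervalIntegral.sub_le_integral_of_hasDeriv_right_of_le hab hf.continuousOn
    (fun t ht => (hd t ht).hasDerivWithinAt) hg.integrableOn_Icc h

theorem hasDerivAt_integral_of_continuous {g : ℝ → ℝ} (hg : Continuous g) (a t : ℝ) :
    HasDerivAt (fun t => ∫ s in a..t, g s) (g t) t :=
  intervalIntegral.integral_hasDerivAt_right (hg.intervalIntegrable _ _)
    hg.aestronglyMeasurable.stronglyMeasurableAtFilter hg.continuousAt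

theorem continuous_integral_upper {g : ℝ → ℝ} (hg : Continuous g) (a : ℝ) :
    Continuous fun t => ∫ s in a..t, g s :=
  continuous_iff_continuousAt.2 fun t => (hasDerivAt_integral_of_continuous hg a t).continuousAt

/-- Uniform Grönwall inequality on a unit interval. -/
theorem uniform_gronwall {f f' g h : ℝ → ℝ} {s : ℝ} (hf : Continuous f) (hg : Continuous g)
    (hh : Continuous h) (hf0 : ∀ t ∈ Icc s (s + 1), 0 ≤ f t)
    (hg0 : ∀ t ∈ Icc s (s + 1), 0 ≤ g t) (hh0 : ∀ t ∈ Icc s (s + 1), 0 ≤ h t)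
    (hd : ∀ t ∈ Ioo s (s + 1), HasDerivAt f (f' t) t)
    (hle : ∀ t ∈ Ioo s (s + 1), f' t ≤ g t * f t + h t) :
    f (s + 1) ≤ exp (∫ t in s..s + 1, g t) * ((∫ t in s..s + 1, f t) + ∫ t in s..s + 1, h t) := by
  have hG := continuous_integral_upper hg s
  have key := sub_le_integral_of_hasDerivAt (f := fun t => (t - s) * f t * exp (-∫ r in s..t, g r))
    (f' := fun t => (1 * f t + (t - s) * f' t) * exp (-∫ r in s..t, g r)
      + (t - s) * f t * (exp (-∫ r in s..t, g r) * -g t)) (g := fun t => f t + h t)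
    (a := s) (b := s + 1) (by linarith) (by fun_prop) (by fun_prop)
    (fun t ht => by
      have h1 : HasDerivAt (fun t : ℝ => t - s) 1 t := by
        simpa using (hasDerivAt_id t).sub_const s
      exact (h1.mul (hd t ht)).mul (hasDerivAt_integral_of_continuous hg s t).neg.exp)
    (fun t ht => by
      have ht' : t ∈ Icc s (s + 1) := ⟨ht.1.le, ht.2.le⟩
      have hGn : 0 ≤ ∫ r in s..t, g r :=
        intervalIntegral.integral_nonneg ht.1.le fun r hr => hg0 r ⟨hr.1, hr.2.trans ht.2.le⟩
      have he : exp (-∫ r in s..t, g r) ≤ 1 := exp_le_one_iff.2 (by linarith)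
      have hp := exp_pos (-∫ r in s..t, g r)
      have hb : f t + (t - s) * (f' t - g t * f t) ≤ f t + h t := by
        nlinarith [hle t ht, hh0 t ht', ht.1, ht.2]
      have hb0 : 0 ≤ f t + h t := add_nonneg (hf0 t ht') (hh0 t ht')
      calc _ = (f t + (t - s) * (f' t - g t * f t)) * exp (-∫ r in s..t, g r) := by ring
        _ ≤ (f t + h t) * exp (-∫ r in s..t, g r) := by gcongr
        _ ≤ _ := mul_le_of_le_one_right hb0 he)
  simp only [add_sub_cancel_left, one_mul, sub_self, zero_mul, sub_zero] at key
  rw [intervalIntegral.integral_add (hf.intervalIntegrable _ _) (hh.intervalIntegrable _ _)] at key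
  calc f (s + 1) = exp (∫ t in s..s + 1, g t) * (f (s + 1) * exp (-∫ t in s..s + 1, g t)) := by
        rw [mul_left_comm, ← exp_add, add_neg_cancel, exp_zero, mul_one]
    _ ≤ _ := by gcongr

/-- A nonnegative function with `f' ≤ -c f + g` and `g → 0` tends to zero. -/
theorem tendsto_zero_of_deriv_le {f f' g : ℝ → ℝ} {c t₀ : ℝ} (hc : 0 < c)
    (hf : Continuous f) (hf0 : ∀ t ≥ t₀, 0 ≤ f t) (hg : Tendsto g atTop (𝓝 0))
    (hd : ∀ t > t₀, HasDerivAt f (f' t) t) (hle : ∀ t > t₀, f' t ≤ -c * f t + g t) :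
    Tendsto f atTop (𝓝 0) := by
  rw [Metric.tendsto_atTop]
  intro ε hε
  obtain ⟨T, hT⟩ := eventually_atTop.1
    (hg.eventually (gt_mem_nhds (show 0 < c * (ε / 2) by positivity)))
  set s := max T t₀
  have hanti : ∀ t ≥ s, (f t - ε / 2) * exp (c * t) ≤ (f s - ε / 2) * exp (c * s) := by
    intro t ht
    have := sub_le_integral_of_hasDerivAt (f := fun t => (f t - ε / 2) * exp (c * t))
      (f' := fun t => f' t * exp (c * t) + (f t - ε / 2) * (exp (c * t) * (c * 1)))
      (g := fun _ => 0) ht (by fun_prop) (by fun_prop)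
      (fun r hr => ((hd r ((le_max_right _ _).trans_lt hr.1)).sub_const _).mul
        ((hasDerivAt_id r).const_mul c).exp)
      (fun r hr => by
        have h1 := hle r ((le_max_right _ _).trans_lt hr.1)
        have h2 := hT r ((le_max_left _ _).trans hr.1.le)
        have h3 : f' r + c * (f r - ε / 2) ≤ 0 := by linarith
        calc _ = (f' r + c * (f r - ε / 2)) * exp (c * r) := by ring
          _ ≤ 0 := mul_nonpos_of_nonpos_of_nonneg h3 (exp_pos _).le)
    simp only [intervalIntegral.integral_zero] at this
    linarith
  have hlim : Tendsto (fun t => |(f s - ε / 2) * exp (c * s)| * exp (-(c * t))) atTop (𝓝 0) := by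
    rw [← mul_zero |(f s - ε / 2) * exp (c * s)|]
    exact ((tendsto_exp_neg_atTop_nhds_zero.comp (tendsto_id.const_mul_atTop hc))).const_mul _
  obtain ⟨T', hT'⟩ := eventually_atTop.1
    (hlim.eventually (gt_mem_nhds (show 0 < ε / 2 by positivity)))
  refine ⟨max T' s, fun t ht => ?_⟩
  have hts := (le_max_right T' s).trans ht
  have h1 := hanti t hts
  have h2 := hT' t ((le_max_left _ _).trans ht)
  have h3 := hf0 t ((le_max_right _ _).trans hts)
  rw [dist_zero_right, norm_eq_abs, abs_of_nonneg h3]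
  have h4 : f t - ε / 2 ≤ |(f s - ε / 2) * exp (c * s)| * exp (-(c * t)) := by
    calc f t - ε / 2 = (f t - ε / 2) * exp (c * t) * exp (-(c * t)) := by
          rw [mul_assoc, ← exp_add, add_neg_cancel, exp_zero, mul_one]
      _ ≤ (f s - ε / 2) * exp (c * s) * exp (-(c * t)) := by gcongr
      _ ≤ _ := by gcongr; exact le_abs_self _
  linarith

theorem tendsto_integral_unit_of_bounded {V : ℝ → ℝ} {C : ℝ} (hV : Continuous V)
    (h0 : ∀ t, 0 ≤ V t) (hC : ∀ t ≥ 1, ∫ s in (1:ℝ)..t, V s ≤ C) :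
    Tendsto (fun s => ∫ t in s..s + 1, V t) atTop (𝓝 0) := by
  have hi : ∀ a b, IntervalIntegrable V volume a b := fun a b => hV.intervalIntegrable a b
  have hmono : Monotone fun t => ∫ s in (1:ℝ)..t, V s := by
    intro a b hab
    have := intervalIntegral.integral_add_adjacent_intervals (hi 1 a) (hi a b)
    have h2 : 0 ≤ ∫ s in a..b, V s := intervalIntegral.integral_nonneg hab fun _ _ => h0 _
    simp only
    linarith
  have hbdd : BddAbove (range fun t => ∫ s in (1:ℝ)..t, V s) := by
    refine ⟨C, ?_⟩
    rintro _ ⟨t, rfl⟩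
    exact (hmono (le_max_left t 1)).trans (hC _ (le_max_right _ _))
  have hl := tendsto_atTop_ciSup hmono hbdd
  have hl' := hl.comp (tendsto_atTop_add_const_right atTop (1:ℝ) tendsto_id)
  have := hl'.sub hl
  rw [sub_self] at this
  refine this.congr fun s => ?_
  have := intervalIntegral.integral_add_adjacent_intervals (hi 1 s) (hi s (s + 1))
  simp only [Function.comp, id]
  linarith

/-- A solution of the rescaled stress-free system for positive times, whose components are
continuous on the whole plane. -/
structure StripFlow where
  β : ℝ
  β_pos : 0 < β
  u : ℝ → ℝ → ℝ
  v : ℝ → ℝ → ℝ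
  θ : ℝ → ℝ → ℝ
  ux : ℝ → ℝ → ℝ
  vx : ℝ → ℝ → ℝ
  vt : ℝ → ℝ → ℝ
  θx : ℝ → ℝ → ℝ
  θt : ℝ → ℝ → ℝ
  u_pos : ∀ x t, 0 < u x t
  θ_pos : ∀ x t, 0 < θ x t
  cu : Continuous (Function.uncurry u)
  cv : Continuous (Function.uncurry v)
  cθ : Continuous (Function.uncurry θ)
  cux : Continuous (Function.uncurry ux)
  cvx : Continuous (Function.uncurry vx)
  cvt : Continuous (Function.uncurry vt)
  cθx : Continuous (Function.uncurry θx)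
  cθt : Continuous (Function.uncurry θt)
  u_dx : ∀ t > 0, ∀ x ∈ Ioo (0:ℝ) 1, HasDerivAt (fun y => u y t) (ux x t) x
  v_dx : ∀ t > 0, ∀ x ∈ Ioo (0:ℝ) 1, HasDerivAt (fun y => v y t) (vx x t) x
  θ_dx : ∀ t > 0, ∀ x ∈ Ioo (0:ℝ) 1, HasDerivAt (fun y => θ y t) (θx x t) x
  u_dt : ∀ x ∈ Icc (0:ℝ) 1, ∀ t > 0, HasDerivAt (u x) (vx x t - u x t) t
  v_dt : ∀ x ∈ Icc (0:ℝ) 1, ∀ t > 0, HasDerivAt (v x) (vt x t) t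
  θ_dt : ∀ x ∈ Icc (0:ℝ) 1, ∀ t > 0, HasDerivAt (θ x) (θt x t) t
  momentum : ∀ t > 0, ∀ x ∈ Ioo (0:ℝ) 1,
    HasDerivAt (fun y => (vx y t - θ y t) / u y t) (vt x t) x
  energyEq : ∀ t > 0, ∀ x ∈ Ioo (0:ℝ) 1, HasDerivAt (fun y => θ y t ^ β * θx y t / u y t)
    (θt x t + θ x t * vx x t / u x t - vx x t ^ 2 / u x t) x
  bc0 : ∀ t, (vx 0 t - θ 0 t) / u 0 t = 0
  bc1 : ∀ t, (vx 1 t - θ 1 t) / u 1 t = 0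
  bcθ0 : ∀ t, θx 0 t = 0
  bcθ1 : ∀ t, θx 1 t = 0

namespace StripFlow

attribute [fun_prop] cu cv cθ cux cvx cvt cθx cθt

variable (S : StripFlow)

/-- The stress. -/
noncomputable def sig (x t : ℝ) : ℝ := (S.vx x t - S.θ x t) / S.u x t

/-- The heat flux. -/
noncomputable def F (x t : ℝ) : ℝ := S.θ x t ^ S.β * S.θx x t / S.u x t

/-- The space derivative of the heat flux. -/
noncomputable def Fx (x t : ℝ) : ℝ := S.θt x t - S.sig x t * S.vx x t

/-- Powers of the temperature. -/
noncomputable def pw (r x t : ℝ) : ℝ := S.θ x t ^ r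

/-- The dissipation density. -/
noncomputable def Vd (x t : ℝ) : ℝ :=
  S.u x t * S.sig x t ^ 2 / S.θ x t + S.F x t * S.θx x t / S.θ x t ^ 2

/-- The dissipation. -/
noncomputable def V (t : ℝ) : ℝ := ∫ x in (0:ℝ)..1, S.Vd x t

/-- The total energy. -/
noncomputable def E : ℝ := ∫ x in (0:ℝ)..1, (S.v x 1 ^ 2 / 2 + S.θ x 1)

@[fun_prop] theorem csig : Continuous (Function.uncurry S.sig) := by
  unfold sig
  fun_prop (disch := intros; exact (S.u_pos _ _).ne')

@[fun_prop] theorem cpw (r : ℝ) : Continuous (Function.uncurry (S.pw r)) := by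
  unfold pw
  exact S.cθ.rpow_const fun p => Or.inl (S.θ_pos _ _).ne'

theorem F_eq (x t : ℝ) : S.F x t = S.pw S.β x t * S.θx x t / S.u x t := rfl

@[fun_prop] theorem cF : Continuous (Function.uncurry S.F) := by
  have : S.F = fun x t => S.pw S.β x t * S.θx x t / S.u x t := rfl
  rw [this]
  fun_prop (disch := intros; exact (S.u_pos _ _).ne')

@[fun_prop] theorem cFx : Continuous (Function.uncurry S.Fx) := by
  unfold Fx; fun_prop

@[fun_prop] theorem cVd : Continuous (Function.uncurry S.Vd) := by
  unfold Vd
  fun_prop (disch := intros; first | exact (S.θ_pos _ _).ne' | exact (pow_pos (S.θ_pos _ _) 2).ne')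

@[fun_prop] theorem cV : Continuous S.V := continuous_integral_of_continuous S.cVd 0 1

theorem pw_pos (r x t : ℝ) : 0 < S.pw r x t := rpow_pos_of_pos (S.θ_pos x t) r

theorem pw_add_one (r x t : ℝ) : S.pw (r + 1) x t = S.pw r x t * S.θ x t :=
  rpow_add_one (S.θ_pos x t).ne' r

theorem pw_add (r s x t : ℝ) : S.pw (r + s) x t = S.pw r x t * S.pw s x t :=
  rpow_add (S.θ_pos x t) r s

theorem vx_eq (x t : ℝ) : S.vx x t = S.u x t * S.sig x t + S.θ x t := by
  have := (S.u_pos x t).ne'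
  unfold sig; field_simp; ring

theorem uF_eq (x t : ℝ) : S.u x t * S.F x t = S.pw S.β x t * S.θx x t := by
  have := (S.u_pos x t).ne'
  rw [F_eq]; field_simp

theorem sig_zero (t : ℝ) : S.sig 0 t = 0 := S.bc0 t
theorem sig_one (t : ℝ) : S.sig 1 t = 0 := S.bc1 t
theorem F_zero (t : ℝ) : S.F 0 t = 0 := by simp [F, S.bcθ0]
theorem F_one (t : ℝ) : S.F 1 t = 0 := by simp [F, S.bcθ1]

theorem sig_dx : ∀ t > 0, ∀ x ∈ Ioo (0:ℝ) 1, HasDerivAt (fun y => S.sig y t) (S.vt x t) x :=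
  S.momentum

theorem F_dx : ∀ t > 0, ∀ x ∈ Ioo (0:ℝ) 1, HasDerivAt (fun y => S.F y t) (S.Fx x t) x := by
  intro t ht x hx
  refine (S.energyEq t ht x hx).congr_deriv ?_
  have := (S.u_pos x t).ne'
  simp only [Fx, sig]; field_simp; ring

theorem pw_dx (r : ℝ) : ∀ t > 0, ∀ x ∈ Ioo (0:ℝ) 1,
    HasDerivAt (fun y => S.pw r y t) (r * S.pw (r - 1) x t * S.θx x t) x := by
  intro t ht x hx
  refine ((S.θ_dx t ht x hx).rpow_const (p := r) (Or.inl (S.θ_pos x t).ne')).congr_deriv ?_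
  simp only [pw]; ring

theorem pw_dt (r : ℝ) : ∀ x ∈ Icc (0:ℝ) 1, ∀ t > 0,
    HasDerivAt (S.pw r x) (r * S.pw (r - 1) x t * S.θt x t) t := by
  intro x hx t ht
  refine ((S.θ_dt x hx t ht).rpow_const (p := r) (Or.inl (S.θ_pos x t).ne')).congr_deriv ?_
  simp only [pw]; ring

theorem Vd_nonneg (x t : ℝ) : 0 ≤ S.Vd x t := by
  have h1 := S.u_pos x t
  have h2 := S.θ_pos x t
  have h3 := S.pw_pos S.β x t
  have : S.Vd x t = S.u x t * S.sig x t ^ 2 / S.θ x t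
      + S.pw S.β x t * S.θx x t ^ 2 / (S.u x t * S.θ x t ^ 2) := by
    rw [Vd, F_eq]; field_simp
  rw [this]; positivity

theorem V_nonneg (t : ℝ) : 0 ≤ S.V t :=
  intervalIntegral.integral_nonneg zero_le_one fun x _ => S.Vd_nonneg x t

theorem integral_energy {t : ℝ} (ht : 1 ≤ t) :
    ∫ x in (0:ℝ)..1, (S.v x t ^ 2 / 2 + S.θ x t) = S.E := by
  have hd : ∀ t > 0, HasDerivAt (fun t => ∫ x in (0:ℝ)..1, (S.v x t ^ 2 / 2 + S.θ x t)) 0 t := by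
    intro t ht
    have h := hasDerivAt_integral_param (f := fun x t => S.v x t ^ 2 / 2 + S.θ x t)
      (f' := fun x t => S.v x t * S.vt x t + S.θt x t) zero_le_one (by fun_prop) (by fun_prop) ht
      (fun x hx t ht => by
        refine ((((S.v_dt x hx t ht).pow 2).div_const 2).add (S.θ_dt x hx t ht)).congr_deriv ?_
        simp
        ring)
    refine h.congr_deriv ?_
    refine integral_eq_zero_of_hasDerivAt (g := fun x => S.v x t * S.sig x t + S.F x t)
      (by fun_prop) (by fun_prop) (fun x hx => ?_) ?_ ?_
    · refine (((S.v_dx t ht x hx).mul (S.sig_dx t ht x hx)).add (S.F_dx t ht x hx)).congr_deriv ?_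
      simp only [Fx]; ring
    · simp [sig_zero, F_zero]
    · simp [sig_one, F_one]
  have := constant_of_has_deriv_right_zero (a := 1) (b := t)
    (f := fun t => ∫ x in (0:ℝ)..1, (S.v x t ^ 2 / 2 + S.θ x t))
    (continuous_integral_of_continuous (by fun_prop) 0 1).continuousOn
    (fun r hr => (hd r (by linarith [hr.1])).hasDerivWithinAt) t ⟨ht, le_rfl⟩
  exact this

theorem integral_v_eq {t : ℝ} (ht : 0 ≤ t) :
    ∫ x in (0:ℝ)..1, S.v x t = ∫ x in (0:ℝ)..1, S.v x 0 := by
  have hd : ∀ s ∈ Ioo 0 t, HasDerivAt (fun t => ∫ x in (0:ℝ)..1, S.v x t) 0 s := by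
    intro t ht
    exact (hasDerivAt_integral_param zero_le_one S.cv S.cvt ht.1 S.v_dt).congr_deriv
      (integral_eq_zero_of_hasDerivAt (g := fun x => S.sig x t)
        (by fun_prop) (by fun_prop) (S.sig_dx t ht.1) (S.sig_zero t) (S.sig_one t))
  have hc : Continuous fun t => ∫ x in (0:ℝ)..1, S.v x t :=
    continuous_integral_of_continuous S.cv 0 1
  have h1 := sub_le_integral_of_hasDerivAt (g := fun _ => 0) ht hc (by fun_prop) hd
    fun _ _ => le_rfl
  have h2 := sub_le_integral_of_hasDerivAt (g := fun _ => 0) ht hc.neg (by fun_prop)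
    (fun s hs => (hd s hs).neg) fun _ _ => by simp
  simp only [intervalIntegral.integral_zero, Pi.neg_apply] at h1 h2
  linarith

theorem integral_v_sq_le {t : ℝ} (ht : 1 ≤ t) : ∫ x in (0:ℝ)..1, S.v x t ^ 2 ≤ 2 * S.E := by
  rw [← S.integral_energy ht]
  exact integral_le_mul zero_le_one 2 (by fun_prop) (by fun_prop)
    fun x _ => by linarith [S.θ_pos x t]

theorem integral_θ_le {t : ℝ} (ht : 1 ≤ t) : ∫ x in (0:ℝ)..1, S.θ x t ≤ S.E := by
  rw [← S.integral_energy ht, ← one_mul (∫ x in (0:ℝ)..1, (S.v x t ^ 2 / 2 + S.θ x t))]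
  exact integral_le_mul zero_le_one 1 (by fun_prop) (by fun_prop)
    fun x _ => by linarith [sq_nonneg (S.v x t)]

theorem E_pos : 0 < S.E := by
  refine intervalIntegral.intervalIntegral_pos_of_pos
    (Continuous.intervalIntegrable (by fun_prop) _ _) (fun x => ?_) zero_lt_one
  have := S.θ_pos x 1
  positivity

theorem integral_abs_v_le {t : ℝ} (ht : 1 ≤ t) : ∫ x in (0:ℝ)..1, |S.v x t| ≤ 1 + S.E := by
  have h1 := integral_le_add_two (f := fun x => |S.v x t|) (g₁ := fun x => S.v x t ^ 2)
    (g₂ := fun _ => 1) zero_le_one (1 / 2) (1 / 2) (by fun_prop) (by fun_prop) (by fun_prop)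
    (fun x _ => by nlinarith [sq_nonneg (|S.v x t| - 1), sq_abs (S.v x t)])
  have h2 := S.integral_v_sq_le ht
  simp at h1
  linarith

/-- The logarithm of the temperature. -/
noncomputable def logθ (x t : ℝ) : ℝ := log (S.θ x t)

@[fun_prop] theorem clogθ : Continuous (Function.uncurry S.logθ) :=
  S.cθ.log fun _ => (S.θ_pos _ _).ne'

/-- The entropy functional. -/
noncomputable def G (t : ℝ) : ℝ := ∫ x in (0:ℝ)..1, (S.logθ x t - (1 - x) * S.v x t)

theorem G_deriv {t : ℝ} (ht : 0 < t) : HasDerivAt S.G (S.V t) t := by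
  have hθ := fun x t => (S.θ_pos x t).ne'
  have h := hasDerivAt_integral_param (f := fun x t => S.logθ x t - (1 - x) * S.v x t)
      (f' := fun x t => S.θt x t / S.θ x t - (1 - x) * S.vt x t) zero_le_one (by fun_prop)
      (by fun_prop (disch := intros; exact (S.θ_pos _ _).ne')) ht
      (fun x hx t ht => ((S.θ_dt x hx t ht).log (hθ x t)).sub
        ((S.v_dt x hx t ht).const_mul (1 - x)))
  refine h.congr_deriv ?_
  have hz := integral_eq_zero_of_hasDerivAt
    (g := fun x => S.F x t / S.θ x t - (1 - x) * S.sig x t)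
    (g' := fun x => (S.θt x t / S.θ x t - (1 - x) * S.vt x t) - S.Vd x t)
    (by fun_prop (disch := intros; exact (S.θ_pos _ _).ne'))
    (by fun_prop (disch := intros; exact (S.θ_pos _ _).ne')) (fun x hx => ?_)
    (by simp [sig_zero, F_zero]) (by simp [F_one])
  · rw [intervalIntegral.integral_sub (Continuous.intervalIntegrable
      (by fun_prop (disch := intros; exact (S.θ_pos _ _).ne')) _ _)
      (Continuous.intervalIntegrable (by fun_prop) _ _)] at hz
    exact sub_eq_zero.1 hz
  · have h1 : HasDerivAt (fun x : ℝ => 1 - x) (-1) x := by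
      simpa using (hasDerivAt_id x).const_sub 1
    refine (((S.F_dx t ht x hx).div (S.θ_dx t ht x hx) (hθ x t)).sub
      (h1.mul (S.sig_dx t ht x hx))).congr_deriv ?_
    have h2 := hθ x t
    simp only [Fx, Vd]
    rw [S.vx_eq x t]
    field_simp
    ring

theorem cG : Continuous S.G := by
  exact continuous_integral_of_continuous (by fun_prop) 0 1

theorem G_eq {t : ℝ} (ht : 1 ≤ t) : S.G t = S.G 1 + ∫ s in (1:ℝ)..t, S.V s := by
  rw [intervalIntegral.integral_eq_sub_of_hasDerivAt_of_le ht S.cG.continuousOn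
    (fun s hs => S.G_deriv (by linarith [hs.1])) (S.cV.intervalIntegrable _ _)]
  ring

theorem integral_V_le {t : ℝ} (ht : 1 ≤ t) :
    ∫ s in (1:ℝ)..t, S.V s ≤ (1 + 2 * S.E) - S.G 1 := by
  have h1 : S.G t ≤ 1 * (∫ x in (0:ℝ)..1, S.θ x t) + 1 * ∫ x in (0:ℝ)..1, |S.v x t| := by
    refine integral_le_add_two zero_le_one 1 1 (by fun_prop) (by fun_prop) (by fun_prop) ?_
    intro x hx
    have : S.logθ x t ≤ S.θ x t - 1 := log_le_sub_one_of_pos (S.θ_pos x t)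
    nlinarith [neg_abs_le (S.v x t), abs_nonneg (S.v x t), hx.1, hx.2]
  have h2 := S.integral_θ_le ht
  have h3 := S.integral_abs_v_le ht
  have h4 := S.G_eq ht
  linarith

theorem exists_θ_ge : ∃ c > 0, ∀ t ≥ 1, ∃ x ∈ Icc (0:ℝ) 1, c ≤ S.θ x t := by
  refine ⟨exp (S.G 1 - (1 + S.E)), exp_pos _, fun t ht => ?_⟩
  by_contra! hcon
  have h1 : S.G t ≤ 1 * (∫ x in (0:ℝ)..1, S.logθ x t) + 1 * ∫ x in (0:ℝ)..1, |S.v x t| := by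
    refine integral_le_add_two zero_le_one 1 1 (by fun_prop) (by fun_prop) (by fun_prop) ?_
    intro x hx
    nlinarith [neg_abs_le (S.v x t), abs_nonneg (S.v x t), hx.1, hx.2]
  have h3 := S.integral_abs_v_le ht
  have h4 := S.G_eq ht
  have h5 : 0 ≤ ∫ s in (1:ℝ)..t, S.V s := intervalIntegral.integral_nonneg ht fun s _ => S.V_nonneg s
  have h6 : ∫ x in (0:ℝ)..1, S.logθ x t < ∫ x in (0:ℝ)..1, (S.G 1 - (1 + S.E)) := by
    refine intervalIntegral.integral_lt_integral_of_continuousOn_of_le_of_exists_lt zero_lt_one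
      (show Continuous fun x => S.logθ x t by fun_prop).continuousOn continuousOn_const ?_ ?_
    · intro x hx
      exact ((log_lt_iff_lt_exp (S.θ_pos x t)).2 (hcon x ⟨hx.1.le, hx.2⟩)).le
    · exact ⟨0, by simp, (log_lt_iff_lt_exp (S.θ_pos 0 t)).2 (hcon 0 (by simp))⟩
  simp at h6
  linarith

theorem exists_θ_le {t : ℝ} (ht : 1 ≤ t) : ∃ x ∈ Icc (0:ℝ) 1, S.θ x t ≤ S.E := by
  by_contra! hcon
  have h6 : ∫ x in (0:ℝ)..1, S.E < ∫ x in (0:ℝ)..1, S.θ x t := by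
    refine intervalIntegral.integral_lt_integral_of_continuousOn_of_le_of_exists_lt zero_lt_one
      continuousOn_const (show Continuous fun x => S.θ x t by fun_prop).continuousOn ?_ ?_
    · intro x hx
      exact (hcon x ⟨hx.1.le, hx.2⟩).le
    · exact ⟨0, by simp, hcon 0 (by simp)⟩
  have := S.integral_θ_le ht
  simp at h6
  linarith

/-- The potential of the velocity. -/
noncomputable def Phi (x t : ℝ) : ℝ := ∫ ξ in (0:ℝ)..x, S.v ξ t

theorem cPhi (x : ℝ) : Continuous (S.Phi x) :=
  continuous_integral_of_continuous S.cv 0 x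

theorem abs_Phi_le {x t : ℝ} (hx : x ∈ Icc (0:ℝ) 1) (ht : 1 ≤ t) : |S.Phi x t| ≤ 1 + S.E := by
  refine (intervalIntegral.abs_integral_le_integral_abs hx.1).trans
    ((intervalIntegral.integral_mono_interval le_rfl hx.1 hx.2
      (Eventually.of_forall fun z => abs_nonneg _)
      (Continuous.intervalIntegrable (by fun_prop) _ _)).trans (S.integral_abs_v_le ht))

theorem Phi_dt {x : ℝ} (hx : x ∈ Icc (0:ℝ) 1) {t : ℝ} (ht : 0 < t) :
    HasDerivAt (S.Phi x) (S.sig x t) t := by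
  refine (hasDerivAt_integral_param hx.1 S.cv S.cvt ht
    (fun y hy => S.v_dt y ⟨hy.1, hy.2.trans hx.2⟩)).congr_deriv ?_
  rw [intervalIntegral.integral_eq_sub_of_hasDerivAt_of_le hx.1 (f := fun x => S.sig x t)
    (show Continuous fun x => S.sig x t by fun_prop).continuousOn
    (fun y hy => S.sig_dx t ht y ⟨hy.1, hy.2.trans_le hx.2⟩)
    (Continuous.intervalIntegrable (by fun_prop) _ _), sig_zero, sub_zero]

theorem uexp_dt {x : ℝ} (hx : x ∈ Icc (0:ℝ) 1) {t : ℝ} (ht : 0 < t) :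
    HasDerivAt (fun t => S.u x t * exp (t - S.Phi x t)) (exp (t - S.Phi x t) * S.θ x t) t := by
  refine ((S.u_dt x hx t ht).mul ((hasDerivAt_id t).sub (S.Phi_dt hx ht)).exp).congr_deriv ?_
  rw [S.vx_eq]
  simp only [Pi.sub_apply, id]
  ring

theorem osc_pw_half {t : ℝ} (ht : 1 ≤ t) {x y : ℝ} (hx : x ∈ Icc (0:ℝ) 1)
    (hy : y ∈ Icc (0:ℝ) 1) :
    (S.pw ((S.β + 1) / 2) x t - S.pw ((S.β + 1) / 2) y t) ^ 2 ≤
      ((S.β + 1) / 2) ^ 2 * S.V t * ∫ x in (0:ℝ)..1, S.u x t * S.θ x t := by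
  set q := (S.β + 1) / 2 with hq
  have hq0 : 0 < q := by have := S.β_pos; positivity
  have hs : ∀ x, 0 < S.u x t * S.θ x t := fun x => mul_pos (S.u_pos x t) (S.θ_pos x t)
  have hs' : ∀ x, 0 < √(S.u x t * S.θ x t) := fun x => sqrt_pos.2 (hs x)
  have h1 := abs_sub_le_integral_abs (f := fun x => S.pw q x t)
    (f' := fun x => q * S.pw (q - 1) x t * S.θx x t) (by fun_prop) (by fun_prop)
    (S.pw_dx q t (by linarith)) hx hy
  have h2 : ∫ z in (0:ℝ)..1, |q * S.pw (q - 1) z t * S.θx z t| = ∫ z in (0:ℝ)..1,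
      √(S.u z t * S.θ z t) * (|q * S.pw (q - 1) z t * S.θx z t| / √(S.u z t * S.θ z t)) :=
    intervalIntegral.integral_congr fun z _ => (mul_div_cancel₀ _ (hs' z).ne').symm
  have h3 := sq_integral_mul_le (f := fun z => √(S.u z t * S.θ z t))
    (g := fun z => |q * S.pw (q - 1) z t * S.θx z t| / √(S.u z t * S.θ z t)) zero_le_one
    (by fun_prop) (by fun_prop (disch := intros; exact (hs' _).ne'))
  rw [← h2] at h3
  have h4 : ∫ z in (0:ℝ)..1, √(S.u z t * S.θ z t) ^ 2 = ∫ z in (0:ℝ)..1, S.u z t * S.θ z t :=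
    intervalIntegral.integral_congr fun z _ => sq_sqrt (hs z).le
  have h5 : ∫ z in (0:ℝ)..1, (|q * S.pw (q - 1) z t * S.θx z t| / √(S.u z t * S.θ z t)) ^ 2
      ≤ q ^ 2 * S.V t := by
    refine integral_le_mul zero_le_one (q ^ 2)
      (by fun_prop (disch := intros; exact (hs' _).ne')) (by fun_prop) fun z _ => ?_
    have e1 : S.pw (q - 1) z t ^ 2 = S.pw S.β z t / S.θ z t := by
      rw [eq_div_iff (S.θ_pos z t).ne', sq, ← S.pw_add, ← S.pw_add_one]
      congr 1; rw [hq]; ring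
    have hu := S.u_pos z t
    have hθ := S.θ_pos z t
    rw [div_pow, sq_sqrt (hs z).le, sq_abs, mul_pow, mul_pow, e1, Vd, F_eq]
    have : q ^ 2 * (S.pw S.β z t / S.θ z t) * S.θx z t ^ 2 / (S.u z t * S.θ z t)
      = q ^ 2 * (S.pw S.β z t * S.θx z t / S.u z t * S.θx z t / S.θ z t ^ 2) := by
      field_simp
    rw [this]
    gcongr
    have : 0 ≤ S.u z t * S.sig z t ^ 2 / S.θ z t := by positivity
    linarith
  rw [h4] at h3
  have h6 : 0 ≤ ∫ z in (0:ℝ)..1, S.u z t * S.θ z t :=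
    intervalIntegral.integral_nonneg zero_le_one fun z _ => (hs z).le
  calc _ = |S.pw q x t - S.pw q y t| ^ 2 := (sq_abs _).symm
    _ ≤ (∫ z in (0:ℝ)..1, |q * S.pw (q - 1) z t * S.θx z t|) ^ 2 := by gcongr
    _ ≤ _ := h3
    _ ≤ (∫ z in (0:ℝ)..1, S.u z t * S.θ z t) * (q ^ 2 * S.V t) := by gcongr
    _ = _ := by ring

theorem pw_half_sq (x t : ℝ) : S.pw ((S.β + 1) / 2) x t ^ 2 = S.pw (S.β + 1) x t := by
  rw [sq, ← S.pw_add]; congr 1; ring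

theorem θ_le_one_add (x t : ℝ) : S.θ x t ≤ 1 + S.pw (S.β + 1) x t := by
  have hp := S.pw_pos (S.β + 1) x t
  rcases le_total (S.θ x t) 1 with h | h
  · linarith
  · have : S.θ x t ^ (1:ℝ) ≤ S.θ x t ^ (S.β + 1) :=
      rpow_le_rpow_of_exponent_le h (by linarith [S.β_pos])
    rw [rpow_one] at this
    unfold pw; linarith

theorem pw_mul_le {t : ℝ} (ht : 1 ≤ t) {x : ℝ} (hx : x ∈ Icc (0:ℝ) 1) :
    S.pw (S.β + 1) x t ≤ 2 * (S.E ^ ((S.β + 1) / 2)) ^ 2 + 2 * ((S.β + 1) / 2) ^ 2 * S.V t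
      * ∫ x in (0:ℝ)..1, S.u x t * S.θ x t := by
  obtain ⟨y, hy, hyE⟩ := S.exists_θ_le ht
  have h1 := S.osc_pw_half ht hx hy
  have h2 : S.pw ((S.β + 1) / 2) y t ≤ S.E ^ ((S.β + 1) / 2) :=
    rpow_le_rpow (S.θ_pos y t).le hyE (by linarith [S.β_pos])
  have h3 := S.pw_pos ((S.β + 1) / 2) y t
  rw [← pw_half_sq]
  nlinarith [sq_nonneg (S.pw ((S.β + 1) / 2) x t - 2 * S.pw ((S.β + 1) / 2) y t)]

theorem exists_u_le : ∃ U > 0, ∀ t ≥ 1, ∀ x ∈ Icc (0:ℝ) 1, S.u x t ≤ U := by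
  have hE := S.E_pos
  set B := 1 + S.E with hB
  set K₀ := 1 + 2 * (S.E ^ ((S.β + 1) / 2)) ^ 2 with hK₀
  set K₁ := 2 * ((S.β + 1) / 2) ^ 2 with hK₁
  have hK₀' : 0 < K₀ := by positivity
  have hK₁' : 0 ≤ K₁ := by positivity
  let J : ℝ → ℝ := fun t => ∫ x in (0:ℝ)..1, S.u x t * S.θ x t
  have hJ : Continuous J := continuous_integral_of_continuous
    (f := fun x t => S.u x t * S.θ x t) (by fun_prop) 0 1
  have hJ0 : ∀ t, 0 ≤ J t := fun t => intervalIntegral.integral_nonneg zero_le_one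
    fun x _ => (mul_pos (S.u_pos x t) (S.θ_pos x t)).le
  obtain ⟨P, hP⟩ := (isCompact_Icc (a := (0:ℝ)) (b := 1)).exists_bound_of_continuousOn
    (show Continuous fun x => S.u x 1 by fun_prop).continuousOn
  have hP0 : 0 ≤ P := (norm_nonneg _).trans (hP 0 (by simp))
  set P₀ := P * exp (1 + B)
  let m : ℝ → ℝ := fun s => exp B * (exp s * (K₀ + K₁ * S.V s * J s))
  have hm : Continuous m := by fun_prop
  let M : ℝ → ℝ := fun t => P₀ + ∫ s in (1:ℝ)..t, m s
  have hMc : Continuous M := (continuous_integral_upper hm 1).const_add _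
  have hM : ∀ t, HasDerivAt M (m t) t := fun t =>
    (hasDerivAt_integral_of_continuous hm 1 t).const_add _
  have hm0 : ∀ s, 0 ≤ m s := fun s => by
    have := S.V_nonneg s
    have := hJ0 s
    positivity
  have hM0 : ∀ t ≥ 1, 0 ≤ M t := fun t ht => by
    have : 0 ≤ ∫ s in (1:ℝ)..t, m s := intervalIntegral.integral_nonneg ht fun s _ => hm0 s
    positivity
  have hpM : ∀ t ≥ 1, ∀ x ∈ Icc (0:ℝ) 1, S.u x t * exp (t - S.Phi x t) ≤ M t := by
    intro t ht x hx
    have hc := S.cPhi x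
    have h1 := sub_le_integral_of_hasDerivAt (f := fun t => S.u x t * exp (t - S.Phi x t))
      (g := m) ht (by fun_prop) hm (fun s hs => S.uexp_dt hx (by linarith [hs.1]))
      (fun s hs => by
        have hb := S.abs_Phi_le hx hs.1.le
        have h2 : S.θ x s ≤ K₀ + K₁ * S.V s * J s := by
          have := S.θ_le_one_add x s
          have := S.pw_mul_le hs.1.le hx
          simp only [J, hK₀, hK₁]; linarith
        have h3 : exp (s - S.Phi x s) ≤ exp B * exp s := by
          rw [← exp_add]; exact exp_le_exp.2 (by linarith [neg_abs_le (S.Phi x s)])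
        calc exp (s - S.Phi x s) * S.θ x s ≤ exp B * exp s * (K₀ + K₁ * S.V s * J s) :=
              mul_le_mul h3 h2 (S.θ_pos x s).le (by positivity)
          _ = m s := by simp only [m]; ring)
    have hb := S.abs_Phi_le hx le_rfl
    have h4 : S.u x 1 * exp (1 - S.Phi x 1) ≤ P₀ :=
      mul_le_mul ((le_abs_self _).trans (hP x hx))
        (exp_le_exp.2 (by linarith [neg_abs_le (S.Phi x 1)])) (exp_pos _).le hP0
    simp only [M]; linarith
  have huM : ∀ t ≥ 1, ∀ x ∈ Icc (0:ℝ) 1, S.u x t ≤ exp B * exp (-t) * M t := by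
    intro t ht x hx
    have hb := S.abs_Phi_le hx ht
    calc S.u x t = exp (S.Phi x t - t) * (S.u x t * exp (t - S.Phi x t)) := by
          rw [mul_left_comm, ← exp_add]; simp
      _ ≤ (exp B * exp (-t)) * M t := by
          refine mul_le_mul ?_ (hpM t ht x hx) ?_ (by positivity)
          · rw [← exp_add]; exact exp_le_exp.2 (by linarith [le_abs_self (S.Phi x t)])
          · have := S.u_pos x t; positivity
  have hJM : ∀ t ≥ 1, J t ≤ exp B * exp (-t) * M t * S.E := by
    intro t ht
    refine (integral_le_mul (g := fun x => S.θ x t) zero_le_one (exp B * exp (-t) * M t)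
      (by fun_prop) (by fun_prop)
      fun x hx => mul_le_mul_of_nonneg_right (huM t ht x hx) (S.θ_pos x t).le).trans ?_
    have := hM0 t ht
    gcongr
    exact S.integral_θ_le ht
  set k := exp B * exp B * K₁ * S.E
  have hk : 0 ≤ k := by positivity
  set C := (1 + 2 * S.E) - S.G 1
  have hfin : ∀ t ≥ 1, M t ≤ exp (k * C) * ((P₀ + exp B * K₀) * exp t) := by
    intro t ht
    have hVc := continuous_integral_upper S.cV 1
    have hVn : ∀ s ≥ 1, 0 ≤ ∫ r in (1:ℝ)..s, S.V r := fun s hs =>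
      intervalIntegral.integral_nonneg hs fun r _ => S.V_nonneg r
    have h1 := sub_le_integral_of_hasDerivAt
      (f := fun t => M t * exp (-(k * ∫ s in (1:ℝ)..t, S.V s)))
      (f' := fun t => m t * exp (-(k * ∫ s in (1:ℝ)..t, S.V s)) + M t *
        (exp (-(k * ∫ s in (1:ℝ)..t, S.V s)) * (-(k * S.V t))))
      (g := fun t => exp B * K₀ * exp t) ht (by fun_prop) (by fun_prop)
      (fun s hs => (hM s).mul
        ((hasDerivAt_integral_of_continuous S.cV 1 s).const_mul k).neg.exp)
      (fun s hs => by
        have hs1 : 1 ≤ s := hs.1.le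
        have hV := S.V_nonneg s
        have he : exp (-(k * ∫ r in (1:ℝ)..s, S.V r)) ≤ 1 :=
          exp_le_one_iff.2 (by have := hVn s hs1; nlinarith)
        have hms : m s ≤ exp B * K₀ * exp s + k * S.V s * M s := by
          have : exp s * (K₁ * S.V s * J s) ≤ exp s * (K₁ * S.V s *
              (exp B * exp (-s) * M s * S.E)) := by
            gcongr; exact hJM s hs1
          have h5 : exp s * exp (-s) = 1 := by rw [← exp_add]; simp
          calc m s = exp B * K₀ * exp s + exp B * (exp s * (K₁ * S.V s * J s)) := by
                simp only [m]; ring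
            _ ≤ exp B * K₀ * exp s + exp B * (exp s * (K₁ * S.V s *
              (exp B * exp (-s) * M s * S.E))) := by gcongr
            _ = exp B * K₀ * exp s + (exp s * exp (-s)) * k * S.V s * M s := by
              simp only [k]; ring
            _ = _ := by rw [h5, one_mul]
        calc _ = (m s - k * S.V s * M s) * exp (-(k * ∫ r in (1:ℝ)..s, S.V r)) := by ring
          _ ≤ (exp B * K₀ * exp s) * exp (-(k * ∫ r in (1:ℝ)..s, S.V r)) := by
            gcongr; linarith
          _ ≤ _ := mul_le_of_le_one_right (by positivity) he)
    rw [intervalIntegral.integral_const_mul, integral_exp] at h1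
    simp only [intervalIntegral.integral_same, mul_zero, neg_zero, exp_zero, mul_one] at h1
    have hM1 : M 1 = P₀ := by simp [M]
    rw [hM1] at h1
    have he1 : 1 ≤ exp t := one_le_exp (by linarith)
    have hbk : 0 ≤ exp B * K₀ := by positivity
    have hP₀ : 0 ≤ P₀ := by positivity
    have h6 : M t * exp (-(k * ∫ s in (1:ℝ)..t, S.V s)) ≤ (P₀ + exp B * K₀) * exp t := by
      nlinarith [exp_pos 1]
    have h7 : exp (k * ∫ s in (1:ℝ)..t, S.V s) ≤ exp (k * C) :=
      exp_le_exp.2 (mul_le_mul_of_nonneg_left (S.integral_V_le ht) hk)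
    calc M t = exp (k * ∫ s in (1:ℝ)..t, S.V s) *
          (M t * exp (-(k * ∫ s in (1:ℝ)..t, S.V s))) := by
          rw [mul_left_comm, ← exp_add]; simp
      _ ≤ _ := mul_le_mul h7 h6 (mul_nonneg (hM0 t ht) (exp_pos _).le) (exp_pos _).le
  refine ⟨exp B * (exp (k * C) * (P₀ + exp B * K₀)), by positivity, fun t ht x hx => ?_⟩
  have h5 : exp (-t) * exp t = 1 := by rw [← exp_add]; simp
  calc S.u x t ≤ exp B * exp (-t) * M t := huM t ht x hx
    _ ≤ exp B * exp (-t) * (exp (k * C) * ((P₀ + exp B * K₀) * exp t)) := by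
      gcongr; exact hfin t ht
    _ = exp B * (exp (k * C) * (P₀ + exp B * K₀)) * (exp (-t) * exp t) := by ring
    _ = _ := by rw [h5, mul_one]

theorem integral_uθ_le {U t : ℝ} (hU : ∀ x ∈ Icc (0:ℝ) 1, S.u x t ≤ U) (ht : 1 ≤ t) :
    ∫ x in (0:ℝ)..1, S.u x t * S.θ x t ≤ U * S.E := by
  have hU0 : 0 < U := (S.u_pos 0 t).trans_le (hU 0 (by simp))
  refine (integral_le_mul (g := fun x => S.θ x t) zero_le_one U (by fun_prop) (by fun_prop)
    fun x hx => mul_le_mul_of_nonneg_right (hU x hx) (S.θ_pos x t).le).trans ?_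
  gcongr
  exact S.integral_θ_le ht

theorem exists_pw_le : ∃ C > 0, ∀ t ≥ 1, ∀ x ∈ Icc (0:ℝ) 1,
    S.pw (S.β + 1) x t ≤ C * (1 + S.V t) := by
  obtain ⟨U, hU0, hU⟩ := S.exists_u_le
  have hE := S.E_pos
  have hβ := S.β_pos
  set a := 2 * (S.E ^ ((S.β + 1) / 2)) ^ 2 with ha
  set b := 2 * ((S.β + 1) / 2) ^ 2 * (U * S.E) with hb
  refine ⟨a + b, by positivity, fun t ht x hx => ?_⟩
  have h1 := S.pw_mul_le ht hx
  have h2 := S.integral_uθ_le (hU t ht) ht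
  have hV := S.V_nonneg t
  have h3 : 2 * ((S.β + 1) / 2) ^ 2 * S.V t * ∫ x in (0:ℝ)..1, S.u x t * S.θ x t
      ≤ 2 * ((S.β + 1) / 2) ^ 2 * S.V t * (U * S.E) := by gcongr
  have ha0 : 0 ≤ a := by positivity
  have hb0 : 0 ≤ b := by positivity
  have h4 : 0 ≤ a * S.V t := by positivity
  have h5 : 2 * ((S.β + 1) / 2) ^ 2 * S.V t * (U * S.E) = b * S.V t := by rw [hb]; ring
  rw [h5] at h3
  linarith

theorem exists_le_u : ∃ c > 0, ∃ t₀ ≥ 1, ∀ t ≥ t₀, ∀ x ∈ Icc (0:ℝ) 1, c ≤ S.u x t := by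
  obtain ⟨U, hU0, hU⟩ := S.exists_u_le
  obtain ⟨c, hc, hcθ⟩ := S.exists_θ_ge
  have hE := S.E_pos
  have hβ := S.β_pos
  set q := (S.β + 1) / 2 with hq
  have hq0 : 0 < q := by positivity
  set d := c ^ q
  have hd : 0 < d := rpow_pos_of_pos hc q
  set K := 4 * q ^ 2 * (U * S.E) / d ^ 2 with hK
  have hK0 : 0 < K := by positivity
  set c' := (d / 2) ^ q⁻¹
  have hc' : 0 < c' := rpow_pos_of_pos (by positivity) _
  have hθ : ∀ t ≥ 1, ∀ x ∈ Icc (0:ℝ) 1, c' * (1 - K * S.V t) ≤ S.θ x t := by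
    intro t ht x hx
    have hV := S.V_nonneg t
    rcases le_total (K * S.V t) 1 with h | h
    · obtain ⟨y, hy, hyc⟩ := hcθ t ht
      have h1 := S.osc_pw_half ht hx hy
      rw [← hq] at h1
      have h2 := S.integral_uθ_le (hU t ht) ht
      have h3 : q ^ 2 * S.V t * ∫ x in (0:ℝ)..1, S.u x t * S.θ x t
        ≤ q ^ 2 * S.V t * (U * S.E) := by gcongr
      have h4 : q ^ 2 * S.V t * (U * S.E) = K * S.V t * (d ^ 2 / 4) := by
        rw [hK]; field_simp
      have h5 : d ≤ S.pw q y t := rpow_le_rpow hc.le hyc hq0.le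
      have h6 : (S.pw q x t - S.pw q y t) ^ 2 ≤ (d / 2) ^ 2 := by
        rw [div_pow]; nlinarith [sq_nonneg d]
      have h7 := abs_le_of_sq_le_sq' h6 (by positivity)
      have h8 : d / 2 ≤ S.pw q x t := by linarith [h7.1]
      have h9 : c' ≤ S.θ x t := by
        calc c' ≤ (S.pw q x t) ^ q⁻¹ := rpow_le_rpow (by positivity) h8 (by positivity)
          _ = S.θ x t := rpow_rpow_inv (S.θ_pos x t).le hq0.ne'
      have : c' * (1 - K * S.V t) ≤ c' := mul_le_of_le_one_right hc'.le (by
        have : 0 ≤ K * S.V t := by positivity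
        linarith)
      linarith
    · have := S.θ_pos x t
      have : c' * (1 - K * S.V t) ≤ 0 := mul_nonpos_of_nonneg_of_nonpos hc'.le (by linarith)
      linarith
  set B := 1 + S.E with hB
  set C := (1 + 2 * S.E) - S.G 1 with hC
  have hC0 : 0 ≤ C := by
    have := S.integral_V_le le_rfl
    simp only [intervalIntegral.integral_same] at this
    linarith
  set N := K * C + 1 with hN
  have hN1 : 1 ≤ N := by have : 0 ≤ K * C := by positivity
                         linarith
  refine ⟨exp (-(B + B + N)) * c', by positivity, N + 1, by linarith, fun t ht x hx => ?_⟩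
  have hc := S.cPhi x
  have htN : 1 ≤ t - N := by linarith
  have hV := S.cV
  have h1 := sub_le_integral_of_hasDerivAt (f := fun t => -(S.u x t * exp (t - S.Phi x t)))
    (g := fun s => -(exp (t - N - B) * (c' * (1 - K * S.V s)))) (a := t - N) (b := t)
    (by linarith) (by fun_prop)
    (by fun_prop) (fun s hs => (S.uexp_dt hx (by linarith [hs.1])).neg)
    (fun s hs => by
      have hs1 : 1 ≤ s := by linarith [hs.1]
      have hb := S.abs_Phi_le hx hs1
      have h3 : exp (t - N - B) ≤ exp (s - S.Phi x s) :=
        exp_le_exp.2 (by linarith [le_abs_self (S.Phi x s), hs.1])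
      have h4 := hθ s hs1 x hx
      have h5 := S.θ_pos x s
      have h6 : exp (t - N - B) * (c' * (1 - K * S.V s)) ≤ exp (t - N - B) * S.θ x s := by
        gcongr
      have h7 : exp (t - N - B) * S.θ x s ≤ exp (s - S.Phi x s) * S.θ x s := by gcongr
      linarith)
  have h2 : ∫ s in (t - N)..t, S.V s ≤ C := by
    have e := intervalIntegral.integral_add_adjacent_intervals (hV.intervalIntegrable 1 (t - N))
      (hV.intervalIntegrable (t - N) t) (μ := volume)
    have := S.integral_V_le (t := t) (by linarith)
    have h0 : 0 ≤ ∫ s in (1:ℝ)..(t - N), S.V s :=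
      intervalIntegral.integral_nonneg htN fun s _ => S.V_nonneg s
    linarith
  have h3 : ∫ s in (t - N)..t, (1 - K * S.V s) = N - K * ∫ s in (t - N)..t, S.V s := by
    rw [intervalIntegral.integral_sub (Continuous.intervalIntegrable (by fun_prop) _ _)
      (Continuous.intervalIntegrable (by fun_prop) _ _), intervalIntegral.integral_const_mul]
    simp
  rw [intervalIntegral.integral_neg, intervalIntegral.integral_const_mul,
    intervalIntegral.integral_const_mul, h3] at h1
  have h4 : 1 ≤ N - K * ∫ s in (t - N)..t, S.V s := by
    have : K * ∫ s in (t - N)..t, S.V s ≤ K * C := by gcongr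
    linarith
  have h5 : exp (t - N - B) * c' ≤ S.u x t * exp (t - S.Phi x t) := by
    have h6 : 0 < S.u x (t - N) * exp (t - N - S.Phi x (t - N)) :=
      mul_pos (S.u_pos _ _) (exp_pos _)
    have h7 : exp (t - N - B) * (c' * 1) ≤
      exp (t - N - B) * (c' * (N - K * ∫ s in (t - N)..t, S.V s)) := by gcongr
    linarith
  have hb := S.abs_Phi_le hx (t := t) (by linarith)
  calc exp (-(B + B + N)) * c' = exp (-B - t) * (exp (t - N - B) * c') := by
        rw [← mul_assoc, ← exp_add]; congr 2; ring
    _ ≤ exp (S.Phi x t - t) * (S.u x t * exp (t - S.Phi x t)) := by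
        refine mul_le_mul ?_ h5 (by positivity) (exp_pos _).le
        exact exp_le_exp.2 (by linarith [neg_abs_le (S.Phi x t)])
    _ = S.u x t := by rw [mul_left_comm, ← exp_add]; simp

/-- The weighted square norm of the heat flux. -/
noncomputable def X (t : ℝ) : ℝ := ∫ x in (0:ℝ)..1, S.u x t * S.F x t ^ 2

/-- The weighted square norm of the stress. -/
noncomputable def Y (t : ℝ) : ℝ := ∫ x in (0:ℝ)..1, S.u x t * S.sig x t ^ 2

/-- The square norm of the acceleration. -/
noncomputable def D (t : ℝ) : ℝ := ∫ x in (0:ℝ)..1, S.vt x t ^ 2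

/-- The integral of `θ ^ (β + 2)`. -/
noncomputable def P (t : ℝ) : ℝ := ∫ x in (0:ℝ)..1, S.pw (S.β + 2) x t

@[fun_prop] theorem cX : Continuous S.X :=
  continuous_integral_of_continuous (f := fun x t => S.u x t * S.F x t ^ 2) (by fun_prop) 0 1
@[fun_prop] theorem cY : Continuous S.Y :=
  continuous_integral_of_continuous (f := fun x t => S.u x t * S.sig x t ^ 2) (by fun_prop) 0 1
@[fun_prop] theorem cD : Continuous S.D :=
  continuous_integral_of_continuous (f := fun x t => S.vt x t ^ 2) (by fun_prop) 0 1
@[fun_prop] theorem cP : Continuous S.P :=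
  continuous_integral_of_continuous (by fun_prop) 0 1

theorem X_nonneg (t : ℝ) : 0 ≤ S.X t := intervalIntegral.integral_nonneg zero_le_one
  fun x _ => mul_nonneg (S.u_pos x t).le (sq_nonneg _)
theorem Y_nonneg (t : ℝ) : 0 ≤ S.Y t := intervalIntegral.integral_nonneg zero_le_one
  fun x _ => mul_nonneg (S.u_pos x t).le (sq_nonneg _)
theorem D_nonneg (t : ℝ) : 0 ≤ S.D t := intervalIntegral.integral_nonneg zero_le_one
  fun _ _ => sq_nonneg _
theorem P_nonneg (t : ℝ) : 0 ≤ S.P t := intervalIntegral.integral_nonneg zero_le_one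
  fun x _ => (S.pw_pos _ x t).le

theorem exists_integral_V_unit_le : ∃ C > 0, ∀ s ≥ 1, ∫ t in s..s + 1, S.V t ≤ C := by
  have hE := S.E_pos
  have h0 := S.integral_V_le le_rfl
  simp only [intervalIntegral.integral_same] at h0
  refine ⟨(1 + 2 * S.E) - S.G 1 + 1, by linarith, fun s hs => ?_⟩
  have e := intervalIntegral.integral_add_adjacent_intervals (S.cV.intervalIntegrable 1 s)
    (S.cV.intervalIntegrable s (s + 1)) (μ := volume)
  have := S.integral_V_le (t := s + 1) (by linarith)
  have h0 : 0 ≤ ∫ s in (1:ℝ)..s, S.V s :=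
    intervalIntegral.integral_nonneg hs fun s _ => S.V_nonneg s
  linarith

theorem exists_θ_le_V : ∃ C > 0, ∀ t ≥ 1, ∀ x ∈ Icc (0:ℝ) 1,
    S.θ x t ≤ C * (1 + S.V t) ∧ S.pw (S.β + 1) x t ≤ C * (1 + S.V t) := by
  obtain ⟨C, hC, h⟩ := S.exists_pw_le
  refine ⟨C + 1, by positivity, fun t ht x hx => ?_⟩
  have h1 := h t ht x hx
  have h2 := S.θ_le_one_add x t
  have h3 := S.V_nonneg t
  constructor <;> linarith

theorem P_le_V : ∃ C > 0, ∀ t ≥ 1, S.P t ≤ C * (1 + S.V t) := by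
  obtain ⟨C, hC, h⟩ := S.exists_θ_le_V
  have hE := S.E_pos
  refine ⟨C * S.E, by positivity, fun t ht => ?_⟩
  have hV := S.V_nonneg t
  have h1 := integral_le_mul (f := fun x => S.pw (S.β + 2) x t) (g := fun x => S.θ x t)
    zero_le_one (C * (1 + S.V t)) (by fun_prop) (by fun_prop) (fun x hx => by
      rw [show S.β + 2 = S.β + 1 + 1 by ring, pw_add_one]
      exact mul_le_mul_of_nonneg_right (h t ht x hx).2 (S.θ_pos x t).le)
  calc S.P t ≤ _ := h1
    _ ≤ C * (1 + S.V t) * S.E := by gcongr; exact S.integral_θ_le ht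
    _ = _ := by ring

theorem integral_v_sq_deriv {t : ℝ} (ht : 0 < t) :
    HasDerivAt (fun t => ∫ x in (0:ℝ)..1, S.v x t ^ 2)
      (∫ x in (0:ℝ)..1, -2 * S.sig x t * S.vx x t) t := by
  refine (hasDerivAt_integral_param (f := fun x t => S.v x t ^ 2)
    (f' := fun x t => 2 * S.v x t * S.vt x t) zero_le_one (by fun_prop) (by fun_prop) ht
    (fun x hx t ht => ((S.v_dt x hx t ht).pow 2).congr_deriv (by simp))).congr_deriv ?_
  have hz := integral_eq_zero_of_hasDerivAt
    (g := fun x => 2 * S.v x t * S.sig x t)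
    (g' := fun x => 2 * S.v x t * S.vt x t - -2 * S.sig x t * S.vx x t)
    (by fun_prop) (by fun_prop) (fun x hx => by
      refine (((S.v_dx t ht x hx).const_mul 2).mul (S.sig_dx t ht x hx)).congr_deriv ?_
      ring) (by simp [sig_zero]) (by simp [sig_one])
  rw [intervalIntegral.integral_sub (Continuous.intervalIntegrable (by fun_prop) _ _)
    (Continuous.intervalIntegrable (by fun_prop) _ _)] at hz
  exact sub_eq_zero.1 hz

theorem exists_integral_Y_le : ∃ C > 0, ∃ t₀ ≥ 1, ∀ s ≥ t₀, ∫ t in s..s + 1, S.Y t ≤ C := by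
  obtain ⟨c, hc, t₀, ht₀, hu⟩ := S.exists_le_u
  obtain ⟨C, hC, hθ⟩ := S.exists_θ_le_V
  obtain ⟨K, hK, hV⟩ := S.exists_integral_V_unit_le
  have hE := S.E_pos
  refine ⟨2 * S.E + C * S.E / c * (1 + K), by positivity, t₀, ht₀, fun s hs => ?_⟩
  have hNc : Continuous fun t => ∫ x in (0:ℝ)..1, S.v x t ^ 2 :=
    continuous_integral_of_continuous (f := fun x t => S.v x t ^ 2) (by fun_prop) 0 1
  have h1 := sub_le_integral_of_hasDerivAt (f := fun t => ∫ x in (0:ℝ)..1, S.v x t ^ 2)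
    (g := fun t => C * S.E / c * (1 + S.V t) - S.Y t) (a := s) (b := s + 1) (by linarith)
    hNc (by fun_prop) (fun t ht => S.integral_v_sq_deriv (by linarith [ht.1]))
    (fun t ht => by
      have ht1 : t₀ ≤ t := hs.trans ht.1.le
      have hVt := S.V_nonneg t
      have h2 := integral_le_add_two (f := fun x => -2 * S.sig x t * S.vx x t)
        (g₁ := fun x => S.u x t * S.sig x t ^ 2) (g₂ := fun x => S.θ x t) zero_le_one (-1)
        (C * (1 + S.V t) / c) (by fun_prop) (by fun_prop) (by fun_prop) (fun x hx => by
          have hux := hu t ht1 x hx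
          have hup := S.u_pos x t
          have hθp := S.θ_pos x t
          have a1 : S.θ x t * S.θ x t ≤ C * (1 + S.V t) * S.θ x t :=
            mul_le_mul_of_nonneg_right (hθ t (ht₀.trans ht1) x hx).1 hθp.le
          have a2 : S.θ x t * S.θ x t / S.u x t ≤ C * (1 + S.V t) / c * S.θ x t := by
            rw [div_mul_eq_mul_div]
            gcongr
          have a3 : -2 * S.sig x t * S.θ x t ≤ S.u x t * S.sig x t ^ 2
              + S.θ x t * S.θ x t / S.u x t := by
            have : S.u x t * S.sig x t ^ 2 + S.θ x t * S.θ x t / S.u x t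
              - -2 * S.sig x t * S.θ x t = (S.u x t * S.sig x t + S.θ x t) ^ 2 / S.u x t := by
              field_simp; ring
            have : 0 ≤ (S.u x t * S.sig x t + S.θ x t) ^ 2 / S.u x t := by positivity
            linarith
          rw [S.vx_eq]
          linarith)
      have h3 := S.integral_θ_le (t := t) (by linarith)
      have h4 : C * (1 + S.V t) / c * ∫ x in (0:ℝ)..1, S.θ x t ≤ C * (1 + S.V t) / c * S.E := by
        gcongr
      have h5 : C * (1 + S.V t) / c * S.E = C * S.E / c * (1 + S.V t) := by ring
      simp only [Y]
      linarith)
  rw [intervalIntegral.integral_sub (Continuous.intervalIntegrable (by fun_prop) _ _)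
    (Continuous.intervalIntegrable (by fun_prop) _ _), intervalIntegral.integral_const_mul,
    intervalIntegral.integral_add (Continuous.intervalIntegrable (by fun_prop) _ _)
    (Continuous.intervalIntegrable (by fun_prop) _ _)] at h1
  simp only [intervalIntegral.integral_const, add_sub_cancel_left, one_smul] at h1
  have h2 := hV s (by linarith)
  have h3 := S.integral_v_sq_le (t := s) (by linarith)
  have h4 : 0 ≤ ∫ x in (0:ℝ)..1, S.v x (s + 1) ^ 2 :=
    intervalIntegral.integral_nonneg zero_le_one fun x _ => sq_nonneg _
  have h5 : C * S.E / c * (1 + ∫ t in s..s + 1, S.V t) ≤ C * S.E / c * (1 + K) := by gcongr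
  linarith

/-- The time derivative of `P`. -/
noncomputable def Pd (t : ℝ) : ℝ :=
  ∫ x in (0:ℝ)..1, (S.β + 2) * S.pw (S.β + 1) x t * S.θt x t

theorem P_deriv {t : ℝ} (ht : 0 < t) : HasDerivAt S.P (S.Pd t) t :=
  hasDerivAt_integral_param (f := S.pw (S.β + 2))
    (f' := fun x t => (S.β + 2) * S.pw (S.β + 1) x t * S.θt x t) zero_le_one (by fun_prop)
    (by fun_prop) ht (fun x hx t ht => (S.pw_dt (S.β + 2) x hx t ht).congr_deriv (by
      rw [show S.β + 2 - 1 = S.β + 1 by ring]))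

theorem exists_Pd_le : ∃ K > 0, ∃ t₀ ≥ 1, ∀ t ≥ t₀,
    S.Pd t ≤ K * (1 + S.V t) * (S.Y t + S.P t) - S.X t := by
  obtain ⟨c, hc, t₀, ht₀, hu⟩ := S.exists_le_u
  obtain ⟨C, hC, hθ⟩ := S.exists_θ_le_V
  have hβ := S.β_pos
  set K := (S.β + 2) * (C * (3 / 2) + C / (2 * c)) with hK
  have hK0 : 0 < K := by positivity
  refine ⟨K, hK0, t₀, ht₀, fun t ht => ?_⟩
  have hVt := S.V_nonneg t
  have ht0 : 0 < t := by linarith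
  have hz := integral_eq_zero_of_hasDerivAt
    (g := fun x => S.pw (S.β + 1) x t * S.F x t)
    (g' := fun x => (S.β + 1) * (S.u x t * S.F x t ^ 2) + S.pw (S.β + 1) x t * S.Fx x t)
    (by fun_prop) (by fun_prop) (fun x hx => by
      refine ((S.pw_dx (S.β + 1) t ht0 x hx).mul (S.F_dx t ht0 x hx)).congr_deriv ?_
      rw [add_sub_cancel_right, sq, ← mul_assoc (S.u x t), S.uF_eq]; ring)
      (by simp [F_zero]) (by simp [F_one])
  rw [intervalIntegral.integral_add (Continuous.intervalIntegrable (by fun_prop) _ _)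
    (Continuous.intervalIntegrable (by fun_prop) _ _), intervalIntegral.integral_const_mul] at hz
  have h1 := integral_le_add_four
    (f := fun x => (S.β + 2) * S.pw (S.β + 1) x t * S.θt x t)
    (g₁ := fun x => S.pw (S.β + 1) x t * S.Fx x t) (g₂ := fun x => S.u x t * S.sig x t ^ 2)
    (g₃ := fun x => S.pw (S.β + 2) x t) (g₄ := fun _ => 0) zero_le_one (S.β + 2)
    (K * (1 + S.V t)) (K * (1 + S.V t)) 0 (by fun_prop) (by fun_prop) (by fun_prop)
    (by fun_prop) (by fun_prop) (fun x hx => by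
      obtain ⟨b1, b2⟩ := hθ t (ht₀.trans ht) x hx
      have hux := hu t ht x hx
      have hup := S.u_pos x t
      have hθp := S.θ_pos x t
      have hp := S.pw_pos (S.β + 1) x t
      have e : S.pw (S.β + 2) x t = S.pw (S.β + 1) x t * S.θ x t := by
        rw [show S.β + 2 = S.β + 1 + 1 by ring, pw_add_one]
      have a3 : S.sig x t * S.vx x t ≤ 3 / 2 * (S.u x t * S.sig x t ^ 2)
          + S.θ x t * S.θ x t / (2 * c) := by
        have k1 : S.sig x t * S.θ x t ≤ 1 / 2 * (S.u x t * S.sig x t ^ 2)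
            + S.θ x t * S.θ x t / (2 * S.u x t) := by
          have : 1 / 2 * (S.u x t * S.sig x t ^ 2) + S.θ x t * S.θ x t / (2 * S.u x t)
            - S.sig x t * S.θ x t = (S.u x t * S.sig x t - S.θ x t) ^ 2 / (2 * S.u x t) := by
            field_simp; ring
          have : 0 ≤ (S.u x t * S.sig x t - S.θ x t) ^ 2 / (2 * S.u x t) := by positivity
          linarith
        have k2 : S.θ x t * S.θ x t / (2 * S.u x t) ≤ S.θ x t * S.θ x t / (2 * c) := by gcongr
        rw [S.vx_eq]; linarith
      have a4 : S.pw (S.β + 1) x t * (S.sig x t * S.vx x t) ≤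
          C * (1 + S.V t) * (3 / 2 * (S.u x t * S.sig x t ^ 2))
          + C * (1 + S.V t) / (2 * c) * S.pw (S.β + 2) x t := by
        calc _ ≤ S.pw (S.β + 1) x t * (3 / 2 * (S.u x t * S.sig x t ^ 2)
              + S.θ x t * S.θ x t / (2 * c)) := by gcongr
          _ = S.pw (S.β + 1) x t * (3 / 2 * (S.u x t * S.sig x t ^ 2))
              + S.θ x t / (2 * c) * S.pw (S.β + 2) x t := by rw [e]; ring
          _ ≤ _ := by have := S.pw_pos (S.β + 2) x t; gcongr
      have a5 : 0 ≤ S.u x t * S.sig x t ^ 2 := by positivity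
      have a6 := (S.pw_pos (S.β + 2) x t).le
      have a7 : S.θt x t = S.Fx x t + S.sig x t * S.vx x t := by simp [Fx]
      have a8 : 0 ≤ (S.β + 2) * (C / (2 * c)) * (1 + S.V t) * (S.u x t * S.sig x t ^ 2) := by
        positivity
      have a9 : 0 ≤ (S.β + 2) * (C * (3 / 2)) * (1 + S.V t) * S.pw (S.β + 2) x t := by
        positivity
      have a10 := mul_le_mul_of_nonneg_left a4 (show 0 ≤ S.β + 2 by linarith)
      rw [a7]
      calc _ = (S.β + 2) * (S.pw (S.β + 1) x t * S.Fx x t)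
            + (S.β + 2) * (S.pw (S.β + 1) x t * (S.sig x t * S.vx x t)) := by ring
        _ ≤ (S.β + 2) * (S.pw (S.β + 1) x t * S.Fx x t) + (S.β + 2) *
          (C * (1 + S.V t) * (3 / 2 * (S.u x t * S.sig x t ^ 2))
          + C * (1 + S.V t) / (2 * c) * S.pw (S.β + 2) x t)
          + (S.β + 2) * (C / (2 * c)) * (1 + S.V t) * (S.u x t * S.sig x t ^ 2)
          + (S.β + 2) * (C * (3 / 2)) * (1 + S.V t) * S.pw (S.β + 2) x t := by linarith
        _ = _ := by rw [hK]; ring)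
  have hX := S.X_nonneg t
  have h2 : S.X t ≤ (S.β + 2) * ((S.β + 1) * S.X t) := by
    rw [← mul_assoc]; exact le_mul_of_one_le_left hX (by nlinarith)
  simp only [Pd, Y, P, X] at *
  nlinarith

theorem sig_sq_le {t : ℝ} (ht : 0 < t) {x : ℝ} (hx : x ∈ Icc (0:ℝ) 1) {κ : ℝ} (hκ : 0 < κ) :
    S.sig x t ^ 2 ≤ κ * S.D t + κ⁻¹ * ∫ x in (0:ℝ)..1, S.sig x t ^ 2 := by
  have h1 := abs_sub_le_integral_abs (f := fun x => S.sig x t ^ 2)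
    (f' := fun x => 2 * S.sig x t * S.vt x t) (by fun_prop) (by fun_prop)
    (fun x hx => ((S.sig_dx t ht x hx).pow 2).congr_deriv (by simp)) hx
    (y := 0) (by simp)
  have h2 := integral_le_add_two (f := fun x => |2 * S.sig x t * S.vt x t|)
    (g₁ := fun x => S.vt x t ^ 2) (g₂ := fun x => S.sig x t ^ 2) zero_le_one κ κ⁻¹
    (by fun_prop) (by fun_prop) (by fun_prop) (fun x _ => by
      have e1 : κ * S.vt x t ^ 2 + κ⁻¹ * S.sig x t ^ 2 - 2 * S.sig x t * S.vt x t
        = κ⁻¹ * (κ * S.vt x t - S.sig x t) ^ 2 := by field_simp; ring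
      have e2 : κ * S.vt x t ^ 2 + κ⁻¹ * S.sig x t ^ 2 + 2 * S.sig x t * S.vt x t
        = κ⁻¹ * (κ * S.vt x t + S.sig x t) ^ 2 := by field_simp; ring
      have e3 : 0 ≤ κ⁻¹ * (κ * S.vt x t - S.sig x t) ^ 2 := by positivity
      have e4 : 0 ≤ κ⁻¹ * (κ * S.vt x t + S.sig x t) ^ 2 := by positivity
      exact abs_le.2 ⟨by linarith, by linarith⟩)
  simp only [sig_zero] at h1
  have h3 := le_abs_self (S.sig x t ^ 2 - 0 ^ 2)
  simp only [D]
  linarith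

theorem sig_sq_le_D {t : ℝ} (ht : 0 < t) {x : ℝ} (hx : x ∈ Icc (0:ℝ) 1) :
    S.sig x t ^ 2 ≤ S.D t := by
  have h1 := abs_sub_le_integral_abs (f := fun x => S.sig x t) (by fun_prop) (by fun_prop)
    (S.sig_dx t ht) hx (y := 0) (by simp)
  have h2 := sq_integral_mul_le (f := fun _ => 1) (g := fun x => |S.vt x t|) zero_le_one
    (by fun_prop) (by fun_prop)
  simp only [one_mul, one_pow, sq_abs, intervalIntegral.integral_const, sub_zero,
    one_smul] at h2
  simp only [sig_zero, sub_zero] at h1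
  calc S.sig x t ^ 2 = |S.sig x t| ^ 2 := (sq_abs _).symm
    _ ≤ (∫ z in (0:ℝ)..1, |S.vt z t|) ^ 2 := by gcongr
    _ ≤ _ := h2

/-- The time derivative of `Y`. -/
noncomputable def Yd (t : ℝ) : ℝ := ∫ x in (0:ℝ)..1, (-2 * S.vt x t * S.vt x t
  - 2 * S.sig x t * S.θt x t - S.sig x t ^ 2 * (S.vx x t - S.u x t))

theorem Y_deriv {t : ℝ} (ht : 0 < t) : HasDerivAt S.Y (S.Yd t) t :=
  hasDerivAt_integral_mul_sq (u' := fun x t => S.vx x t - S.u x t) ht (by fun_prop) (by fun_prop)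
    (by fun_prop) (by fun_prop) S.cv S.cvt S.cvx S.cθ S.cθt S.u_dt S.v_dt S.θ_dt S.sig_dx S.v_dx
    S.vx_eq S.sig_zero S.sig_one

theorem exists_Yd_le : ∃ K > 0, ∃ t₀ ≥ 1, ∀ t ≥ t₀,
    S.Yd t ≤ K * (S.X t + S.Y t) - S.D t := by
  obtain ⟨c, hc, t₀, ht₀, hu⟩ := S.exists_le_u
  have hE := S.E_pos
  set κ := (288 * S.E)⁻¹ with hκ
  have hκ0 : 0 < κ := by positivity
  set K := 72 * S.E * κ⁻¹ / c + 2 / c + 1 with hK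
  refine ⟨K, by positivity, t₀, ht₀, fun t ht => ?_⟩
  have ht0 : 0 < t := by linarith
  set m := κ * S.D t + κ⁻¹ * ∫ x in (0:ℝ)..1, S.sig x t ^ 2 with hm
  have hm0 : 0 ≤ m := (sq_nonneg _).trans (S.sig_sq_le ht0 (x := 0) (by simp) hκ0)
  have hz := integral_eq_zero_of_hasDerivAt
    (g := fun x => 2 * (S.sig x t * S.F x t) + 3 * (S.sig x t ^ 2 * S.v x t))
    (g' := fun x => 2 * (S.vt x t * S.F x t + S.sig x t * S.Fx x t)
      + 3 * (2 * S.sig x t * S.vt x t * S.v x t + S.sig x t ^ 2 * S.vx x t))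
    (by fun_prop) (by fun_prop) (fun x hx => by
      refine ((((S.sig_dx t ht0 x hx).mul (S.F_dx t ht0 x hx)).const_mul 2).add
        ((((S.sig_dx t ht0 x hx).pow 2).mul (S.v_dx t ht0 x hx)).const_mul 3)).congr_deriv ?_
      simp)
      (by simp [sig_zero]) (by simp [sig_one])
  have h1 := integral_le_add_four
    (f := fun x => (-2 * S.vt x t * S.vt x t
      - 2 * S.sig x t * S.θt x t - S.sig x t ^ 2 * (S.vx x t - S.u x t))
      + (2 * (S.vt x t * S.F x t + S.sig x t * S.Fx x t)
      + 3 * (2 * S.sig x t * S.vt x t * S.v x t + S.sig x t ^ 2 * S.vx x t)))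
    (g₁ := fun x => S.vt x t ^ 2) (g₂ := fun x => S.v x t ^ 2)
    (g₃ := fun x => S.u x t * S.F x t ^ 2) (g₄ := fun x => S.u x t * S.sig x t ^ 2) zero_le_one
    (-(5 / 4)) (36 * m) (2 / c) 1 (by fun_prop) (by fun_prop) (by fun_prop)
    (by fun_prop) (by fun_prop) (fun x hx => by
      have hux := hu t ht x hx
      have hup := S.u_pos x t
      have a7 : S.θt x t = S.Fx x t + S.sig x t * S.vx x t := by simp [Fx]
      have a1 : 36 * (S.sig x t ^ 2 * S.v x t ^ 2) ≤ 36 * m * S.v x t ^ 2 := by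
        rw [mul_assoc]; gcongr; exact S.sig_sq_le ht0 hx hκ0
      have a2 : 2 * S.F x t ^ 2 ≤ 2 / c * (S.u x t * S.F x t ^ 2) := by
        have : 2 * S.F x t ^ 2 = 2 / c * (c * S.F x t ^ 2) := by field_simp
        rw [this]; gcongr
      rw [a7]
      nlinarith [sq_nonneg (S.vt x t - 2 * S.F x t),
        sq_nonneg (S.vt x t - 12 * (S.sig x t * S.v x t))])
  rw [intervalIntegral.integral_add (Continuous.intervalIntegrable (by fun_prop) _ _)
    (Continuous.intervalIntegrable (by fun_prop) _ _), hz, add_zero] at h1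
  have h2 : 36 * m * (∫ x in (0:ℝ)..1, S.v x t ^ 2) ≤ 36 * m * (2 * S.E) := by
    gcongr; exact S.integral_v_sq_le (by linarith)
  have h3 : ∫ x in (0:ℝ)..1, S.sig x t ^ 2 ≤ 1 / c * S.Y t :=
    integral_le_mul zero_le_one (1 / c) (by fun_prop) (by fun_prop) fun x hx => by
      have hux := hu t ht x hx
      calc S.sig x t ^ 2 = 1 / c * (c * S.sig x t ^ 2) := by field_simp
        _ ≤ _ := by gcongr
  have h4 : 36 * m * (2 * S.E) ≤ 1 / 4 * S.D t + 72 * S.E * κ⁻¹ / c * S.Y t := by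
    calc 36 * m * (2 * S.E) = 72 * S.E * κ * S.D t + 72 * S.E * κ⁻¹ *
          ∫ x in (0:ℝ)..1, S.sig x t ^ 2 := by rw [hm]; ring
      _ ≤ 72 * S.E * κ * S.D t + 72 * S.E * κ⁻¹ * (1 / c * S.Y t) := by gcongr
      _ = _ := by
        have : 72 * S.E * κ = 1 / 4 := by rw [hκ]; field_simp; norm_num
        rw [this]; ring
  have hX := S.X_nonneg t
  have hY := S.Y_nonneg t
  have b1 : 0 ≤ 72 * S.E * κ⁻¹ / c * S.X t := by positivity
  have b2 : 0 ≤ 2 / c * S.Y t := by positivity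
  have h5 : K * (S.X t + S.Y t) = 72 * S.E * κ⁻¹ / c * S.X t + 72 * S.E * κ⁻¹ / c * S.Y t
    + 2 / c * S.X t + 2 / c * S.Y t + S.X t + S.Y t := by rw [hK]; ring
  rw [h5]
  change S.Yd t ≤ -(5 / 4) * S.D t + 36 * m * _ + 2 / c * S.X t + 1 * S.Y t at h1
  linarith

theorem exists_integral_le : ∃ C > 0, ∃ t₀ ≥ 1, ∀ s ≥ t₀,
    S.Y s ≤ C ∧ ∫ t in s..s + 1, (S.D t + S.X t) ≤ C := by
  obtain ⟨K₁, hK₁, t₁, ht₁, h1⟩ := S.exists_Pd_le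
  obtain ⟨K₂, hK₂, t₂, ht₂, h2⟩ := S.exists_Yd_le
  obtain ⟨K₃, hK₃, t₃, ht₃, h3⟩ := S.exists_integral_Y_le
  obtain ⟨K₄, hK₄, h4⟩ := S.P_le_V
  obtain ⟨K₅, hK₅, h5⟩ := S.exists_integral_V_unit_le
  set M := K₂ + 1 with hM
  set k := K₂ + M * K₁ with hk
  have hk0 : 0 < k := by positivity
  let L : ℝ → ℝ := fun t => S.Y t + M * S.P t
  have hLc : Continuous L := by fun_prop
  have hL0 : ∀ t, 0 ≤ L t := fun t => by
    have := S.Y_nonneg t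
    have := S.P_nonneg t
    positivity
  have hLd : ∀ t > 0, HasDerivAt L (S.Yd t + M * S.Pd t) t := fun t ht =>
    (S.Y_deriv ht).add ((S.P_deriv ht).const_mul M)
  set t₀ := max (max t₁ t₂) t₃ with ht₀
  have l1 : t₁ ≤ t₀ := (le_max_left _ _).trans (le_max_left _ _)
  have l2 : t₂ ≤ t₀ := (le_max_right _ _).trans (le_max_left _ _)
  have l3 : t₃ ≤ t₀ := le_max_right _ _
  have hle : ∀ t ≥ t₀, S.Yd t + M * S.Pd t ≤ k * (1 + S.V t) * L t - (S.D t + S.X t) := by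
    intro t ht
    have e1 := h1 t (l1.trans ht)
    have e2 := h2 t (l2.trans ht)
    have hV := S.V_nonneg t
    have hY := S.Y_nonneg t
    have hP := S.P_nonneg t
    have e3 : M * S.Pd t ≤ M * (K₁ * (1 + S.V t) * (S.Y t + S.P t) - S.X t) := by gcongr
    have e4 : k * (1 + S.V t) * L t = K₂ * S.Y t + K₂ * S.V t * S.Y t
      + K₂ * (1 + S.V t) * (M * S.P t) + M * K₁ * (1 + S.V t) * S.Y t
      + M * K₁ * (1 + S.V t) * S.P t + M * K₁ * (1 + S.V t) * (K₂ * S.P t) := by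
      simp only [L, hk, hM]; ring
    have e5 : 0 ≤ K₂ * S.V t * S.Y t := by positivity
    have e6 : 0 ≤ K₂ * (1 + S.V t) * (M * S.P t) := by positivity
    have e7 : 0 ≤ M * K₁ * (1 + S.V t) * (K₂ * S.P t) := by positivity
    have e8 : M * (K₁ * (1 + S.V t) * (S.Y t + S.P t) - S.X t) =
      M * K₁ * (1 + S.V t) * S.Y t + M * K₁ * (1 + S.V t) * S.P t - K₂ * S.X t - S.X t := by
      rw [hM]; ring
    linarith
  have hI : ∀ a b : ℝ, a ≤ b → 0 ≤ ∫ t in a..b, (S.D t + S.X t) := fun a b hab =>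
    intervalIntegral.integral_nonneg hab fun t _ => add_nonneg (S.D_nonneg t) (S.X_nonneg t)
  have hVi : ∀ s ≥ t₀, ∫ t in s..s + 1, k * (1 + S.V t) ≤ k * (1 + K₅) := by
    intro s hs
    rw [intervalIntegral.integral_const_mul, intervalIntegral.integral_add
      (Continuous.intervalIntegrable (by fun_prop) _ _)
      (Continuous.intervalIntegrable (by fun_prop) _ _)]
    have := h5 s (by linarith)
    simp only [intervalIntegral.integral_const, add_sub_cancel_left, one_smul]
    gcongr
  set C₁ := exp (k * (1 + K₅)) * (K₃ + M * (K₄ * (1 + K₅))) with hC₁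
  have hC₁0 : 0 < C₁ := by positivity
  have hLb : ∀ s ≥ t₀, L (s + 1) ≤ C₁ := by
    intro s hs
    have hV := S.V_nonneg
    have g := uniform_gronwall (f := L) (g := fun t => k * (1 + S.V t)) (h := fun _ => 0) (s := s)
      hLc (by fun_prop) (by fun_prop) (fun t _ => hL0 t)
      (fun t _ => by have := hV t; positivity) (fun t _ => le_rfl)
      (fun t ht => hLd t (by linarith [ht.1]))
      (fun t ht => by
        have := hle t (hs.trans ht.1.le)
        have := S.D_nonneg t
        have := S.X_nonneg t
        linarith)
    simp only [intervalIntegral.integral_zero, add_zero] at g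
    refine g.trans ?_
    have i1 : ∫ t in s..s + 1, L t ≤ 1 * (∫ t in s..s + 1, S.Y t) + M * ∫ t in s..s + 1, S.P t :=
      integral_le_add_two (by linarith) 1 M hLc (by fun_prop) (by fun_prop)
        fun t _ => by simp only [L]; linarith
    have i2 : ∫ t in s..s + 1, S.P t ≤ K₄ * ∫ t in s..s + 1, (1 + S.V t) :=
      integral_le_mul (by linarith) K₄ (by fun_prop) (by fun_prop)
        fun t ht => h4 t (by linarith [ht.1])
    have i3 := hVi s hs
    rw [intervalIntegral.integral_const_mul] at i3
    have i4 : ∫ t in s..s + 1, (1 + S.V t) ≤ 1 + K₅ := le_of_mul_le_mul_left i3 hk0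
    have i5 := h3 s (l3.trans hs)
    have i6 : ∫ t in s..s + 1, S.P t ≤ K₄ * (1 + K₅) := i2.trans (by gcongr)
    have i7 : M * ∫ t in s..s + 1, S.P t ≤ M * (K₄ * (1 + K₅)) := by gcongr
    refine mul_le_mul (exp_le_exp.2 (hVi s hs)) (by linarith) ?_ (exp_pos _).le
    exact intervalIntegral.integral_nonneg (by linarith) fun t _ => hL0 t
  refine ⟨C₁ + k * (1 + K₅) * C₁, by positivity, t₀ + 1, by linarith, fun s hs => ?_⟩
  have hLb' : ∀ t ≥ s, L t ≤ C₁ := fun t ht => by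
    have := hLb (t - 1) (by linarith)
    rwa [sub_add_cancel] at this
  constructor
  · have a1 := hLb' s le_rfl
    have a2 := S.P_nonneg s
    have a3 : 0 ≤ M * S.P s := by positivity
    have a4 : 0 ≤ k * (1 + K₅) * C₁ := by positivity
    simp only [L] at a1
    linarith
  · have g := sub_le_integral_of_hasDerivAt (f := L)
      (g := fun t => k * (1 + S.V t) * C₁ - (S.D t + S.X t)) (a := s) (b := s + 1)
      (by linarith) hLc (by fun_prop) (fun t ht => hLd t (by linarith [ht.1]))
      (fun t ht => by
        have e := hle t (by linarith [ht.1])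
        have hV := S.V_nonneg t
        have : k * (1 + S.V t) * L t ≤ k * (1 + S.V t) * C₁ := by
          gcongr; exact hLb' t ht.1.le
        linarith)
    rw [intervalIntegral.integral_sub (Continuous.intervalIntegrable (by fun_prop) _ _)
      (Continuous.intervalIntegrable (by fun_prop) _ _),
      intervalIntegral.integral_mul_const] at g
    have a1 := hLb' s le_rfl
    have a2 := hL0 (s + 1)
    have a3 : (∫ t in s..s + 1, k * (1 + S.V t)) * C₁ ≤ k * (1 + K₅) * C₁ := by
      gcongr; exact hVi s (by linarith)
    linarith

theorem osc_pw {U t : ℝ} (hU : ∀ x ∈ Icc (0:ℝ) 1, S.u x t ≤ U) (ht : 0 < t) {x y : ℝ}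
    (hx : x ∈ Icc (0:ℝ) 1) (hy : y ∈ Icc (0:ℝ) 1) :
    (S.pw (S.β + 1) x t - S.pw (S.β + 1) y t) ^ 2 ≤ (S.β + 1) ^ 2 * U * S.X t := by
  have h1 := abs_sub_le_integral_abs (f := fun x => S.pw (S.β + 1) x t)
    (f' := fun x => (S.β + 1) * (S.u x t * S.F x t)) (by fun_prop) (by fun_prop)
    (fun x hx => (S.pw_dx (S.β + 1) t ht x hx).congr_deriv (by
      rw [add_sub_cancel_right, S.uF_eq, mul_assoc])) hx hy
  have h2 := sq_integral_mul_le (f := fun _ => 1)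
    (g := fun x => |(S.β + 1) * (S.u x t * S.F x t)|) zero_le_one (by fun_prop) (by fun_prop)
  simp only [one_mul, one_pow, sq_abs, intervalIntegral.integral_const, sub_zero,
    one_smul] at h2
  have h3 : ∫ x in (0:ℝ)..1, ((S.β + 1) * (S.u x t * S.F x t)) ^ 2 ≤ (S.β + 1) ^ 2 * U * S.X t :=
    integral_le_mul zero_le_one ((S.β + 1) ^ 2 * U) (by fun_prop) (by fun_prop) fun x hx => by
      have hu := hU x hx
      have hup := S.u_pos x t
      calc _ = (S.β + 1) ^ 2 * S.u x t * (S.u x t * S.F x t ^ 2) := by ring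
        _ ≤ _ := by gcongr
  calc _ = |S.pw (S.β + 1) x t - S.pw (S.β + 1) y t| ^ 2 := (sq_abs _).symm
    _ ≤ (∫ x in (0:ℝ)..1, |(S.β + 1) * (S.u x t * S.F x t)|) ^ 2 := by gcongr
    _ ≤ _ := h2.trans h3

theorem pw_le_one_add {r s : ℝ} (hr : 0 ≤ r) (hrs : r ≤ s) (x t : ℝ) :
    S.pw r x t ≤ 1 + S.pw s x t := by
  have hp := S.pw_pos s x t
  rcases le_total (S.θ x t) 1 with h | h
  · have : S.pw r x t ≤ 1 := rpow_le_one (S.θ_pos x t).le h hr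
    linarith
  · have : S.pw r x t ≤ S.pw s x t := rpow_le_rpow_of_exponent_le h hrs
    linarith

theorem exists_pw_le_X : ∃ C > 0, ∀ t ≥ 1, ∀ x ∈ Icc (0:ℝ) 1, ∀ r, 0 ≤ r → r ≤ 2 * (S.β + 1) →
    S.pw r x t ≤ C * (1 + S.X t) := by
  obtain ⟨U, hU0, hU⟩ := S.exists_u_le
  have hE := S.E_pos
  have hβ := S.β_pos
  set a := 2 * (S.E ^ (S.β + 1)) ^ 2 with ha
  set b := 2 * ((S.β + 1) ^ 2 * U) with hb
  refine ⟨1 + a + b, by positivity, fun t ht x hx r hr hr' => ?_⟩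
  obtain ⟨y, hy, hyE⟩ := S.exists_θ_le ht
  have h1 := S.osc_pw (hU t ht) (by linarith) hx hy
  have h2 : S.pw (S.β + 1) y t ≤ S.E ^ (S.β + 1) :=
    rpow_le_rpow (S.θ_pos y t).le hyE (by linarith)
  have h3 := S.pw_pos (S.β + 1) y t
  have h4 := S.pw_le_one_add hr hr' x t
  have h5 : S.pw (2 * (S.β + 1)) x t = S.pw (S.β + 1) x t ^ 2 := by
    rw [two_mul, pw_add, sq]
  have h6 : S.pw (S.β + 1) y t ^ 2 ≤ (S.E ^ (S.β + 1)) ^ 2 := by gcongr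
  have hX := S.X_nonneg t
  have h7 : S.pw (S.β + 1) x t ^ 2 ≤ a + b * S.X t := by
    have := sq_nonneg (S.pw (S.β + 1) x t - 2 * S.pw (S.β + 1) y t)
    have e : b * S.X t = 2 * ((S.β + 1) ^ 2 * U * S.X t) := by rw [hb]; ring
    rw [e, ha]
    nlinarith
  have h8 : 0 ≤ a * S.X t := by positivity
  have h9 : 0 ≤ b := by positivity
  have h10 : (1 + a + b) * (1 + S.X t) = 1 + (a + b * S.X t) + (S.X t + a * S.X t + b) := by ring
  linarith

/-- The time derivative of `X`. -/
noncomputable def Xd (t : ℝ) : ℝ := ∫ x in (0:ℝ)..1,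
  (-2 * S.Fx x t * (S.pw S.β x t * S.θt x t) - 2 * S.F x t * 0
    - S.F x t ^ 2 * (S.vx x t - S.u x t))

theorem X_deriv {t : ℝ} (ht : 0 < t) : HasDerivAt S.X (S.Xd t) t := by
  have hβ : S.β + 1 ≠ 0 := by linarith [S.β_pos]
  exact hasDerivAt_integral_mul_sq (u' := fun x t => S.vx x t - S.u x t)
    (a := S.F) (a' := S.Fx) (p := fun x t => S.pw (S.β + 1) x t / (S.β + 1))
    (p' := fun x t => S.pw S.β x t * S.θt x t) (px := fun x t => S.pw S.β x t * S.θx x t)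
    (q := fun _ _ => 0) (q' := fun _ _ => 0) ht (by fun_prop) (by fun_prop)
    (by fun_prop) (by fun_prop) (by fun_prop (disch := exact fun _ => hβ)) (by fun_prop) (by fun_prop) (by fun_prop) (by fun_prop) S.u_dt
    (fun x hx t ht => ((S.pw_dt (S.β + 1) x hx t ht).div_const _).congr_deriv (by
      rw [add_sub_cancel_right]; field_simp))
    (fun x _ t _ => hasDerivAt_const t 0) S.F_dx
    (fun t ht x hx => ((S.pw_dx (S.β + 1) t ht x hx).div_const _).congr_deriv (by
      rw [add_sub_cancel_right]; field_simp))
    (fun x t => by rw [S.uF_eq, add_zero]) S.F_zero S.F_one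

theorem exists_Xd_le : ∃ K > 0, ∃ t₀ ≥ 1, ∀ t ≥ t₀, ∀ B,
    (∀ x ∈ Icc (0:ℝ) 1, S.pw S.β x t ≤ B ∧ S.pw (S.β + 2) x t ≤ B) →
    S.Xd t ≤ K * B * (1 + S.D t) * S.Y t + (2 + S.D t) * S.X t := by
  obtain ⟨U, hU0, hU⟩ := S.exists_u_le
  obtain ⟨c, hc, t₀, ht₀, hu⟩ := S.exists_le_u
  refine ⟨U + 1 / c, by positivity, t₀, ht₀, fun t ht B hB => ?_⟩
  have hD := S.D_nonneg t
  have ht0 : 0 < t := by linarith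
  refine integral_le_add_two (g₁ := fun x => S.u x t * S.sig x t ^ 2)
    (g₂ := fun x => S.u x t * S.F x t ^ 2) zero_le_one _ _ (by fun_prop) (by fun_prop)
    (by fun_prop) (fun x hx => ?_)
  obtain ⟨b1, b2⟩ := hB x hx
  have hux := hu t ht x hx
  have huU := hU t (ht₀.trans ht) x hx
  have hup := S.u_pos x t
  have hθp := S.θ_pos x t
  have hp := S.pw_pos S.β x t
  have hp2 := S.pw_pos (S.β + 2) x t
  have hB0 : 0 < B := hp.trans_le b1
  have hs := S.sig_sq_le_D ht0 hx
  have e2 : S.pw (S.β + 2) x t = S.pw S.β x t * S.θ x t ^ 2 := by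
    rw [show S.β + 2 = S.β + 1 + 1 by ring, pw_add_one, pw_add_one]; ring
  have a7 : S.θt x t = S.Fx x t + S.sig x t * S.vx x t := by simp [Fx]
  have a1 : -2 * S.Fx x t * (S.pw S.β x t * S.θt x t)
      ≤ S.pw S.β x t * (1 / 2 * (S.sig x t * S.vx x t) ^ 2) := by
    rw [a7]
    nlinarith [mul_nonneg hp.le (sq_nonneg (2 * S.Fx x t + S.sig x t * S.vx x t))]
  have a2 : S.pw S.β x t * (1 / 2 * (S.sig x t * S.vx x t) ^ 2) ≤
      S.pw S.β x t * S.u x t * S.sig x t ^ 2 * (S.u x t * S.sig x t ^ 2)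
      + S.pw (S.β + 2) x t * (1 / S.u x t) * (S.u x t * S.sig x t ^ 2) := by
    rw [S.vx_eq, e2]
    have : S.pw S.β x t * S.θ x t ^ 2 * (1 / S.u x t) * (S.u x t * S.sig x t ^ 2) =
      S.pw S.β x t * S.θ x t ^ 2 * S.sig x t ^ 2 := by field_simp
    rw [this]
    nlinarith [mul_nonneg (mul_nonneg hp.le (sq_nonneg (S.sig x t)))
      (sq_nonneg (S.u x t * S.sig x t - S.θ x t))]
  have a3 : S.pw S.β x t * S.u x t * S.sig x t ^ 2 * (S.u x t * S.sig x t ^ 2)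
      ≤ B * U * S.D t * (S.u x t * S.sig x t ^ 2) := by gcongr
  have a4 : S.pw (S.β + 2) x t * (1 / S.u x t) * (S.u x t * S.sig x t ^ 2)
      ≤ B * (1 / c) * (S.u x t * S.sig x t ^ 2) := by gcongr
  have a5 : - (S.F x t ^ 2 * (S.vx x t - S.u x t)) ≤ (2 + S.D t) * (S.u x t * S.F x t ^ 2) := by
    have k1 : -S.sig x t ≤ 1 + S.D t := by nlinarith [sq_nonneg (S.sig x t + 1)]
    have k2 : 0 ≤ S.F x t ^ 2 * S.θ x t := by positivity
    have k3 : (S.u x t * S.F x t ^ 2) * (-S.sig x t) ≤ (S.u x t * S.F x t ^ 2) * (1 + S.D t) := by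
      gcongr
    rw [S.vx_eq]
    linarith
  have a6 : 0 ≤ B * U * (S.u x t * S.sig x t ^ 2) := by positivity
  have a8 : 0 ≤ B * (1 / c) * S.D t * (S.u x t * S.sig x t ^ 2) := by positivity
  have a9 : (U + 1 / c) * B * (1 + S.D t) * (S.u x t * S.sig x t ^ 2)
    = B * U * S.D t * (S.u x t * S.sig x t ^ 2) + B * (1 / c) * (S.u x t * S.sig x t ^ 2)
      + B * U * (S.u x t * S.sig x t ^ 2) + B * (1 / c) * S.D t * (S.u x t * S.sig x t ^ 2) := by
    ring
  rw [a9]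
  linarith

theorem exists_X_le : ∃ C > 0, ∃ t₀ ≥ 1, ∀ t ≥ t₀, S.X t ≤ C := by
  obtain ⟨K₁, hK₁, t₁, ht₁, h1⟩ := S.exists_integral_le
  obtain ⟨K₂, hK₂, t₂, ht₂, h2⟩ := S.exists_Xd_le
  obtain ⟨K₃, hK₃, h3⟩ := S.exists_pw_le_X
  have hβ := S.β_pos
  set k := K₂ * K₃ * K₁ + 2 with hk
  refine ⟨exp (k * (1 + K₁)) * (1 + K₁), by positivity, max t₁ t₂ + 1, by
    have := le_max_left t₁ t₂; linarith, fun t ht => ?_⟩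
  obtain ⟨s, rfl⟩ : ∃ s, t = s + 1 := ⟨t - 1, by ring⟩
  have hs : max t₁ t₂ ≤ s := by linarith
  have l1 : t₁ ≤ s := (le_max_left _ _).trans hs
  have l2 : t₂ ≤ s := (le_max_right _ _).trans hs
  have hg := uniform_gronwall (f := fun t => 1 + S.X t) (f' := S.Xd)
    (g := fun t => k * (1 + S.D t))
    (h := fun _ => 0) (s := s) (by fun_prop) (by fun_prop) (by fun_prop)
    (fun t _ => by have := S.X_nonneg t; positivity)
    (fun t _ => by have := S.D_nonneg t; positivity) (fun _ _ => le_rfl)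
    (fun t ht => (S.X_deriv (by linarith [ht.1])).const_add 1)
    (fun t ht => by
      have hst : s ≤ t := ht.1.le
      have hX := S.X_nonneg t
      have hY := S.Y_nonneg t
      have hD := S.D_nonneg t
      have e1 := h2 t (l2.trans hst) (K₃ * (1 + S.X t)) (fun x hx =>
        ⟨h3 t (by linarith) x hx _ hβ.le (by linarith),
          h3 t (by linarith) x hx _ (by linarith) (by linarith)⟩)
      have e2 := (h1 t (l1.trans hst)).1
      have e3 : K₂ * (K₃ * (1 + S.X t)) * (1 + S.D t) * S.Y t ≤
        K₂ * (K₃ * (1 + S.X t)) * (1 + S.D t) * K₁ := by gcongr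
      have e4 : 0 ≤ S.D t * S.X t := by positivity
      have e5 : k * (1 + S.D t) * (1 + S.X t) = K₂ * (K₃ * (1 + S.X t)) * (1 + S.D t) * K₁
        + 2 * ((1 + S.D t) * (1 + S.X t)) := by rw [hk]; ring
      rw [e5]
      linarith)
  simp only [intervalIntegral.integral_zero, add_zero] at hg
  have i1 := (h1 s l1).2
  have i2 : ∫ t in s..s + 1, S.D t ≤ K₁ := by
    refine le_trans ?_ i1
    exact intervalIntegral.integral_mono_on (by linarith) (S.cD.intervalIntegrable _ _)
      ((S.cD.add S.cX).intervalIntegrable _ _) fun t _ => by linarith [S.X_nonneg t]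
  have i3 : ∫ t in s..s + 1, S.X t ≤ K₁ := by
    refine le_trans ?_ i1
    exact intervalIntegral.integral_mono_on (by linarith) (S.cX.intervalIntegrable _ _)
      ((S.cD.add S.cX).intervalIntegrable _ _) fun t _ => by linarith [S.D_nonneg t]
  rw [intervalIntegral.integral_const_mul, intervalIntegral.integral_add
      (Continuous.intervalIntegrable (by fun_prop) _ _)
      (Continuous.intervalIntegrable (by fun_prop) _ _), intervalIntegral.integral_add
      (Continuous.intervalIntegrable (by fun_prop) _ _)
      (Continuous.intervalIntegrable (by fun_prop) _ _)] at hg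
  simp only [intervalIntegral.integral_const, add_sub_cancel_left, one_smul] at hg
  have i4 : 0 ≤ ∫ t in s..s + 1, S.X t :=
    intervalIntegral.integral_nonneg (by linarith) fun t _ => S.X_nonneg t
  calc S.X (s + 1) ≤ 1 + S.X (s + 1) := by linarith
    _ ≤ _ := hg
    _ ≤ _ := by gcongr

theorem exists_pw_le_const : ∃ C > 0, ∃ t₀ ≥ 1, ∀ t ≥ t₀, ∀ x ∈ Icc (0:ℝ) 1,
    ∀ r, 0 ≤ r → r ≤ 2 * (S.β + 1) → S.pw r x t ≤ C := by
  obtain ⟨K₁, hK₁, t₁, ht₁, h1⟩ := S.exists_X_le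
  obtain ⟨K₃, hK₃, h3⟩ := S.exists_pw_le_X
  refine ⟨K₃ * (1 + K₁), by positivity, t₁, ht₁, fun t ht x hx r hr hr' => ?_⟩
  refine (h3 t (ht₁.trans ht) x hx r hr hr').trans ?_
  have := h1 t ht
  gcongr

theorem tendsto_X_add_Y : Tendsto (fun t => S.X t + S.Y t) atTop (𝓝 0) := by
  obtain ⟨K₁, hK₁, t₁, ht₁, h1⟩ := S.exists_integral_le
  obtain ⟨K₂, hK₂, t₂, ht₂, h2⟩ := S.exists_Xd_le
  obtain ⟨K₃, hK₃, t₃, ht₃, h3⟩ := S.exists_pw_le_const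
  obtain ⟨K₄, hK₄, t₄, ht₄, h4⟩ := S.exists_Yd_le
  obtain ⟨K₅, hK₅, t₅, ht₅, h5⟩ := S.exists_X_le
  have hβ := S.β_pos
  set t₀ := max (max t₁ t₂) (max (max t₃ t₄) t₅) with ht₀
  have l1 : t₁ ≤ t₀ := by simp [ht₀]
  have l2 : t₂ ≤ t₀ := by simp [ht₀]
  have l3 : t₃ ≤ t₀ := by simp [ht₀]
  have l4 : t₄ ≤ t₀ := by simp [ht₀]
  have l5 : t₅ ≤ t₀ := by simp [ht₀]
  have hXY : ∀ t ≥ t₀, S.X t + S.Y t ≤ K₃ * S.V t := by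
    intro t ht
    have e := integral_le_mul (f := fun x => S.u x t * S.F x t ^ 2 + S.u x t * S.sig x t ^ 2)
      (g := fun x => S.Vd x t) zero_le_one K₃ (by fun_prop) (by fun_prop) (fun x hx => by
        have b1 := h3 t (l3.trans ht) x hx (S.β + 2) (by linarith) (by linarith)
        have b2 := h3 t (l3.trans ht) x hx 1 (by linarith) (by linarith)
        rw [show S.pw 1 x t = S.θ x t from rpow_one _] at b2
        have hup := S.u_pos x t
        have hθp := S.θ_pos x t
        have hp := S.pw_pos S.β x t
        have e2 : S.pw (S.β + 2) x t = S.pw S.β x t * S.θ x t ^ 2 := by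
          rw [show S.β + 2 = S.β + 1 + 1 by ring, pw_add_one, pw_add_one]; ring
        have c1 : S.u x t * S.F x t ^ 2 = S.pw (S.β + 2) x t *
            (S.F x t * S.θx x t / S.θ x t ^ 2) := by
          rw [sq, ← mul_assoc, uF_eq, e2]; field_simp
        have c2 : S.u x t * S.sig x t ^ 2 = S.θ x t * (S.u x t * S.sig x t ^ 2 / S.θ x t) := by
          field_simp
        have c3 : 0 ≤ S.F x t * S.θx x t / S.θ x t ^ 2 := by
          rw [F_eq]
          have : S.pw S.β x t * S.θx x t / S.u x t * S.θx x t / S.θ x t ^ 2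
            = S.pw S.β x t * S.θx x t ^ 2 / (S.u x t * S.θ x t ^ 2) := by field_simp
          rw [this]; positivity
        calc _ = S.pw (S.β + 2) x t * (S.F x t * S.θx x t / S.θ x t ^ 2)
              + S.θ x t * (S.u x t * S.sig x t ^ 2 / S.θ x t) := by rw [← c1, ← c2]
          _ ≤ K₃ * (S.F x t * S.θx x t / S.θ x t ^ 2)
              + K₃ * (S.u x t * S.sig x t ^ 2 / S.θ x t) := by gcongr
          _ = K₃ * S.Vd x t := by rw [Vd]; ring)
    rw [intervalIntegral.integral_add (Continuous.intervalIntegrable (by fun_prop) _ _)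
      (Continuous.intervalIntegrable (by fun_prop) _ _)] at e
    exact e
  set M := K₂ * K₃ * K₁ + K₅ + 1 with hM
  set k := (K₂ * K₃ + 2 + M * K₄) + (1 + M) with hk
  let H : ℝ → ℝ := fun t => S.X t + M * S.Y t
  have hM1 : 1 ≤ M := by have : 0 < K₂ * K₃ * K₁ := by positivity
                         linarith
  have hH : ∀ s ≥ t₀, S.X (s + 1) + S.Y (s + 1) ≤ 2 * k * K₃ * ∫ t in s..s + 1, S.V t := by
    intro s hs
    have key : ∀ t ≥ t₀, S.Xd t + M * S.Yd t ≤ k * K₃ * S.V t ∧ H t ≤ k * K₃ * S.V t := by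
      intro t ht
      have hX := S.X_nonneg t
      have hY := S.Y_nonneg t
      have hD := S.D_nonneg t
      have e1 := h2 t (l2.trans ht) K₃ (fun x hx =>
        ⟨h3 t (l3.trans ht) x hx _ hβ.le (by linarith),
          h3 t (l3.trans ht) x hx _ (by linarith) (by linarith)⟩)
      have e2 := (h1 t (l1.trans ht)).1
      have e3 := h5 t (l5.trans ht)
      have e4 := h4 t (l4.trans ht)
      have e5 : M * S.Yd t ≤ M * (K₄ * (S.X t + S.Y t) - S.D t) := by gcongr
      have e6 : S.D t * S.Y t * (K₂ * K₃) ≤ S.D t * K₁ * (K₂ * K₃) := by gcongr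
      have e7 : S.D t * S.X t ≤ S.D t * K₅ := by gcongr
      have e8 : S.Xd t + M * S.Yd t ≤ (K₂ * K₃ + 2 + M * K₄) * (S.X t + S.Y t) := by
        have i1 : 0 ≤ K₂ * K₃ * S.X t := by positivity
        have i2 : M * (K₄ * (S.X t + S.Y t) - S.D t) = M * K₄ * (S.X t + S.Y t)
          - (S.D t * K₁ * (K₂ * K₃) + S.D t * K₅ + S.D t) := by rw [hM]; ring
        linarith
      have e9 : (K₂ * K₃ + 2 + M * K₄) * (S.X t + S.Y t) ≤ k * (S.X t + S.Y t) := by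
        have : 0 ≤ (1 + M) * (S.X t + S.Y t) := by positivity
        rw [hk]; linarith
      have e10 : H t ≤ k * (S.X t + S.Y t) := by
        have j1 : 0 ≤ (K₂ * K₃ + 2 + M * K₄) * (S.X t + S.Y t) := by positivity
        have j2 : 0 ≤ M * S.X t := by positivity
        simp only [H, hk]; linarith
      have e11 : k * (S.X t + S.Y t) ≤ k * K₃ * S.V t := by
        rw [mul_assoc]; have := hXY t ht; gcongr
      exact ⟨by linarith, by linarith⟩
    have hg := uniform_gronwall (f := H) (f' := fun t => S.Xd t + M * S.Yd t)
      (g := fun _ => 0) (h := fun t => k * K₃ * S.V t) (s := s) (by fun_prop) (by fun_prop)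
      (by fun_prop) (fun t _ => by
        have := S.X_nonneg t
        have := S.Y_nonneg t
        positivity) (fun _ _ => le_rfl)
      (fun t _ => by have := S.V_nonneg t; positivity)
      (fun t ht => (S.X_deriv (by linarith [ht.1])).add
        ((S.Y_deriv (by linarith [ht.1])).const_mul M))
      (fun t ht => by have := (key t (hs.trans ht.1.le)).1; linarith)
    have hHi : ∫ t in s..s + 1, H t ≤ k * K₃ * ∫ t in s..s + 1, S.V t :=
      integral_le_mul (by linarith) _ (by fun_prop) (by fun_prop)
        fun t ht => (key t (hs.trans ht.1)).2
    simp only [intervalIntegral.integral_zero, exp_zero, one_mul,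
      intervalIntegral.integral_const_mul] at hg
    have hY : S.Y (s + 1) ≤ M * S.Y (s + 1) := le_mul_of_one_le_left (S.Y_nonneg _) hM1
    simp only [H] at hg hHi
    linarith
  have hlim := ((tendsto_integral_unit_of_bounded S.cV S.V_nonneg
    (fun t ht => S.integral_V_le ht)).const_mul (2 * k * K₃))
  rw [mul_zero] at hlim
  have : Tendsto (fun s => S.X (s + 1) + S.Y (s + 1)) atTop (𝓝 0) :=
    tendsto_of_tendsto_of_tendsto_of_le_of_le' tendsto_const_nhds hlim
      (Eventually.of_forall fun s => add_nonneg (S.X_nonneg _) (S.Y_nonneg _))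
      (eventually_atTop.2 ⟨t₀, hH⟩)
  have h := this.comp (tendsto_atTop_add_const_right atTop (-1) tendsto_id)
  refine h.congr fun t => ?_
  simp

theorem tendsto_X : Tendsto S.X atTop (𝓝 0) :=
  squeeze_zero S.X_nonneg (fun t => le_add_of_nonneg_right (S.Y_nonneg t)) S.tendsto_X_add_Y

theorem tendsto_Y : Tendsto S.Y atTop (𝓝 0) :=
  squeeze_zero S.Y_nonneg (fun t => le_add_of_nonneg_left (S.X_nonneg t)) S.tendsto_X_add_Y

end StripFlow

theorem sq_sub_integral_le {f f' : ℝ → ℝ} (hf : Continuous f) (hf' : Continuous f')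
    (hd : ∀ x ∈ Ioo (0:ℝ) 1, HasDerivAt f (f' x) x) {x : ℝ} (hx : x ∈ Icc (0:ℝ) 1) :
    (f x - ∫ y in (0:ℝ)..1, f y) ^ 2 ≤ ∫ y in (0:ℝ)..1, f' y ^ 2 := by
  set I := ∫ z in (0:ℝ)..1, |f' z| with hI
  have h1 : ∀ y ∈ Icc (0:ℝ) 1, |f x - f y| ≤ I := fun y hy =>
    abs_sub_le_integral_abs hf hf' hd hx hy
  have h2 := integral_le_mul (f := f) (g := fun _ => 1) zero_le_one (f x + I) hf (by fun_prop)
    fun y hy => by linarith [neg_abs_le (f x - f y), h1 y hy]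
  have h3 := integral_le_mul (f := fun y => -f y) (g := fun _ => 1) zero_le_one (-f x + I)
    (by fun_prop) (by fun_prop) fun y hy => by linarith [le_abs_self (f x - f y), h1 y hy]
  rw [intervalIntegral.integral_neg] at h3
  simp only [intervalIntegral.integral_const, sub_zero, one_smul, mul_one] at h2 h3
  have h4 : |f x - ∫ y in (0:ℝ)..1, f y| ≤ I := abs_le.2 ⟨by linarith, by linarith⟩
  have h5 := sq_integral_mul_le (f := fun _ => 1) (g := fun x => |f' x|) zero_le_one
    (by fun_prop) (by fun_prop)
  simp only [one_mul, one_pow, sq_abs, intervalIntegral.integral_const, sub_zero,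
    one_smul] at h5
  calc _ = |f x - ∫ y in (0:ℝ)..1, f y| ^ 2 := (sq_abs _).symm
    _ ≤ I ^ 2 := by gcongr
    _ ≤ _ := h5

/-- Equality of mixed partial derivatives on the strip. -/
theorem hasDerivAt_of_mixed {f fx ft ftx : ℝ → ℝ → ℝ} (hf : Continuous (Function.uncurry f))
    (hfx : Continuous (Function.uncurry fx)) (hft : Continuous (Function.uncurry ft))
    (hftx : Continuous (Function.uncurry ftx))
    (hdx : ∀ t > 0, ∀ x ∈ Ioo (0:ℝ) 1, HasDerivAt (fun y => f y t) (fx x t) x)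
    (hdt : ∀ x ∈ Icc (0:ℝ) 1, ∀ t > 0, HasDerivAt (f x) (ft x t) t)
    (hdtx : ∀ t > 0, ∀ x ∈ Ioo (0:ℝ) 1, HasDerivAt (fun y => ft y t) (ftx x t) x) :
    ∀ x ∈ Icc (0:ℝ) 1, ∀ t > 0, HasDerivAt (fx x) (ftx x t) t := by
  intro x hx t ht
  let Q : ℝ → ℝ → ℝ := fun x s => fx x t + ∫ r in t..s, ftx x r
  have hQc : Continuous (Function.uncurry Q) := by
    have : Continuous (fun p : ℝ × ℝ => ∫ r in t..p.2, ftx p.1 r) :=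
      intervalIntegral.continuous_parametric_intervalIntegral_of_continuous
        (f := fun (p : ℝ × ℝ) r => ftx p.1 r) (by fun_prop) (by fun_prop)
    exact (show Continuous fun p : ℝ × ℝ => fx p.1 t by fun_prop).add this
  have hQt : ∀ x s, HasDerivAt (Q x) (ftx x s) s := fun x s =>
    (hasDerivAt_integral_of_continuous (show Continuous (ftx x) by fun_prop) t s).const_add _
  have h_int : ∀ y ∈ Icc (0:ℝ) 1, ∀ s > 0,
      ∫ x in (0:ℝ)..y, Q x s = ∫ x in (0:ℝ)..y, fx x s := by
    intro y hy s hs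
    have e1 : ∀ s > 0, ∫ x in (0:ℝ)..y, fx x s = f y s - f 0 s := fun s hs =>
      intervalIntegral.integral_eq_sub_of_hasDerivAt_of_le hy.1
        (f := fun x => f x s) (show Continuous fun x => f x s by fun_prop).continuousOn
        (fun z hz => hdx s hs z ⟨hz.1, hz.2.trans_le hy.2⟩)
        (Continuous.intervalIntegrable (by fun_prop) _ _)
    have e2 : ∀ s > 0, ∫ x in (0:ℝ)..y, ftx x s = ft y s - ft 0 s := fun s hs =>
      intervalIntegral.integral_eq_sub_of_hasDerivAt_of_le hy.1
        (f := fun x => ft x s) (show Continuous fun x => ft x s by fun_prop).continuousOn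
        (fun z hz => hdtx s hs z ⟨hz.1, hz.2.trans_le hy.2⟩)
        (Continuous.intervalIntegrable (by fun_prop) _ _)
    have hd : ∀ s > 0, HasDerivAt (fun s => (∫ x in (0:ℝ)..y, Q x s) - (f y s - f 0 s)) 0 s := by
      intro s hs
      have := ((hasDerivAt_integral_param hy.1 hQc hftx hs fun x _ t _ => hQt x t).sub
        ((hdt y hy s hs).sub (hdt 0 (by simp) s hs)))
      exact this.congr_deriv (by rw [e2 s hs, sub_self])
    have hconst := (convex_Ioi (0:ℝ)).is_const_of_fderivWithin_eq_zero (𝕜 := ℝ)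
      (f := fun s => (∫ x in (0:ℝ)..y, Q x s) - (f y s - f 0 s))
      (fun s hs => (hd s hs).differentiableAt.differentiableWithinAt)
      (fun s hs => by
        have := (hd s hs).hasFDerivAt.hasFDerivWithinAt (s := Ioi 0)
        rw [this.fderivWithin (isOpen_Ioi.uniqueDiffWithinAt hs)]
        ext; simp)
      (show s ∈ Ioi 0 from hs) (show t ∈ Ioi 0 from ht)
    have hQ0 : ∀ x, Q x t = fx x t := fun x => by simp [Q]
    simp only [hQ0, e1 t ht] at hconst
    rw [e1 s hs]
    linarith
  have hQx : ∀ s > 0, Q x s = fx x s := by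
    intro s hs
    have hEq : EqOn (fun x => Q x s) (fun x => fx x s) (Ioo 0 1) := by
      intro y hy
      have d1 := hasDerivAt_integral_of_continuous (show Continuous fun x => Q x s by fun_prop) 0 y
      have d2 := hasDerivAt_integral_of_continuous
        (show Continuous fun x => fx x s by fun_prop) 0 y
      refine d1.unique (d2.congr_of_eventuallyEq ?_)
      filter_upwards [Ioo_mem_nhds hy.1 hy.2] with z hz
      exact h_int z ⟨hz.1.le, hz.2.le⟩ s hs
    have hcl := hEq.closure (by fun_prop) (by fun_prop)
    rw [closure_Ioo (by norm_num)] at hcl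
    exact hcl hx
  refine (hQt x t).congr_of_eventuallyEq ?_
  filter_upwards [Ioi_mem_nhds ht] with s hs
  exact (hQx s hs).symm

namespace StripFlow
variable (S : StripFlow)

theorem exists_le_θ : ∃ c > 0, ∃ t₀ ≥ 1, ∀ t ≥ t₀, ∀ x ∈ Icc (0:ℝ) 1, c ≤ S.θ x t := by
  obtain ⟨U, hU0, hU⟩ := S.exists_u_le
  obtain ⟨c, hc, hcθ⟩ := S.exists_θ_ge
  have hβ := S.β_pos
  have hβ1 : 0 < S.β + 1 := by linarith
  set d := c ^ (S.β + 1)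
  have hd : 0 < d := rpow_pos_of_pos hc _
  have h := (S.tendsto_X.const_mul ((S.β + 1) ^ 2 * U))
  rw [mul_zero] at h
  obtain ⟨t₀, ht₀⟩ := eventually_atTop.1
    (h.eventually (gt_mem_nhds (show 0 < (d / 2) ^ 2 by positivity)))
  refine ⟨(d / 2) ^ (S.β + 1)⁻¹, rpow_pos_of_pos (by positivity) _, max t₀ 1, le_max_right _ _,
    fun t ht x hx => ?_⟩
  have ht1 : 1 ≤ t := (le_max_right _ _).trans ht
  obtain ⟨y, hy, hyc⟩ := hcθ t ht1
  have h1 := S.osc_pw (hU t ht1) (by linarith) hx hy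
  have h2 := ht₀ t ((le_max_left _ _).trans ht)
  have h3 : d ≤ S.pw (S.β + 1) y t := rpow_le_rpow hc.le hyc hβ1.le
  have h4 := abs_le_of_sq_le_sq' (h1.trans h2.le) (by positivity)
  have h5 : d / 2 ≤ S.pw (S.β + 1) x t := by linarith [h4.1]
  calc _ ≤ (S.pw (S.β + 1) x t) ^ (S.β + 1)⁻¹ :=
        rpow_le_rpow (by positivity) h5 (by positivity)
    _ = S.θ x t := rpow_rpow_inv (S.θ_pos x t).le hβ1.ne'

theorem tendsto_integral_θx_sq : Tendsto (fun t => ∫ x in (0:ℝ)..1, S.θx x t ^ 2) atTop (𝓝 0) := by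
  obtain ⟨U, hU0, hU⟩ := S.exists_u_le
  obtain ⟨c, hc, t₀, ht₀, hθ⟩ := S.exists_le_θ
  have hβ := S.β_pos
  have hcb : 0 < c ^ S.β := rpow_pos_of_pos hc _
  have h := S.tendsto_X.const_mul (U / (c ^ S.β) ^ 2)
  rw [mul_zero] at h
  refine tendsto_of_tendsto_of_tendsto_of_le_of_le' tendsto_const_nhds h
    (Eventually.of_forall fun t => intervalIntegral.integral_nonneg zero_le_one
      fun _ _ => sq_nonneg _) (eventually_atTop.2 ⟨t₀, fun t ht => ?_⟩)
  refine integral_le_mul zero_le_one _ (by fun_prop) (by fun_prop) fun x hx => ?_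
  have h1 : c ^ S.β ≤ S.pw S.β x t := rpow_le_rpow hc.le (hθ t ht x hx) hβ.le
  have h2 := hU t (ht₀.trans ht) x hx
  have h3 := S.u_pos x t
  have h4 := S.pw_pos S.β x t
  have h5 : S.θx x t ^ 2 = S.u x t / S.pw S.β x t ^ 2 * (S.u x t * S.F x t ^ 2) := by
    have := S.uF_eq x t
    have : S.u x t * (S.u x t * S.F x t ^ 2) = (S.pw S.β x t * S.θx x t) ^ 2 := by
      rw [← this]; ring
    rw [div_mul_eq_mul_div, this]; field_simp
  rw [h5]
  gcongr

/-- The mean temperature. -/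
noncomputable def Θ (t : ℝ) : ℝ := ∫ x in (0:ℝ)..1, S.θ x t

@[fun_prop] theorem cΘ : Continuous S.Θ := continuous_integral_of_continuous S.cθ 0 1

theorem tendsto_integral_vx_sub_mean :
    Tendsto (fun t => ∫ x in (0:ℝ)..1, (S.vx x t - S.Θ t) ^ 2) atTop (𝓝 0) := by
  obtain ⟨U, hU0, hU⟩ := S.exists_u_le
  have h := (S.tendsto_Y.const_mul (2 * U)).add (S.tendsto_integral_θx_sq.const_mul 2)
  simp only [mul_zero, add_zero] at h
  refine tendsto_of_tendsto_of_tendsto_of_le_of_le' tendsto_const_nhds h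
    (Eventually.of_forall fun t => intervalIntegral.integral_nonneg zero_le_one
      fun _ _ => sq_nonneg _) (eventually_atTop.2 ⟨1, fun t ht => ?_⟩)
  have e := integral_le_add_two (f := fun x => (S.vx x t - S.Θ t) ^ 2)
    (g₁ := fun x => S.u x t * S.sig x t ^ 2) (g₂ := fun _ => 1) zero_le_one (2 * U)
    (2 * ∫ x in (0:ℝ)..1, S.θx x t ^ 2) (by fun_prop) (by fun_prop) (by fun_prop)
    (fun x hx => by
      have h1 := sq_sub_integral_le (f := fun x => S.θ x t) (by fun_prop) (by fun_prop)
        (S.θ_dx t (by linarith)) hx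
      have h2 := hU t ht x hx
      have h3 := S.u_pos x t
      have h4 : S.u x t * (S.u x t * S.sig x t ^ 2) ≤ U * (S.u x t * S.sig x t ^ 2) := by gcongr
      rw [S.vx_eq]
      simp only [Θ]
      nlinarith [sq_nonneg (S.u x t * S.sig x t - (S.θ x t - ∫ x in (0:ℝ)..1, S.θ x t))])
  simp only [intervalIntegral.integral_const, sub_zero, one_smul, mul_one] at e
  exact e

/-- The conserved momentum. -/
noncomputable def m : ℝ := ∫ x in (0:ℝ)..1, S.v x 0

theorem v_sub_affine_sq_le {t : ℝ} (ht : 0 < t) {x : ℝ} (hx : x ∈ Icc (0:ℝ) 1) (a : ℝ) :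
    (S.v x t - S.m - a * (x - 1 / 2)) ^ 2 ≤ ∫ x in (0:ℝ)..1, (S.vx x t - a) ^ 2 := by
  have h := sq_sub_integral_le (f := fun x => S.v x t - S.m - a * (x - 1 / 2))
    (f' := fun x => S.vx x t - a) (by fun_prop) (by fun_prop)
    (fun x hx => (((S.v_dx t ht x hx).sub_const S.m).sub
      (((hasDerivAt_id x).sub_const (1 / 2)).const_mul a)).congr_deriv (by ring)) hx
  have h0 : ∫ x in (0:ℝ)..1, (S.v x t - S.m - a * (x - 1 / 2)) = 0 := by
    rw [intervalIntegral.integral_sub (Continuous.intervalIntegrable (by fun_prop) _ _)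
      (Continuous.intervalIntegrable (by fun_prop) _ _),
      intervalIntegral.integral_sub (Continuous.intervalIntegrable (by fun_prop) _ _)
      (Continuous.intervalIntegrable (by fun_prop) _ _), S.integral_v_eq ht.le,
      intervalIntegral.integral_const_mul, intervalIntegral.integral_sub
      (Continuous.intervalIntegrable (by fun_prop) _ _)
      (Continuous.intervalIntegrable (by fun_prop) _ _)]
    simp [m]
  rwa [h0, sub_zero] at h

theorem exists_tendsto_mean : ∃ a, Tendsto S.Θ atTop (𝓝 a) := by
  have hs := S.tendsto_integral_vx_sub_mean
  set s : ℝ → ℝ := fun t => ∫ x in (0:ℝ)..1, (S.vx x t - S.Θ t) ^ 2 with hsdef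
  have hE := S.E_pos
  have hq := hs.sqrt
  rw [sqrt_zero] at hq
  set K := |S.m| + S.E
  have hb : ∀ t ≥ 1, |S.E - (S.m ^ 2 / 2 + S.Θ t ^ 2 / 24 + S.Θ t)| ≤ K * √(s t) + s t := by
    intro t ht
    have hs0 : 0 ≤ s t := intervalIntegral.integral_nonneg zero_le_one fun _ _ => sq_nonneg _
    have hΘ : S.Θ t ≤ S.E := S.integral_θ_le ht
    have hΘ0 : 0 ≤ S.Θ t := intervalIntegral.integral_nonneg zero_le_one
      fun x _ => (S.θ_pos x t).le
    have e1 : ∫ x in (0:ℝ)..1, (S.m + S.Θ t * (x - 1 / 2)) ^ 2 = S.m ^ 2 + S.Θ t ^ 2 / 12 := by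
      have : ∀ x ∈ Set.uIcc (0:ℝ) 1, HasDerivAt (fun x => S.m ^ 2 * x + S.m * S.Θ t * (x ^ 2 - x)
        + S.Θ t ^ 2 * (x ^ 3 / 3 - x ^ 2 / 2 + x / 4)) ((S.m + S.Θ t * (x - 1 / 2)) ^ 2) x := by
        intro x _
        have d1 := hasDerivAt_id x
        have d2 := (hasDerivAt_id x).pow 2
        have d3 := (hasDerivAt_id x).pow 3
        refine (((d1.const_mul (S.m ^ 2)).add ((d2.sub d1).const_mul (S.m * S.Θ t))).add
          ((((d3.div_const 3).sub (d2.div_const 2)).add (d1.div_const 4)).const_mul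
            (S.Θ t ^ 2))).congr_deriv ?_
        simp
        ring
      rw [intervalIntegral.integral_eq_sub_of_hasDerivAt this
        (Continuous.intervalIntegrable (by fun_prop) _ _)]
      norm_num
      ring
    have e2 := S.integral_energy ht
    have e3 : S.E - (S.m ^ 2 / 2 + S.Θ t ^ 2 / 24 + S.Θ t) =
        ∫ x in (0:ℝ)..1, (S.v x t ^ 2 / 2 + S.θ x t
          - (S.m + S.Θ t * (x - 1 / 2)) ^ 2 / 2 - S.θ x t) := by
      rw [intervalIntegral.integral_sub (Continuous.intervalIntegrable (by fun_prop) _ _)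
        (Continuous.intervalIntegrable (by fun_prop) _ _), intervalIntegral.integral_sub
        (Continuous.intervalIntegrable (by fun_prop) _ _)
        (Continuous.intervalIntegrable (by fun_prop) _ _), e2,
        intervalIntegral.integral_div, e1]
      simp only [Θ]
      ring
    rw [e3]
    refine (intervalIntegral.abs_integral_le_integral_abs zero_le_one).trans ?_
    have e4 := integral_le_mul (f := fun x => |S.v x t ^ 2 / 2 + S.θ x t
          - (S.m + S.Θ t * (x - 1 / 2)) ^ 2 / 2 - S.θ x t|) (g := fun _ => 1) zero_le_one
          (K * √(s t) + s t) (by fun_prop) (by fun_prop) (fun x hx => by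
        have f1 := S.v_sub_affine_sq_le (show 0 < t by linarith) hx (S.Θ t)
        set g := S.v x t - S.m - S.Θ t * (x - 1 / 2) with hg
        have f2 : |g| ≤ √(s t) := abs_le_sqrt f1
        have f3 : |S.m + S.Θ t * (x - 1 / 2)| ≤ K := by
          refine (abs_add_le _ _).trans ?_
          have : |S.Θ t * (x - 1 / 2)| ≤ S.E := by
            rw [abs_mul, abs_of_nonneg hΘ0]
            have : |x - 1 / 2| ≤ 1 := abs_le.2 ⟨by linarith [hx.1], by linarith [hx.2]⟩
            calc _ ≤ S.E * 1 := by gcongr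
              _ = _ := mul_one _
          simp only [K]; linarith
        have f4 : S.v x t ^ 2 / 2 + S.θ x t - (S.m + S.Θ t * (x - 1 / 2)) ^ 2 / 2 - S.θ x t
          = (S.m + S.Θ t * (x - 1 / 2)) * g + g ^ 2 / 2 := by rw [hg]; ring
        rw [f4, mul_one]
        refine (abs_add_le _ _).trans ?_
        rw [abs_mul, abs_of_nonneg (show 0 ≤ g ^ 2 / 2 by positivity)]
        have f5 : |S.m + S.Θ t * (x - 1 / 2)| * |g| ≤ K * √(s t) := by gcongr
        have f6 : g ^ 2 ≤ s t := f1
        linarith)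
    simpa using e4
  have hlim0 := (hq.const_mul K).add hs
  simp only [mul_zero, add_zero] at hlim0
  have hlim : Tendsto (fun t => S.E - (S.m ^ 2 / 2 + S.Θ t ^ 2 / 24 + S.Θ t)) atTop (𝓝 0) :=
    squeeze_zero_norm' (eventually_atTop.2 ⟨1, hb⟩) hlim0
  have hfin := ((hlim.const_mul 24).const_sub (144 + 24 * (S.E - S.m ^ 2 / 2) : ℝ)).sqrt.sub_const 12
  refine ⟨_, hfin.congr fun t => ?_⟩
  have hΘ0 : 0 ≤ S.Θ t := intervalIntegral.integral_nonneg zero_le_one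
    fun x _ => (S.θ_pos x t).le
  have : 144 + 24 * (S.E - S.m ^ 2 / 2) - 24 * (S.E - (S.m ^ 2 / 2 + S.Θ t ^ 2 / 24 + S.Θ t))
    = (S.Θ t + 12) ^ 2 := by ring
  rw [this, sqrt_sq (by linarith)]
  ring

theorem exists_tendsto_integral_vx_sub : ∃ a,
    Tendsto (fun t => ∫ x in (0:ℝ)..1, (S.vx x t - a) ^ 2) atTop (𝓝 0) := by
  obtain ⟨a, ha⟩ := S.exists_tendsto_mean
  refine ⟨a, ?_⟩
  have h := (S.tendsto_integral_vx_sub_mean.const_mul 2).add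
    (((ha.sub_const a).pow 2).const_mul 2)
  simp only [mul_zero, add_zero, sub_self, ne_eq, OfNat.ofNat_ne_zero, not_false_eq_true,
    zero_pow] at h
  refine squeeze_zero (fun t => intervalIntegral.integral_nonneg zero_le_one
      fun _ _ => sq_nonneg _) (fun t => ?_) h
  have e := integral_le_add_two (f := fun x => (S.vx x t - a) ^ 2)
    (g₁ := fun x => (S.vx x t - S.Θ t) ^ 2) (g₂ := fun _ => 1) zero_le_one 2
    (2 * (S.Θ t - a) ^ 2) (by fun_prop) (by fun_prop) (by fun_prop)
    (fun x hx => by nlinarith [sq_nonneg ((S.vx x t - S.Θ t) - (S.Θ t - a))])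
  simpa using e

theorem tendsto_integral_vx_sub_u {a : ℝ}
    (ha : Tendsto (fun t => ∫ x in (0:ℝ)..1, (S.vx x t - a) ^ 2) atTop (𝓝 0)) :
    Tendsto (fun t => ∫ x in (0:ℝ)..1, (S.vx x t - S.u x t) ^ 2) atTop (𝓝 0) := by
  have hq : Tendsto (fun t => ∫ x in (0:ℝ)..1, (S.u x t - a) ^ 2) atTop (𝓝 0) := by
    refine tendsto_zero_of_deriv_le (t₀ := 1) (c := 1) one_pos
      (continuous_integral_of_continuous (f := fun x t => (S.u x t - a) ^ 2) (by fun_prop) 0 1)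
      (fun t _ => intervalIntegral.integral_nonneg zero_le_one fun _ _ => sq_nonneg _) ha
      (fun t ht => hasDerivAt_integral_param (f := fun x t => (S.u x t - a) ^ 2)
        (f' := fun x t => 2 * (S.u x t - a) * (S.vx x t - S.u x t)) zero_le_one (by fun_prop)
        (by fun_prop) (by linarith) fun x hx t ht =>
          (((S.u_dt x hx t ht).sub_const a).pow 2).congr_deriv (by simp)) (fun t ht => ?_)
    have := integral_le_add_two (f := fun x => 2 * (S.u x t - a) * (S.vx x t - S.u x t))
      (g₁ := fun x => (S.u x t - a) ^ 2) (g₂ := fun x => (S.vx x t - a) ^ 2) zero_le_one (-1) 1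
      (by fun_prop) (by fun_prop) (by fun_prop)
      (fun x hx => by nlinarith [sq_nonneg ((S.u x t - a) - (S.vx x t - a))])
    linarith
  have h := (ha.const_mul 2).add (hq.const_mul 2)
  simp only [mul_zero, add_zero] at h
  refine squeeze_zero (fun t => intervalIntegral.integral_nonneg zero_le_one
      fun _ _ => sq_nonneg _) (fun t => ?_) h
  exact integral_le_add_two zero_le_one 2 2 (by fun_prop) (by fun_prop) (by fun_prop)
    (fun x hx => by nlinarith [sq_nonneg ((S.vx x t - a) + (S.u x t - a))])

theorem ux_div_u_dt : ∀ x ∈ Icc (0:ℝ) 1, ∀ t > 0, HasDerivAt (fun t => S.ux x t / S.u x t)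
    (S.vt x t + S.θx x t / S.u x t - S.θ x t / S.u x t * (S.ux x t / S.u x t)) t := by
  have hu := fun x t => (S.u_pos x t).ne'
  refine hasDerivAt_of_mixed (f := fun x t => log (S.u x t))
    (fx := fun x t => S.ux x t / S.u x t) (ft := fun x t => S.sig x t + S.θ x t / S.u x t - 1)
    (ftx := fun x t => S.vt x t + S.θx x t / S.u x t - S.θ x t / S.u x t * (S.ux x t / S.u x t))
    (S.cu.log fun _ => hu _ _)
    (by fun_prop (disch := intros; exact (S.u_pos _ _).ne'))
    (by fun_prop (disch := intros; exact (S.u_pos _ _).ne'))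
    (by fun_prop (disch := intros; exact (S.u_pos _ _).ne'))
    (fun t ht x hx => (S.u_dx t ht x hx).log (hu x t)) (fun x hx t ht => ?_)
    (fun t ht x hx => ?_)
  · refine ((S.u_dt x hx t ht).log (hu x t)).congr_deriv ?_
    have := hu x t
    rw [S.vx_eq]; field_simp
  · refine (((S.sig_dx t ht x hx).add ((S.θ_dx t ht x hx).div (S.u_dx t ht x hx)
      (hu x t))).sub_const 1).congr_deriv ?_
    have := hu x t
    field_simp
    ring

theorem tendsto_integral_ux_sq {a : ℝ}
    (ha : Tendsto (fun t => ∫ x in (0:ℝ)..1, (S.vx x t - a) ^ 2) atTop (𝓝 0)) :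
    Tendsto (fun t => ∫ x in (0:ℝ)..1, S.ux x t ^ 2) atTop (𝓝 0) := by
  obtain ⟨U, hU0, hU⟩ := S.exists_u_le
  obtain ⟨c, hc, t₁, ht₁, hθ⟩ := S.exists_le_θ
  obtain ⟨c', hc', t₂, ht₂, hu⟩ := S.exists_le_u
  obtain ⟨B, hB, t₃, ht₃, hp⟩ := S.exists_pw_le_const
  have hβ := S.β_pos
  set t₀ := max t₁ (max t₂ t₃) with ht₀
  have l1 : t₁ ≤ t₀ := by simp [ht₀]
  have l2 : t₂ ≤ t₀ := by simp [ht₀]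
  have l3 : t₃ ≤ t₀ := by simp [ht₀]
  let n : ℝ → ℝ → ℝ := fun x t => S.v x t - S.m - a * (x - 1 / 2)
  let r : ℝ → ℝ → ℝ := fun x t => S.ux x t / S.u x t - n x t
  have hn : Continuous (Function.uncurry n) := by fun_prop
  have hr : Continuous (Function.uncurry r) := by
    fun_prop (disch := intros; exact (S.u_pos _ _).ne')
  let r' : ℝ → ℝ → ℝ := fun x t =>
    S.θx x t / S.u x t - S.θ x t / S.u x t * (r x t + n x t)
  have hr' : Continuous (Function.uncurry r') := by
    fun_prop (disch := intros; exact (S.u_pos _ _).ne')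
  have hrt : ∀ x ∈ Icc (0:ℝ) 1, ∀ t > 0, HasDerivAt (r x) (r' x t) t := by
    intro x hx t ht
    refine ((S.ux_div_u_dt x hx t ht).sub
      (((S.v_dt x hx t ht).sub_const S.m).sub_const (a * (x - 1 / 2)))).congr_deriv ?_
    simp only [r', r]
    ring
  let g : ℝ → ℝ := fun t => 2 * B / c' * (∫ x in (0:ℝ)..1, (S.vx x t - a) ^ 2)
    + 2 / (c' * c) * ∫ x in (0:ℝ)..1, S.θx x t ^ 2
  have hg : Tendsto g atTop (𝓝 0) := by
    have := (ha.const_mul (2 * B / c')).add (S.tendsto_integral_θx_sq.const_mul (2 / (c' * c)))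
    simpa using this
  have hR : Tendsto (fun t => ∫ x in (0:ℝ)..1, r x t ^ 2) atTop (𝓝 0) := by
    refine tendsto_zero_of_deriv_le (t₀ := t₀) (c := c / U) (by positivity)
      (continuous_integral_of_continuous (f := fun x t => r x t ^ 2) (by fun_prop) 0 1)
      (fun t _ => intervalIntegral.integral_nonneg zero_le_one fun _ _ => sq_nonneg _) hg
      (fun t ht => hasDerivAt_integral_param (f := fun x t => r x t ^ 2)
        (f' := fun x t => 2 * r x t * r' x t) zero_le_one (by fun_prop)
        (by fun_prop) (by linarith) fun x hx t ht =>
          ((hrt x hx t ht).pow 2).congr_deriv (by simp)) (fun t ht => ?_)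
    have e := integral_le_add_four (f := fun x => 2 * r x t * r' x t)
      (g₁ := fun x => r x t ^ 2) (g₂ := fun _ => 1) (g₃ := fun x => S.θx x t ^ 2)
      (g₄ := fun _ => 0) zero_le_one (-(c / U)) (2 * B / c' * ∫ x in (0:ℝ)..1, (S.vx x t - a) ^ 2)
      (2 / (c' * c)) 0
      (by fun_prop) (by fun_prop) (by fun_prop) (by fun_prop) (by fun_prop)
      (fun x hx => by
        have b1 := hθ t (l1.trans ht.le) x hx
        have b2 := hu t (l2.trans ht.le) x hx
        have b3 := hp t (l3.trans ht.le) x hx 1 (by linarith) (by linarith)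
        rw [show S.pw 1 x t = S.θ x t from rpow_one _] at b3
        have b4 := hU t (by linarith) x hx
        have b5 : n x t ^ 2 ≤ _ := S.v_sub_affine_sq_le (show 0 < t by linarith) hx a
        have hup := S.u_pos x t
        have hθp := S.θ_pos x t
        have k1 : 2 * r x t * r' x t ≤ -(S.θ x t / S.u x t * r x t ^ 2)
            + 2 * S.θ x t / S.u x t * n x t ^ 2 + 2 / (S.u x t * S.θ x t) * S.θx x t ^ 2 := by
          have : -(S.θ x t / S.u x t * r x t ^ 2)
            + 2 * S.θ x t / S.u x t * n x t ^ 2 + 2 / (S.u x t * S.θ x t) * S.θx x t ^ 2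
            - 2 * r x t * r' x t = S.θ x t / S.u x t * (1 / 2 * (r x t + 2 * n x t) ^ 2)
              + 1 / (2 * S.u x t * S.θ x t) * (S.θ x t * r x t - 2 * S.θx x t) ^ 2 := by
            simp only [r']; field_simp; ring
          have : 0 ≤ S.θ x t / S.u x t * (1 / 2 * (r x t + 2 * n x t) ^ 2)
              + 1 / (2 * S.u x t * S.θ x t) * (S.θ x t * r x t - 2 * S.θx x t) ^ 2 := by
            positivity
          linarith
        have k2 : c / U * r x t ^ 2 ≤ S.θ x t / S.u x t * r x t ^ 2 := by gcongr
        have k3 : 2 * S.θ x t / S.u x t * n x t ^ 2 ≤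
          2 * B / c' * ∫ x in (0:ℝ)..1, (S.vx x t - a) ^ 2 := by gcongr
        have k4 : 2 / (S.u x t * S.θ x t) * S.θx x t ^ 2 ≤ 2 / (c' * c) * S.θx x t ^ 2 := by
          gcongr
        linarith)
    simp only [intervalIntegral.integral_const, sub_zero, one_smul, mul_one, zero_mul,
      add_zero] at e
    simp only [g]
    linarith
  have h := (hR.const_mul (2 * U ^ 2)).add (ha.const_mul (2 * U ^ 2))
  simp only [mul_zero, add_zero] at h
  refine tendsto_of_tendsto_of_tendsto_of_le_of_le' tendsto_const_nhds h
    (Eventually.of_forall fun t => intervalIntegral.integral_nonneg zero_le_one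
      fun _ _ => sq_nonneg _) (eventually_atTop.2 ⟨1, fun t ht => ?_⟩)
  have e := integral_le_add_two (f := fun x => S.ux x t ^ 2)
    (g₁ := fun x => r x t ^ 2) (g₂ := fun _ => 1) zero_le_one (2 * U ^ 2)
    (2 * U ^ 2 * ∫ x in (0:ℝ)..1, (S.vx x t - a) ^ 2) (by fun_prop) (by fun_prop) (by fun_prop)
    (fun x hx => by
      have b4 := hU t ht x hx
      have b5 : n x t ^ 2 ≤ _ := S.v_sub_affine_sq_le (show 0 < t by linarith) hx a
      have hup := S.u_pos x t
      calc S.ux x t ^ 2 = S.u x t ^ 2 * (r x t + n x t) ^ 2 := by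
            simp only [r]; field_simp; ring
        _ ≤ U ^ 2 * (2 * r x t ^ 2 + 2 * ∫ x in (0:ℝ)..1, (S.vx x t - a) ^ 2) := by
            gcongr
            nlinarith [sq_nonneg (r x t - n x t)]
        _ = _ := by ring)
  simpa using e

theorem tendsto_integral_derivatives : Tendsto (fun t => ∫ x in (0:ℝ)..1,
    (S.ux x t ^ 2 + (S.vx x t - S.u x t) ^ 2 + S.θx x t ^ 2)) atTop (𝓝 0) := by
  obtain ⟨a, ha⟩ := S.exists_tendsto_integral_vx_sub
  have h := ((S.tendsto_integral_ux_sq ha).add (S.tendsto_integral_vx_sub_u ha)).add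
    S.tendsto_integral_θx_sq
  simp only [add_zero] at h
  refine h.congr fun t => ?_
  rw [intervalIntegral.integral_add (Continuous.intervalIntegrable (by fun_prop) _ _)
    (Continuous.intervalIntegrable (by fun_prop) _ _), intervalIntegral.integral_add
    (Continuous.intervalIntegrable (by fun_prop) _ _)
    (Continuous.intervalIntegrable (by fun_prop) _ _)]

theorem w_sq_le {t : ℝ} (ht : 0 < t) {x : ℝ} (hx : x ∈ Icc (0:ℝ) 1) :
    (S.v x t - (∫ ξ in (0:ℝ)..1, S.v ξ 0) - (∫ ξ in (0:ℝ)..x, S.u ξ t)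
      + ∫ ξ in (0:ℝ)..1, ∫ η in (0:ℝ)..ξ, S.u η t) ^ 2 ≤ ∫ x in (0:ℝ)..1,
    (S.ux x t ^ 2 + (S.vx x t - S.u x t) ^ 2 + S.θx x t ^ 2) := by
  have hc := continuous_integral_upper (show Continuous fun x => S.u x t by fun_prop) 0
  have h := sq_sub_integral_le (f := fun x => S.v x t - ∫ ξ in (0:ℝ)..x, S.u ξ t)
    (f' := fun x => S.vx x t - S.u x t) (by fun_prop) (by fun_prop)
    (fun x hx => (S.v_dx t ht x hx).sub (hasDerivAt_integral_of_continuous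
      (show Continuous fun x => S.u x t by fun_prop) 0 x)) hx
  rw [intervalIntegral.integral_sub (Continuous.intervalIntegrable (by fun_prop) _ _)
    (hc.intervalIntegrable _ _), S.integral_v_eq ht.le] at h
  have h2 := intervalIntegral.integral_mono_on (μ := volume) (zero_le_one (α := ℝ))
    (f := fun x => (S.vx x t - S.u x t) ^ 2)
    (g := fun x => S.ux x t ^ 2 + (S.vx x t - S.u x t) ^ 2 + S.θx x t ^ 2)
    (Continuous.intervalIntegrable (by fun_prop) _ _)
    (Continuous.intervalIntegrable (by fun_prop) _ _)
    (fun x _ => by linarith [sq_nonneg (S.ux x t), sq_nonneg (S.θx x t)])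
  refine le_trans (le_of_eq ?_) (h.trans h2)
  ring

end StripFlow

/-- The extension of a function on `[0,1] × [0,∞)` to the plane by coordinatewise clamping. -/
def stripExtend (f : ℝ → ℝ → ℝ) (x t : ℝ) : ℝ := f (max 0 (min 1 x)) (max 0 t)

theorem stripExtend_eq (f : ℝ → ℝ → ℝ) {x t : ℝ} (hx : x ∈ Icc (0:ℝ) 1) (ht : 0 ≤ t) :
    stripExtend f x t = f x t := by
  simp only [stripExtend, min_eq_right hx.2, max_eq_right hx.1, max_eq_right ht]

theorem clamp_mem (x : ℝ) : max 0 (min 1 x) ∈ Icc (0:ℝ) 1 :=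
  ⟨le_max_left _ _, max_le zero_le_one (min_le_left _ _)⟩

theorem continuous_stripExtend {f : ℝ → ℝ → ℝ}
    (hf : ContinuousOn (Function.uncurry f) (Icc 0 1 ×ˢ Ici 0)) :
    Continuous (Function.uncurry (stripExtend f)) :=
  hf.comp_continuous (f := fun p : ℝ × ℝ => (max 0 (min 1 p.1), max 0 p.2)) (by fun_prop)
    fun p => ⟨clamp_mem p.1, le_max_left 0 p.2⟩

theorem hasDerivAt_stripExtend_left {f : ℝ → ℝ → ℝ} {f' x t : ℝ} (hx : x ∈ Ioo (0:ℝ) 1)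
    (ht : 0 < t) (h : HasDerivWithinAt (fun y => f y t) f' (Icc 0 1) x) :
    HasDerivAt (fun y => stripExtend f y t) f' x := by
  have hn := Icc_mem_nhds hx.1 hx.2
  refine (h.hasDerivAt hn).congr_of_eventuallyEq ?_
  filter_upwards [hn] with y hy using stripExtend_eq f hy ht.le

theorem hasDerivAt_stripExtend_right {f : ℝ → ℝ → ℝ} {f' x t : ℝ} (hx : x ∈ Icc (0:ℝ) 1)
    (ht : 0 < t) (h : HasDerivWithinAt (fun s => f x s) f' (Ici 0) t) :
    HasDerivAt (stripExtend f x) f' t := by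
  refine (h.hasDerivAt (Ici_mem_nhds ht)).congr_of_eventuallyEq ?_
  filter_upwards [Ici_mem_nhds ht] with s hs using stripExtend_eq f hx hs

/-- Extension of a classical solution on the strip to the plane. -/
noncomputable def NSSol.toStripFlow (S : NSSol) : StripFlow where
  β := S.β
  β_pos := S.hβ
  u := stripExtend S.u
  v := stripExtend S.v
  θ := stripExtend S.θ
  ux := stripExtend S.ux
  vx := stripExtend S.vx
  vt := stripExtend S.vt
  θx := stripExtend S.θx
  θt := stripExtend S.θt
  u_pos x t := S.hu_pos _ (clamp_mem x) _ (le_max_left 0 t)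
  θ_pos x t := S.hθ_pos _ (clamp_mem x) _ (le_max_left 0 t)
  cu := continuous_stripExtend S.hu_cont
  cv := continuous_stripExtend S.hv_cont
  cθ := continuous_stripExtend S.hθ_cont
  cux := continuous_stripExtend S.hux_cont
  cvx := continuous_stripExtend S.hvx_cont
  cvt := continuous_stripExtend S.hvt_cont
  cθx := continuous_stripExtend S.hθx_cont
  cθt := continuous_stripExtend S.hθt_cont
  u_dx t ht x hx := by
    rw [stripExtend_eq S.ux (Ioo_subset_Icc_self hx) ht.le]
    exact hasDerivAt_stripExtend_left hx ht (S.hux x (Ioo_subset_Icc_self hx) t ht.le)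
  v_dx t ht x hx := by
    rw [stripExtend_eq S.vx (Ioo_subset_Icc_self hx) ht.le]
    exact hasDerivAt_stripExtend_left hx ht (S.hvx x (Ioo_subset_Icc_self hx) t ht.le)
  θ_dx t ht x hx := by
    rw [stripExtend_eq S.θx (Ioo_subset_Icc_self hx) ht.le]
    exact hasDerivAt_stripExtend_left hx ht (S.hθx x (Ioo_subset_Icc_self hx) t ht.le)
  u_dt x hx t ht := by
    rw [stripExtend_eq S.vx hx ht.le, stripExtend_eq S.u hx ht.le, ← S.mass x hx t ht.le,
      add_sub_cancel_right]
    exact hasDerivAt_stripExtend_right hx ht (S.hut x hx t ht.le)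
  v_dt x hx t ht := by
    rw [stripExtend_eq S.vt hx ht.le]
    exact hasDerivAt_stripExtend_right hx ht (S.hvt x hx t ht.le)
  θ_dt x hx t ht := by
    rw [stripExtend_eq S.θt hx ht.le]
    exact hasDerivAt_stripExtend_right hx ht (S.hθt x hx t ht.le)
  momentum t ht x hx := by
    rw [stripExtend_eq S.vt (Ioo_subset_Icc_self hx) ht.le]
    exact hasDerivAt_stripExtend_left (f := fun y t => (S.vx y t - S.θ y t) / S.u y t) hx ht
      (S.momentum x (Ioo_subset_Icc_self hx) t ht.le)
  energyEq t ht x hx := by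
    have hx' := Ioo_subset_Icc_self hx
    rw [stripExtend_eq S.θt hx' ht.le, stripExtend_eq S.θ hx' ht.le,
      stripExtend_eq S.vx hx' ht.le, stripExtend_eq S.u hx' ht.le]
    exact hasDerivAt_stripExtend_left (f := fun y t => S.θ y t ^ S.β * S.θx y t / S.u y t) hx ht
      (S.energyEq x hx' t ht.le)
  bc0 t := by simpa [stripExtend] using S.bc0 (max 0 t) (le_max_left 0 t)
  bc1 t := by simpa [stripExtend] using S.bc1 (max 0 t) (le_max_left 0 t)
  bcθ0 t := by simpa [stripExtend] using S.bcθ0 (max 0 t) (le_max_left 0 t)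
  bcθ1 t := by simpa [stripExtend] using S.bcθ1 (max 0 t) (le_max_left 0 t)

theorem integral_stripExtend (f : ℝ → ℝ → ℝ) {x t : ℝ} (hx : x ∈ Icc (0:ℝ) 1) (ht : 0 ≤ t) :
    ∫ ξ in (0:ℝ)..x, stripExtend f ξ t = ∫ ξ in (0:ℝ)..x, f ξ t := by
  refine intervalIntegral.integral_congr fun y hy => ?_
  rw [uIcc_of_le hx.1] at hy
  exact stripExtend_eq f ⟨hy.1, hy.2.trans hx.2⟩ ht

/-- Decay of the first derivatives in `L²` (`w_x = v_x − u`) and uniform decay of `w`. -/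
theorem derivatives_L2_decay_and_w_uniform_decay (S : NSSol) :
    Tendsto (fun t => ∫ x in (0:ℝ)..1,
        ((S.ux x t) ^ 2 + (S.vx x t - S.u x t) ^ 2 + (S.θx x t) ^ 2)) atTop (𝓝 0) ∧
    ∀ ε > (0:ℝ), ∃ T : ℝ, ∀ t ≥ T, ∀ x ∈ Icc (0:ℝ) 1, |S.w x t| < ε := by
  have key : ∀ t ≥ (0:ℝ), (∫ x in (0:ℝ)..1, (S.toStripFlow.ux x t ^ 2
      + (S.toStripFlow.vx x t - S.toStripFlow.u x t) ^ 2 + S.toStripFlow.θx x t ^ 2))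
      = ∫ x in (0:ℝ)..1, (S.ux x t ^ 2 + (S.vx x t - S.u x t) ^ 2 + S.θx x t ^ 2) := by
    intro t ht
    refine intervalIntegral.integral_congr fun x hx => ?_
    rw [uIcc_of_le zero_le_one] at hx
    simp only [NSSol.toStripFlow, stripExtend_eq _ hx ht]
  have hlim := S.toStripFlow.tendsto_integral_derivatives
  refine ⟨hlim.congr' (eventually_atTop.2 ⟨0, key⟩), fun ε hε => ?_⟩
  obtain ⟨T, hT⟩ := eventually_atTop.1 (hlim.eventually (gt_mem_nhds (pow_pos hε 2)))
  refine ⟨max T 1, fun t ht x hx => abs_lt_of_sq_lt_sq ?_ hε.le⟩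
  have ht0 : 0 < t := zero_lt_one.trans_le ((le_max_right _ _).trans ht)
  have hw : S.w x t = S.toStripFlow.v x t - (∫ ξ in (0:ℝ)..1, S.toStripFlow.v ξ 0)
      - (∫ ξ in (0:ℝ)..x, S.toStripFlow.u ξ t)
      + ∫ ξ in (0:ℝ)..1, ∫ η in (0:ℝ)..ξ, S.toStripFlow.u η t := by
    have h2 : (∫ ξ in (0:ℝ)..1, ∫ η in (0:ℝ)..ξ, stripExtend S.u η t)
        = ∫ ξ in (0:ℝ)..1, ∫ η in (0:ℝ)..ξ, S.u η t := by
      refine intervalIntegral.integral_congr fun ξ hξ => ?_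
      rw [uIcc_of_le zero_le_one] at hξ
      exact integral_stripExtend S.u hξ ht0.le
    simp only [NSSol.toStripFlow, NSSol.w]
    rw [h2, integral_stripExtend S.u hx ht0.le, stripExtend_eq S.v hx ht0.le,
      integral_stripExtend S.v (right_mem_Icc.2 zero_le_one) le_rfl]
  rw [hw]
  exact (S.toStripFlow.w_sq_le ht0 hx).trans_lt (hT t ((le_max_left _ _).trans ht))
end

section
/- For every t ≥ 0 the exact dissipation identity holds: (d/dt) ∫₀¹ (ψ(x,t)²/2 + A(θ(x,t)/A − log(θ(x,t)/A) − 1)) dx + A ∫₀¹ (z_x²/(uθ) + θ^β θ_x²/(uθ²))(x,t) dx = 0, where z(x,t) = w(x,t) + ∫₀ˣ (u(ξ,t) − θ(ξ,t)) dξ and ψ(x,t) = w(x,t) + ∫₀ˣ (u(ξ,t) − A) dξ − ∫₀¹∫₀^ξ (u(η,t) − A) dη dξ. -/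
open MeasureTheory Real Set Filter Topology

/-- The function `ψ(x,t) = w(x,t) + ∫₀ˣ (u − A) dξ − ∫₀¹∫₀^ξ (u − A) dη dξ`. -/
noncomputable def NSSol.ψ (S : NSSol) (x t : ℝ) : ℝ :=
  S.w x t + (∫ ξ in (0:ℝ)..x, (S.u ξ t - S.A))
    - ∫ ξ in (0:ℝ)..1, ∫ η in (0:ℝ)..ξ, (S.u η t - S.A)

/-- Differentiation under the integral sign on `[a, b] × [c, ∞)`, one-sided at `t = c`. -/
theorem hasDerivWithinAt_intervalIntegral_Ici {f g : ℝ → ℝ → ℝ} {a b c : ℝ} (hab : a ≤ b)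
    (hfc : ContinuousOn (fun x => f x c) (Icc a b))
    (hf : ∀ x ∈ Icc a b, ∀ t ∈ Ici c, HasDerivWithinAt (f x) (g x t) (Ici c) t)
    (hg : ContinuousOn (Function.uncurry g) (Icc a b ×ˢ Ici c)) {t : ℝ} (ht : t ∈ Ici c) :
    HasDerivWithinAt (fun s => ∫ x in a..b, f x s) (∫ x in a..b, g x t) (Ici c) t := by
  -- a continuous extension of `g` to the whole plane
  set G : ℝ → ℝ → ℝ := fun x s => g (max a (min b x)) (max c s) with hG
  have hGc : Continuous (Function.uncurry G) := by
    have hmap : Continuous fun p : ℝ × ℝ => (max a (min b p.1), max c p.2) := by fun_prop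
    exact hg.comp_continuous hmap fun p => ⟨⟨le_max_left _ _, max_le hab (min_le_left _ _)⟩,
      mem_Ici.mpr (le_max_left _ _)⟩
  have hGg : ∀ x ∈ Icc a b, ∀ s ∈ Ici c, G x s = g x s := fun x hx s hs => by
    simp only [hG]
    rw [min_eq_right hx.2, max_eq_right hx.1, max_eq_right hs]
  have hGx : ∀ x, Continuous (G x) := fun x => hGc.comp (by fun_prop : Continuous fun s => (x, s))
  have hrep : ∀ s ∈ Ici c, ∀ x ∈ Icc a b, f x s = f x c + ∫ τ in c..s, G x τ := by
    intro s hs x hx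
    have hcont : ContinuousOn (f x) (Icc c s) := fun τ hτ =>
      ((hf x hx τ hτ.1).continuousWithinAt).mono Icc_subset_Ici_self
    rw [intervalIntegral.integral_eq_sub_of_hasDerivAt_of_le hs hcont (fun τ hτ => ?_)
      ((hGx x).intervalIntegrable _ _)]
    · ring
    · rw [hGg x hx τ hτ.1.le]
      exact (hf x hx τ hτ.1.le).hasDerivAt (Ici_mem_nhds hτ.1)
  have hFub : ∀ s ∈ Ici c, ∫ x in a..b, f x s =
      (∫ x in a..b, f x c) + ∫ τ in c..s, ∫ x in a..b, G x τ := by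
    intro s hs
    have hswap : ∫ τ in c..s, ∫ x in a..b, G x τ = ∫ x in a..b, ∫ τ in c..s, G x τ := by
      refine intervalIntegral_intervalIntegral_swap (F := fun τ x => G x τ) ?_
      have hcs : Continuous (Function.uncurry fun τ x => G x τ) :=
        hGc.comp (continuous_swap : Continuous (Prod.swap : ℝ × ℝ → ℝ × ℝ))
      exact (hcs.continuousOn.integrableOn_compact
        (isCompact_uIcc.prod isCompact_uIcc)).mono_set
          (prod_mono uIoc_subset_uIcc uIoc_subset_uIcc)
    rw [hswap, ← intervalIntegral.integral_add]
    · refine intervalIntegral.integral_congr fun x hx => ?_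
      rw [uIcc_of_le hab] at hx
      exact hrep s hs x hx
    · exact hfc.intervalIntegrable_of_Icc hab
    · exact (intervalIntegral.continuous_parametric_intervalIntegral_of_continuous' hGc
        c s).intervalIntegrable _ _
  have hHc : Continuous fun τ => ∫ x in a..b, G x τ :=
    intervalIntegral.continuous_parametric_intervalIntegral_of_continuous'
      (f := fun τ x => G x τ)
      (hGc.comp (continuous_swap : Continuous (Prod.swap : ℝ × ℝ → ℝ × ℝ))) a b
  have hval : ∫ x in a..b, g x t = ∫ x in a..b, G x t :=
    intervalIntegral.integral_congr fun x hx => by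
      rw [uIcc_of_le hab] at hx
      exact (hGg x hx t ht).symm
  rw [hval]
  exact ((hHc.integral_hasStrictDerivAt c t).hasDerivAt.const_add _).hasDerivWithinAt.congr
    hFub (hFub t ht)

/-- A function continuous on `[0, 1] × [0, ∞)` is continuous in its first variable on `[0, 1]`. -/
theorem continuousOn_slice {f : ℝ → ℝ → ℝ}
    (hf : ContinuousOn (Function.uncurry f) (Icc 0 1 ×ˢ Ici 0)) {t : ℝ} (ht : t ∈ Ici (0:ℝ)) :
    ContinuousOn (fun x => f x t) (Icc 0 1) :=
  hf.comp (f := fun x : ℝ => (x, t)) (by fun_prop) fun _ hx => ⟨hx, ht⟩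

namespace NSSol

variable (S : NSSol)

/-- The constant `A` is positive, since `(∫ v₀)² < 2 E₀` by the Cauchy–Schwarz inequality. -/
theorem A_pos : 0 < S.A := by
  have h0 : (0:ℝ) ∈ Ici (0:ℝ) := self_mem_Ici
  have hv := continuousOn_slice S.hv_cont h0
  have hθ := continuousOn_slice S.hθ_cont h0
  set m := ∫ x in (0:ℝ)..1, S.v x 0 with hm
  have hpos : 0 < ∫ x in (0:ℝ)..1,
      ((S.v x 0 ^ 2 / 2 + S.θ x 0) - (m * S.v x 0 - m ^ 2 / 2)) := by
    refine intervalIntegral.intervalIntegral_pos_of_pos_on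
      (ContinuousOn.intervalIntegrable_of_Icc zero_le_one (by fun_prop)) (fun x hx => ?_)
      zero_lt_one
    have := S.hθ_pos x (Ioo_subset_Icc_self hx) 0 h0
    nlinarith [sq_nonneg (S.v x 0 - m)]
  rw [intervalIntegral.integral_sub
      (ContinuousOn.intervalIntegrable_of_Icc zero_le_one (by fun_prop))
      (ContinuousOn.intervalIntegrable_of_Icc zero_le_one (by fun_prop)),
    intervalIntegral.integral_sub
      (ContinuousOn.intervalIntegrable_of_Icc zero_le_one (by fun_prop))
      (ContinuousOn.intervalIntegrable_of_Icc zero_le_one (by fun_prop)),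
    intervalIntegral.integral_const_mul, intervalIntegral.integral_const, ← hm] at hpos
  have hE : m ^ 2 < 2 * S.E₀ := by
    unfold E₀
    simp only [sub_zero, one_smul] at hpos
    nlinarith
  have hsqrt : (6:ℝ) < √(36 + 3 * (2 * S.E₀ - m ^ 2)) :=
    Real.lt_sqrt_of_sq_lt (by linarith)
  unfold A
  linarith

/-- On the domain, `ψ = v - ∫ v₀ - A (x - 1/2)`. -/
theorem ψ_eq {x t : ℝ} (hx : x ∈ Icc (0:ℝ) 1) (ht : t ∈ Ici (0:ℝ)) :
    S.ψ x t = S.v x t - (∫ ξ in (0:ℝ)..1, S.v ξ 0) - S.A * (x - 1 / 2) := by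
  have hu := continuousOn_slice S.hu_cont ht
  have hint_u : IntervalIntegrable (fun x => S.u x t) volume 0 1 :=
    hu.intervalIntegrable_of_Icc zero_le_one
  have hsub : ∀ y ∈ Icc (0:ℝ) 1,
      ∫ ξ in (0:ℝ)..y, (S.u ξ t - S.A) = (∫ ξ in (0:ℝ)..y, S.u ξ t) - S.A * y := by
    intro y hy
    rw [intervalIntegral.integral_sub
      ((hu.mono (Icc_subset_Icc_right hy.2)).intervalIntegrable_of_Icc hy.1)
      intervalIntegrable_const, intervalIntegral.integral_const, smul_eq_mul]
    ring
  have hprim : ContinuousOn (fun y => ∫ ξ in (0:ℝ)..y, S.u ξ t) (Icc 0 1) := by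
    have := intervalIntegral.continuousOn_primitive_interval' hint_u left_mem_uIcc
    rwa [uIcc_of_le zero_le_one] at this
  have hdbl : ∫ ξ in (0:ℝ)..1, ∫ η in (0:ℝ)..ξ, (S.u η t - S.A) =
      (∫ ξ in (0:ℝ)..1, ∫ η in (0:ℝ)..ξ, S.u η t) - S.A / 2 := by
    rw [intervalIntegral.integral_congr (g := fun ξ => (∫ η in (0:ℝ)..ξ, S.u η t) - S.A * ξ)
      (fun ξ hξ => hsub ξ (by rwa [uIcc_of_le zero_le_one] at hξ)),
      intervalIntegral.integral_sub (hprim.intervalIntegrable_of_Icc zero_le_one)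
        (Continuous.intervalIntegrable (by fun_prop) _ _),
      intervalIntegral.integral_const_mul, integral_id]
    ring
  unfold ψ w
  rw [hsub x hx, hdbl]
  ring

theorem hasDerivWithinAt_ψ_fst {x t : ℝ} (hx : x ∈ Icc (0:ℝ) 1) (ht : t ∈ Ici (0:ℝ)) :
    HasDerivWithinAt (fun y => S.ψ y t) (S.vx x t - S.A) (Icc 0 1) x := by
  have hlin : HasDerivWithinAt (fun y : ℝ => S.A * (y - 1 / 2)) S.A (Icc 0 1) x := by
    simpa only [mul_one, id] using
      ((hasDerivWithinAt_id x (Icc 0 1)).sub_const (1 / 2)).const_mul S.A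
  exact (((S.hvx x hx t ht).sub_const _).sub hlin).congr (fun y hy => S.ψ_eq hy ht) (S.ψ_eq hx ht)

theorem hasDerivWithinAt_ψ_snd {x t : ℝ} (hx : x ∈ Icc (0:ℝ) 1) (ht : t ∈ Ici (0:ℝ)) :
    HasDerivWithinAt (S.ψ x) (S.vt x t) (Ici 0) t :=
  (((S.hvt x hx t ht).sub_const _).sub_const _).congr (fun _ hs => S.ψ_eq hx hs) (S.ψ_eq hx ht)

theorem continuousOn_ψ : ContinuousOn (Function.uncurry S.ψ) (Icc 0 1 ×ˢ Ici 0) := by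
  have hlin : ContinuousOn (fun p : ℝ × ℝ => S.A * (p.1 - 1 / 2)) (Icc 0 1 ×ˢ Ici 0) := by
    fun_prop
  exact ((S.hv_cont.sub continuousOn_const).sub hlin).congr fun p hp => S.ψ_eq hp.1 hp.2

/-- The time derivative of the entropy density. -/
theorem hasDerivWithinAt_entropy_density {x t : ℝ} (hx : x ∈ Icc (0:ℝ) 1)
    (ht : t ∈ Ici (0:ℝ)) :
    HasDerivWithinAt
      (fun s => S.ψ x s ^ 2 / 2 + S.A * (S.θ x s / S.A - Real.log (S.θ x s / S.A) - 1))
      (S.ψ x t * S.vt x t + S.θt x t * (1 - S.A / S.θ x t)) (Ici 0) t := by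
  have hA := S.A_pos.ne'
  have hθ := (S.hθ_pos x hx t ht).ne'
  have hd := (S.hθt x hx t ht).div_const S.A
  have h := (((S.hasDerivWithinAt_ψ_snd hx ht).pow 2).div_const 2).add
    (((hd.sub (hd.log (div_ne_zero hθ hA))).sub_const 1).const_mul S.A)
  refine h.congr_deriv ?_
  push_cast
  field_simp

/-- The space derivative of the flux `σ ψ + q (1 - A / θ)`, where `σ` is the effective stress and
`q` the heat flux, is the entropy production plus `A` times the dissipation density. -/
theorem hasDerivWithinAt_entropy_flux {x t : ℝ} (hx : x ∈ Icc (0:ℝ) 1) (ht : t ∈ Ici (0:ℝ)) :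
    HasDerivWithinAt
      (fun y => (S.vx y t - S.θ y t) / S.u y t * S.ψ y t
        + S.θ y t ^ S.β * S.θx y t / S.u y t * (1 - S.A / S.θ y t))
      ((S.ψ x t * S.vt x t + S.θt x t * (1 - S.A / S.θ x t))
        + S.A * ((S.vx x t - S.θ x t) ^ 2 / (S.u x t * S.θ x t)
          + S.θ x t ^ S.β * S.θx x t ^ 2 / (S.u x t * S.θ x t ^ 2))) (Icc 0 1) x := by
  have hθ := (S.hθ_pos x hx t ht).ne'
  have hu := (S.hu_pos x hx t ht).ne'
  have hinv := ((hasDerivWithinAt_const x (Icc 0 1) S.A).div (S.hθx x hx t ht) hθ).const_sub 1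
  refine (((S.momentum x hx t ht).mul (S.hasDerivWithinAt_ψ_fst hx ht)).add
    ((S.energyEq x hx t ht).mul hinv)).congr_deriv ?_
  simp only [Pi.div_apply]
  field_simp
  ring

end NSSol

/-- The exact dissipation identity:
`d/dt ∫₀¹ (ψ²/2 + A(θ/A − log(θ/A) − 1)) dx
  = − A ∫₀¹ (z_x²/(uθ) + θ^β θ_x²/(uθ²)) dx`,
where `z_x = w_x + u − θ = v_x − θ`. -/
theorem exact_dissipation_identity (S : NSSol) :
    ∀ t ∈ Ici (0:ℝ),
      HasDerivWithinAt
        (fun s => ∫ x in (0:ℝ)..1,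
          ((S.ψ x s) ^ 2 / 2
            + S.A * (S.θ x s / S.A - Real.log (S.θ x s / S.A) - 1)))
        (-(S.A * ∫ x in (0:ℝ)..1,
          ((S.vx x t - S.θ x t) ^ 2 / (S.u x t * S.θ x t)
            + S.θ x t ^ S.β * (S.θx x t) ^ 2 / (S.u x t * (S.θ x t) ^ 2))))
        (Ici 0) t := by
  intro t ht
  have hθ0 : ∀ p ∈ Icc (0:ℝ) 1 ×ˢ Ici (0:ℝ), Function.uncurry S.θ p ≠ 0 :=
    fun p hp => (S.hθ_pos p.1 hp.1 p.2 hp.2).ne'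
  have hψ := S.continuousOn_ψ
  have hθ_log : ContinuousOn (fun x => Real.log (S.θ x 0 / S.A)) (Icc 0 1) :=
    ((continuousOn_slice S.hθ_cont self_mem_Ici).div_const _).log fun x hx =>
      div_ne_zero (S.hθ_pos x hx 0 self_mem_Ici).ne' S.A_pos.ne'
  have hrate : ContinuousOn (Function.uncurry fun x s =>
      S.ψ x s * S.vt x s + S.θt x s * (1 - S.A / S.θ x s)) (Icc 0 1 ×ˢ Ici 0) :=
    (hψ.mul S.hvt_cont).add
      (S.hθt_cont.mul (continuousOn_const.sub (continuousOn_const.div S.hθ_cont hθ0)))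
  refine (hasDerivWithinAt_intervalIntegral_Ici zero_le_one ?_
    (fun x hx s hs => S.hasDerivWithinAt_entropy_density hx hs) hrate ht).congr_deriv ?_
  · have h1 := continuousOn_slice hψ self_mem_Ici
    have h2 := continuousOn_slice S.hθ_cont self_mem_Ici
    fun_prop
  have hrate_slice := continuousOn_slice hrate ht
  have hdiss : ContinuousOn (fun x =>
      (S.vx x t - S.θ x t) ^ 2 / (S.u x t * S.θ x t)
        + S.θ x t ^ S.β * S.θx x t ^ 2 / (S.u x t * S.θ x t ^ 2)) (Icc 0 1) := by
    have hu := continuousOn_slice S.hu_cont ht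
    have hθ := continuousOn_slice S.hθ_cont ht
    have hvx := continuousOn_slice S.hvx_cont ht
    have hθx := continuousOn_slice S.hθx_cont ht
    have hθn : ∀ x ∈ Icc (0:ℝ) 1, S.θ x t ≠ 0 := fun x hx => (S.hθ_pos x hx t ht).ne'
    have hun : ∀ x ∈ Icc (0:ℝ) 1, S.u x t ≠ 0 := fun x hx => (S.hu_pos x hx t ht).ne'
    exact (((hvx.sub hθ).pow 2).div (hu.mul hθ) fun x hx => mul_ne_zero (hun x hx) (hθn x hx)).add
      (((hθ.rpow_const fun x hx => Or.inl (hθn x hx)).mul (hθx.pow 2)).div (hu.mul (hθ.pow 2))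
        fun x hx => mul_ne_zero (hun x hx) (pow_ne_zero 2 (hθn x hx)))
  have hrate_int := hrate_slice.intervalIntegrable_of_Icc (μ := volume) zero_le_one
  have hdiss_int := (hdiss.intervalIntegrable_of_Icc (μ := volume) zero_le_one).const_mul S.A
  have key := intervalIntegral.integral_eq_sub_of_hasDerivAt_of_le zero_le_one
    (fun x hx => (S.hasDerivWithinAt_entropy_flux hx ht).continuousWithinAt)
    (fun x hx => (S.hasDerivWithinAt_entropy_flux (Ioo_subset_Icc_self hx) ht).hasDerivAt
      (Icc_mem_nhds hx.1 hx.2)) (hrate_int.add hdiss_int)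
  rw [intervalIntegral.integral_add hrate_int hdiss_int, intervalIntegral.integral_const_mul,
    S.bc0 t ht, S.bc1 t ht, S.bcθ0 t ht, S.bcθ1 t ht] at key
  simp only [zero_mul, mul_zero, zero_div, add_zero, sub_zero] at key
  linarith
end
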